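/- Let X ⊂ ℂⁿ be a domain whose Bergman pseudodistance d^b_X is a distance. If h_X(x⁰) = 0 for some point x⁰ ∈ X, then X is biholomorphically equivalent to the unit ball 𝔹ⁿ and h_X ≡ 0 on X. -/

import Mathlib

open MeasureTheory Metric Filter Topology Set
open scoped ENNReal

noncomputable section

/-- Membership in the Bergman space `A²(Ω)`: holomorphic and square-integrable. -/
def MemA2 {n : ℕ} (Ω : Set (Fin n → ℂ)) (f : (Fin n → ℂ) → ℂ) : Prop :=
  DifferentiableOn ℂ f Ω ∧ MemLp f 2 (volume.restrict Ω)

/-- `K` is the Bergman kernel of `Ω`: the reproducing kernel of `A²(Ω)`. -/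
def IsBergmanKernel {n : ℕ} (Ω : Set (Fin n → ℂ)) (K : (Fin n → ℂ) → (Fin n → ℂ) → ℂ) : Prop :=
  (∀ w ∈ Ω, MemA2 Ω fun z => K z w) ∧
  ∀ f, MemA2 Ω f → ∀ w ∈ Ω, f w = ∫ z in Ω, f z * (starRingEnd ℂ) (K z w)

/-- Wirtinger derivative `∂f/∂z_μ`. -/
def wderiv {n : ℕ} (μ : Fin n) (f : (Fin n → ℂ) → ℂ) (z : Fin n → ℂ) : ℂ :=
  (fderiv ℝ f z (Pi.single μ 1) - Complex.I * fderiv ℝ f z (Pi.single μ Complex.I)) / 2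

/-- Wirtinger derivative `∂f/∂z̄_μ`. -/
def wderivBar {n : ℕ} (μ : Fin n) (f : (Fin n → ℂ) → ℂ) (z : Fin n → ℂ) : ℂ :=
  (fderiv ℝ f z (Pi.single μ 1) + Complex.I * fderiv ℝ f z (Pi.single μ Complex.I)) / 2

/-- One-variable Wirtinger derivative `∂f/∂z`. -/
def wderiv1 (f : ℂ → ℂ) (z : ℂ) : ℂ :=
  (fderiv ℝ f z 1 - Complex.I * fderiv ℝ f z Complex.I) / 2

/-- One-variable Wirtinger derivative `∂f/∂z̄`. -/
def wderiv1Bar (f : ℂ → ℂ) (z : ℂ) : ℂ :=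
  (fderiv ℝ f z 1 + Complex.I * fderiv ℝ f z Complex.I) / 2

/-- Bergman metric tensor `g_{μν}(z) = ∂² log K(z,z) / ∂z_μ ∂z̄_ν`. -/
def bergmanTensor {n : ℕ} (K : (Fin n → ℂ) → (Fin n → ℂ) → ℂ) (μ ν : Fin n)
    (z : Fin n → ℂ) : ℂ :=
  wderiv μ (fun w => wderivBar ν (fun u => Complex.log (K u u)) w) z

/-- The hermitian quadratic form of the Bergman metric. -/
def bergmanQuad {n : ℕ} (K : (Fin n → ℂ) → (Fin n → ℂ) → ℂ) (z ξ : Fin n → ℂ) : ℝ :=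
  (∑ μ, ∑ ν, bergmanTensor K μ ν z * ξ μ * (starRingEnd ℂ) (ξ ν)).re

/-- The Bergman metric `b_Ω(z,ξ)`. -/
def bergmanMetric {n : ℕ} (K : (Fin n → ℂ) → (Fin n → ℂ) → ℂ) (z ξ : Fin n → ℂ) : ℝ :=
  Real.sqrt (bergmanQuad K z ξ)

/-- Piecewise-`C¹` curves on `[0,1]`. -/
def PiecewiseC1 {n : ℕ} (γ : ℝ → (Fin n → ℂ)) : Prop :=
  ContinuousOn γ (Set.Icc 0 1) ∧
  ∃ (k : ℕ) (t : Fin (k + 1) → ℝ), StrictMono t ∧ t 0 = 0 ∧ t (Fin.last k) = 1 ∧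
    ∀ i : Fin k, ContDiffOn ℝ 1 γ (Set.Icc (t i.castSucc) (t i.succ))

/-- The Bergman length of a curve. -/
def bergmanLength {n : ℕ} (K : (Fin n → ℂ) → (Fin n → ℂ) → ℂ) (γ : ℝ → (Fin n → ℂ)) : ℝ :=
  ∫ t in (0:ℝ)..1, bergmanMetric K (γ t) (deriv γ t)

/-- The Bergman pseudodistance of `Ω`. -/
def bergmanDist {n : ℕ} (Ω : Set (Fin n → ℂ)) (K : (Fin n → ℂ) → (Fin n → ℂ) → ℂ)
    (z w : Fin n → ℂ) : ℝ :=
  sInf { L : ℝ | ∃ γ : ℝ → (Fin n → ℂ), γ 0 = z ∧ γ 1 = w ∧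
    (∀ t ∈ Set.Icc (0:ℝ) 1, γ t ∈ Ω) ∧ PiecewiseC1 γ ∧ L = bergmanLength K γ }

/-- The Bergman ball `B_Ω(p,r)`. -/
def bergmanBall {n : ℕ} (Ω : Set (Fin n → ℂ)) (K : (Fin n → ℂ) → (Fin n → ℂ) → ℂ)
    (p : Fin n → ℂ) (r : ℝ) : Set (Fin n → ℂ) :=
  { z ∈ Ω | bergmanDist Ω K p z < r }

/-- The Bergman pseudodistance is an honest distance. -/
def BergmanDistIsDistance {n : ℕ} (Ω : Set (Fin n → ℂ))
    (K : (Fin n → ℂ) → (Fin n → ℂ) → ℂ) : Prop :=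
  ∀ z ∈ Ω, ∀ w ∈ Ω, z ≠ w → 0 < bergmanDist Ω K z w

/-- `Ω` is complete with respect to the Bergman distance. -/
def BergmanComplete {n : ℕ} (Ω : Set (Fin n → ℂ))
    (K : (Fin n → ℂ) → (Fin n → ℂ) → ℂ) : Prop :=
  ∀ x : ℕ → (Fin n → ℂ), (∀ k, x k ∈ Ω) →
    (∀ ε : ℝ, 0 < ε → ∃ N, ∀ k ≥ N, ∀ l ≥ N, bergmanDist Ω K (x k) (x l) < ε) →
    ∃ p ∈ Ω, Filter.Tendsto (fun k => bergmanDist Ω K (x k) p) Filter.atTop (nhds 0)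

/-- The Euclidean unit ball `𝔹ⁿ ⊂ ℂⁿ`. -/
def euclUnitBall (n : ℕ) : Set (Fin n → ℂ) :=
  { z | ∑ μ, ‖z μ‖ ^ 2 < 1 }

/-- The Bergman–Fridman invariant `h_X(p)`. -/
def fridmanInv {n : ℕ} (Ω : Set (Fin n → ℂ)) (K : (Fin n → ℂ) → (Fin n → ℂ) → ℂ)
    (p : Fin n → ℂ) : ℝ :=
  sInf { c : ℝ | ∃ r : ℝ, 0 < r ∧ c = 1 / r ∧ ∃ f : (Fin n → ℂ) → (Fin n → ℂ),
    DifferentiableOn ℂ f (euclUnitBall n) ∧ Set.InjOn f (euclUnitBall n) ∧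
    f '' euclUnitBall n ⊆ Ω ∧ bergmanBall Ω K p r ⊆ f '' euclUnitBall n }

/-- Biholomorphic equivalence of domains in `ℂⁿ` (an injective holomorphic map of `ℂⁿ`
restricted to a domain is automatically a biholomorphism onto its image). -/
def Biholomorphic {n : ℕ} (U V : Set (Fin n → ℂ)) : Prop :=
  ∃ f : (Fin n → ℂ) → (Fin n → ℂ),
    DifferentiableOn ℂ f U ∧ Set.InjOn f U ∧ f '' U = V

/-- The Levi form of a real-valued function `ρ` at `p` in direction `ξ`. -/
def leviForm {n : ℕ} (ρ : (Fin n → ℂ) → ℝ) (p ξ : Fin n → ℂ) : ℝ :=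
  (∑ μ, ∑ ν, wderiv μ (fun w => wderivBar ν (fun u => (ρ u : ℂ)) w) p
      * ξ μ * (starRingEnd ℂ) (ξ ν)).re

/-- The complex tangent space of `{ρ = 0}` at `p`. -/
def complexTangent {n : ℕ} (ρ : (Fin n → ℂ) → ℝ) (p : Fin n → ℂ) : Set (Fin n → ℂ) :=
  { ξ | ∑ μ, wderiv μ (fun u => (ρ u : ℂ)) p * ξ μ = 0 }

/-- Strong pseudoconvexity at a boundary point, for defining function `ρ`. -/
def StronglyPseudoconvexAt {n : ℕ} (ρ : (Fin n → ℂ) → ℝ) (p : Fin n → ℂ) : Prop :=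
  ∀ ξ ∈ complexTangent ρ p, ξ ≠ 0 → 0 < leviForm ρ p ξ

/-- `ρ` is a (global) defining function for `D`. -/
def IsDefiningFunction {n : ℕ} (D : Set (Fin n → ℂ)) (ρ : (Fin n → ℂ) → ℝ) : Prop :=
  (∀ z, z ∈ D ↔ ρ z < 0) ∧ ∀ z ∈ frontier D, fderiv ℝ ρ z ≠ 0

/-- Plurisubharmonicity via the sub-mean-value property on complex lines. -/
def PlurisubharmonicOn {n : ℕ} (u : (Fin n → ℂ) → ℝ) (Ω : Set (Fin n → ℂ)) : Prop :=
  UpperSemicontinuousOn u Ω ∧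
  ∀ (a b : Fin n → ℂ) (r : ℝ), 0 < r →
    (∀ w : ℂ, ‖w‖ ≤ r → a + w • b ∈ Ω) →
    u a ≤ (1 / (2 * Real.pi)) *
      ∫ θ in (0:ℝ)..(2 * Real.pi), u (a + ((r : ℂ) * Complex.exp (θ * Complex.I)) • b)

/-- Pseudoconvexity: `-log dist(·, ∂D)` is plurisubharmonic on `D`. -/
def IsPseudoconvex {n : ℕ} (D : Set (Fin n → ℂ)) : Prop :=
  PlurisubharmonicOn (fun z => -Real.log (Metric.infDist z Dᶜ)) D

/-- Order of vanishing at `0` of a vector-valued map on `ℂ` (`⊤` if it vanishes to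
infinite order). -/
def vanishingOrderC {n : ℕ} (f : ℂ → (Fin n → ℂ)) : ℝ≥0∞ :=
  sInf ((fun m : ℕ => (m : ℝ≥0∞)) '' { m : ℕ | iteratedDeriv m f 0 ≠ 0 })

/-- Order of vanishing at `0` of a real-valued function on `ℂ`. -/
def vanishingOrderR (g : ℂ → ℝ) : ℝ≥0∞ :=
  sInf ((fun m : ℕ => (m : ℝ≥0∞)) '' { m : ℕ | iteratedFDeriv ℝ m g 0 ≠ 0 })

/-- The D'Angelo 1-type of `ρ` at `p`. -/
def dAngeloOneType {n : ℕ} (ρ : (Fin n → ℂ) → ℝ) (p : Fin n → ℂ) : ℝ≥0∞ :=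
  ⨆ (φ : ℂ → (Fin n → ℂ)) (_ : AnalyticAt ℂ φ 0) (_ : φ 0 = p)
    (_ : vanishingOrderC (fun w => φ w - p) ≠ ⊤),
    vanishingOrderR (fun w => ρ (φ w)) / vanishingOrderC (fun w => φ w - p)

/-- The Levi form at `p` has at most one degenerate eigenvalue. -/
def LeviCorankOneAt {n : ℕ} (ρ : (Fin n → ℂ) → ℝ) (p : Fin n → ℂ) : Prop :=
  ∃ V : Submodule ℂ (Fin n → ℂ), n - 2 ≤ Module.finrank ℂ V ∧
    (V : Set (Fin n → ℂ)) ⊆ complexTangent ρ p ∧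
    ∀ ξ ∈ V, ξ ≠ 0 → 0 < leviForm ρ p ξ

/-- A bounded smooth pseudoconvex finite-type Levi corank one domain, with defining
function `ρ`. -/
def IsLeviCorankOneDomain {n : ℕ} (D : Set (Fin n → ℂ)) (ρ : (Fin n → ℂ) → ℝ) : Prop :=
  IsOpen D ∧ IsConnected D ∧ Bornology.IsBounded D ∧ IsPseudoconvex D ∧
  ContDiff ℝ (⊤ : ℕ∞) ρ ∧ IsDefiningFunction D ρ ∧
  (∀ p ∈ frontier D, dAngeloOneType ρ p ≠ ⊤) ∧
  ∀ p ∈ frontier D, LeviCorankOneAt ρ p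

/-- The open unit disc in `ℂ`. -/
def openUnitDisc : Set ℂ := Metric.ball 0 1

/-- Tautness of a domain in `ℂⁿ`. -/
def IsTaut {n : ℕ} (D : Set (Fin n → ℂ)) : Prop :=
  ∀ f : ℕ → ℂ → (Fin n → ℂ),
    (∀ k, DifferentiableOn ℂ (f k) openUnitDisc ∧ f k '' openUnitDisc ⊆ D) →
    ∃ φ : ℕ → ℕ, StrictMono φ ∧
      ((∃ g : ℂ → (Fin n → ℂ), DifferentiableOn ℂ g openUnitDisc ∧ g '' openUnitDisc ⊆ D ∧
          TendstoLocallyUniformlyOn (fun k => f (φ k)) g Filter.atTop openUnitDisc) ∨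
        ∀ S : Set ℂ, IsCompact S → S ⊆ openUnitDisc →
          ∀ L : Set (Fin n → ℂ), IsCompact L → L ⊆ D →
            ∀ᶠ k in Filter.atTop, ∀ w ∈ S, f (φ k) w ∉ L)

/-- Convergence of a sequence of domains in the local Hausdorff sense. -/
def LocalHausdorffConv {n : ℕ} (Ω : ℕ → Set (Fin n → ℂ)) (Ωl : Set (Fin n → ℂ)) : Prop :=
  (∀ S : Set (Fin n → ℂ), IsCompact S → S ⊆ Ωl → ∀ᶠ j in Filter.atTop, S ⊆ Ω j) ∧
  ∀ S : Set (Fin n → ℂ), IsCompact S →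
    (∃ j₀ : ℕ, S ⊆ interior (⋂ j, ⋂ (_ : j₀ ≤ j), Ω j)) → S ⊆ Ωl

/-- A real-valued subharmonic polynomial of degree at most `d` in one complex variable,
containing no harmonic terms. -/
def SubharmonicPolyNoHarm (P : ℂ → ℝ) (d : ℕ) : Prop :=
  (∃ c : Fin (d + 1) → Fin (d + 1) → ℂ,
    (∀ j, c j 0 = 0) ∧ (∀ k, c 0 k = 0) ∧
    ∀ w : ℂ, (P w : ℂ) = ∑ j, ∑ k, c j k * w ^ (j : ℕ) * (starRingEnd ℂ) w ^ (k : ℕ)) ∧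
  ∀ w : ℂ, 0 ≤ (wderiv1 (fun u => wderiv1Bar (fun v => (P v : ℂ)) u) w).re

/-- A strictly subharmonic real polynomial of degree `2` in one complex variable. -/
def StrictlySubharmonicPolyDeg2 (Q : ℂ → ℝ) : Prop :=
  (∃ c : Fin 3 → Fin 3 → ℂ, ∀ w : ℂ,
      (Q w : ℂ) = ∑ j, ∑ k, c j k * w ^ (j : ℕ) * (starRingEnd ℂ) w ^ (k : ℕ)) ∧
  ∀ w : ℂ, 0 < (wderiv1 (fun u => wderiv1Bar (fun v => (Q v : ℂ)) u) w).re

/-- A nontangential cone in `D` with vertex `p0 ∈ ∂D`. -/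
def IsNontangentialCone {n : ℕ} (D Γ : Set (Fin n → ℂ)) (p0 : Fin n → ℂ) : Prop :=
  Γ ⊆ D ∧ p0 ∈ closure Γ ∧
  ∃ C : ℝ, 0 < C ∧ ∀ z ∈ Γ, ‖z - p0‖ ≤ C * Metric.infDist z Dᶜ

/-- The Bergman kernel is positive on the diagonal of `Ω`. -/
def DiagPos {n : ℕ} (Ω : Set (Fin n → ℂ)) (K : (Fin n → ℂ) → (Fin n → ℂ) → ℂ) : Prop :=
  ∀ z ∈ Ω, (K z z).im = 0 ∧ 0 < (K z z).re

/-- The Bergman metric of `Ω` is positive definite. -/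
def BergPosDef {n : ℕ} (Ω : Set (Fin n → ℂ)) (K : (Fin n → ℂ) → (Fin n → ℂ) → ℂ) : Prop :=
  ∀ z ∈ Ω, ∀ ξ : Fin n → ℂ, ξ ≠ 0 → 0 < bergmanMetric K z ξ

/-- The real coordinate directions of `ℂⁿ ≃ ℝ^{2n}`. -/
def realDir {n : ℕ} (μ : Fin (2 * n)) : Fin n → ℂ :=
  Pi.single ⟨(μ : ℕ) / 2, by have := μ.isLt; omega⟩
    (if (μ : ℕ) % 2 = 0 then 1 else Complex.I)

/-- The real coefficients `g̃_{μν}` of the Bergman metric, obtained by polarization. -/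
def realTensor {n : ℕ} (K : (Fin n → ℂ) → (Fin n → ℂ) → ℂ) (μ ν : Fin (2 * n))
    (z : Fin n → ℂ) : ℝ :=
  (bergmanQuad K z (realDir μ + realDir ν) - bergmanQuad K z (realDir μ)
    - bergmanQuad K z (realDir ν)) / 2

/-- The Christoffel symbols `Γ^η_{μν}` of the Bergman metric, in real coordinates. -/
def christoffel {n : ℕ} (K : (Fin n → ℂ) → (Fin n → ℂ) → ℂ) (η μ ν : Fin (2 * n))
    (z : Fin n → ℂ) : ℝ :=
  (1 / 2) * ∑ τ : Fin (2 * n),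
    (fderiv ℝ (realTensor K ν τ) z (realDir μ)
      + fderiv ℝ (realTensor K τ μ) z (realDir ν)
      - fderiv ℝ (realTensor K μ ν) z (realDir τ))
    * (Matrix.of fun a b => realTensor K a b z)⁻¹ τ η

/-- `z0 ∈ ∂D` is a local holomorphic peak point of `D`. -/
def IsLocalPeakPoint {n : ℕ} (D : Set (Fin n → ℂ)) (z0 : Fin n → ℂ) : Prop :=
  ∃ U ∈ nhds z0, ∃ g : (Fin n → ℂ) → ℂ,
    DifferentiableOn ℂ g (U ∩ D) ∧ ContinuousOn g (closure (U ∩ D)) ∧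
    g z0 = 1 ∧ ∀ z ∈ closure (U ∩ D), z ≠ z0 → ‖g z‖ < 1

/-- A real polynomial on `ℂⁿ` containing no pluriharmonic terms. -/
def IsPolyNoPluriharm {n : ℕ} (P : (Fin n → ℂ) → ℝ) : Prop :=
  ∃ (d : ℕ) (c : (Fin n → Fin (d + 1)) → (Fin n → Fin (d + 1)) → ℂ),
    (∀ α β, (∀ j, (β j : ℕ) = 0) → c α β = 0) ∧
    (∀ α β, (∀ j, (α j : ℕ) = 0) → c α β = 0) ∧
    ∀ z, (P z : ℂ) = ∑ α, ∑ β, c α β * (∏ j, z j ^ (α j : ℕ)) *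
      ∏ j, (starRingEnd ℂ) (z j) ^ (β j : ℕ)

section SeveralVariables

variable {E F : Type*} [NormedAddCommGroup E] [NormedSpace ℂ E]
  [NormedAddCommGroup F] [NormedSpace ℂ F]

theorem norm_fderiv_le_of_ball {f : E → F} {c : E} {R C : ℝ} (hR : 0 < R)
    (hd : DifferentiableOn ℂ f (ball c R)) (hb : ∀ z ∈ ball c R, ‖f z‖ ≤ C) :
    ‖fderiv ℂ f c‖ ≤ 2 * C / R := by
  refine Complex.norm_fderiv_le_div_of_mapsTo_ball hd (fun z hz => ?_) hR
  rw [mem_closedBall, dist_eq_norm]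
  have h1 := hb z hz
  have h2 := hb c (mem_ball_self hR)
  linarith [norm_sub_le (f z) (f c)]

theorem norm_sub_le_of_ball {f : E → F} {c : E} {R C : ℝ} (hR : 0 < R)
    (hd : DifferentiableOn ℂ f (ball c (2 * R))) (hb : ∀ z ∈ ball c (2 * R), ‖f z‖ ≤ C)
    {z w : E} (hz : z ∈ ball c R) (hw : w ∈ ball c R) :
    ‖f z - f w‖ ≤ 2 * C / R * ‖z - w‖ := by
  have hsub : ∀ x ∈ ball c R, ball x R ⊆ ball c (2 * R) := fun x hx =>
    ball_subset_ball' (by rw [mem_ball] at hx; linarith)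
  refine (convex_ball c R).norm_image_sub_le_of_norm_fderiv_le (𝕜 := ℂ) (fun x hx => ?_)
    (fun x hx => ?_) hw hz
  · exact hd.differentiableAt (isOpen_ball.mem_nhds (hsub x hx (mem_ball_self hR)))
  · exact norm_fderiv_le_of_ball hR (hd.mono (hsub x hx)) fun y hy => hb y (hsub x hx hy)

theorem norm_fderiv_sub_le_of_ball {f : E → F} {c : E} {R C : ℝ} (hR : 0 < R)
    (hd : DifferentiableOn ℂ f (ball c (4 * R))) (hb : ∀ z ∈ ball c (4 * R), ‖f z‖ ≤ C)
    {z w : E} (hz : z ∈ ball c R) (hw : w ∈ ball c R) :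
    ‖fderiv ℂ f z - fderiv ℂ f w‖ ≤ 2 * C / R ^ 2 * ‖z - w‖ := by
  have hin : ∀ x ∈ ball c R, ∀ y ∈ ball w R, y + (x - w) ∈ ball c (2 * R) := by
    intro x hx y hy
    rw [mem_ball, dist_eq_norm] at *
    calc ‖y + (x - w) - c‖ = ‖(y - w) + (x - c)‖ := by congr 1; abel
      _ ≤ ‖y - w‖ + ‖x - c‖ := norm_add_le _ _
      _ < 2 * R := by linarith
  have h24 : ball c (2 * R) ⊆ ball c (4 * R) := ball_subset_ball (by linarith)
  have hdf : ∀ x ∈ ball c (2 * R), DifferentiableAt ℂ f x := fun x hx =>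
    hd.differentiableAt (isOpen_ball.mem_nhds (h24 hx))
  have hin' : ∀ y ∈ ball w R, y ∈ ball c (2 * R) := fun y hy => by simpa using hin w hw y hy
  have key := norm_fderiv_le_of_ball (f := fun x => f (x + (z - w)) - f x) (c := w)
    (C := C / R * ‖z - w‖) hR ?_ ?_
  · have e : fderiv ℂ (fun x => f (x + (z - w)) - f x) w = fderiv ℂ f z - fderiv ℂ f w := by
      have hw' := hin' w (mem_ball_self hR)
      have hz' := hin z hz w (mem_ball_self hR)
      have : DifferentiableAt ℂ (fun x => f (x + (z - w))) w :=
        ((hdf _ hz').hasFDerivAt.comp w ((hasFDerivAt_id w).add_const (z - w))).differentiableAt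
      rw [fderiv_fun_sub this (hdf w hw'), fderiv_comp_add_right]
      simp
    rw [e] at key
    refine key.trans (le_of_eq ?_)
    field_simp
  · intro y hy
    refine DifferentiableAt.differentiableWithinAt ?_
    have := ((hdf _ (hin z hz y hy)).hasFDerivAt.comp y ((hasFDerivAt_id y).add_const (z - w)))
    exact this.differentiableAt.sub (hdf y (hin' y hy))
  · intro y hy
    have := norm_sub_le_of_ball (f := f) (c := c) (R := 2 * R) (C := C) (by linarith)
      (by convert hd using 2; ring) (fun x hx => hb x (by convert hx using 2; ring))
      (hin z hz y hy) (hin' y hy)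
    convert this using 1
    rw [add_sub_cancel_left]
    field_simp

theorem tendstoUniformlyOn_of_eventually_lipschitz {α β ι : Type*} [PseudoMetricSpace α]
    [PseudoMetricSpace β] {l : Filter ι} [l.NeBot] {f : ι → α → β} {g : α → β} {s : Set α}
    {M : ℝ} (hs : TotallyBounded s)
    (hlip : ∀ᶠ i in l, ∀ x ∈ s, ∀ y ∈ s, dist (f i x) (f i y) ≤ M * dist x y)
    (hlim : ∀ x ∈ s, Tendsto (f · x) l (𝓝 (g x))) : TendstoUniformlyOn f g l s := by
  have hg : ∀ x ∈ s, ∀ y ∈ s, dist (g x) (g y) ≤ M * dist x y := fun x hx y hy =>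
    le_of_tendsto ((hlim x hx).dist (hlim y hy)) (hlip.mono fun i hi => hi x hx y hy)
  rw [Metric.tendstoUniformlyOn_iff]
  intro ε hε
  set N := |M| + 1 with hN
  have hNpos : 0 < N := by positivity
  obtain ⟨t, hts, htf, hcov⟩ := totallyBounded_iff_subset.1 hs _
    (dist_mem_uniformity (show 0 < ε / (4 * N) by positivity))
  have h1 : ∀ᶠ i in l, ∀ y ∈ t, dist (g y) (f i y) < ε / 2 :=
    (htf.eventually_all).2 fun y hy => by
      have := Metric.tendsto_nhds.1 (hlim y (hts hy)) (ε / 2) (by positivity)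
      filter_upwards [this] with i hi
      rwa [dist_comm]
  filter_upwards [h1, hlip] with i hi hl x hx
  obtain ⟨y, hy, hxy⟩ := mem_iUnion₂.1 (hcov hx)
  have hxy' : dist x y < ε / (4 * N) := hxy
  have hMd : M * dist x y ≤ ε / 4 := by
    calc M * dist x y ≤ N * dist x y := by gcongr; linarith [le_abs_self M]
      _ ≤ N * (ε / (4 * N)) := by gcongr
      _ = ε / 4 := by field_simp
  have e1 := hg x hx y (hts hy)
  have e2 := hl y (hts hy) x hx
  rw [dist_comm y x] at e2
  calc dist (g x) (f i x) ≤ dist (g x) (g y) + dist (g y) (f i y) + dist (f i y) (f i x) :=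
        dist_triangle4 _ _ _ _
    _ < ε := by linarith [hi y hy]

theorem exists_tendsto_ultrafilter_of_bounded {ι G : Type*} [NormedAddCommGroup G] [ProperSpace G]
    (l : Ultrafilter ι) (u : ι → G) (C : ℝ) (hC : ∀ᶠ i in (l : Filter ι), ‖u i‖ ≤ C) :
    ∃ y, Tendsto u l (𝓝 y) := by
  obtain ⟨y, -, hy⟩ := (isCompact_closedBall (0 : G) C).ultrafilter_le_nhds' (l.map u)
    (show ∀ᶠ i in (l : Filter ι), u i ∈ closedBall 0 C from hC.mono fun i hi => by simpa using hi)
  exact ⟨y, hy⟩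

variable [FiniteDimensional ℂ E] [FiniteDimensional ℂ F]

/-- **Montel's theorem** along an ultrafilter: a locally bounded family of holomorphic maps
converges, together with its derivatives, locally uniformly. -/
theorem exists_tendsto_of_locally_bounded {ι : Type*} (l : Ultrafilter ι) {U : Set E}
    (hU : IsOpen U) {f : ι → E → F}
    (h : ∀ z ∈ U, ∃ R > 0, ∃ C, ∀ᶠ i in (l : Filter ι),
      DifferentiableOn ℂ (f i) (ball z R) ∧ ∀ w ∈ ball z R, ‖f i w‖ ≤ C) :
    ∃ g : E → F, DifferentiableOn ℂ g U ∧ ∀ z ∈ U, ∃ R > 0, ball z R ⊆ U ∧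
      TendstoUniformlyOn f g l (ball z R) ∧
      TendstoUniformlyOn (fun i => fderiv ℂ (f i)) (fderiv ℂ g) l (ball z R) := by
  have : ProperSpace E := FiniteDimensional.proper ℂ E
  have : ProperSpace F := FiniteDimensional.proper ℂ F
  have : ProperSpace (E →L[ℂ] F) := FiniteDimensional.proper ℂ _
  have hg : ∀ z, ∃ y, z ∈ U → Tendsto (f · z) l (𝓝 y) := fun z => by
    by_cases hz : z ∈ U
    · obtain ⟨R, hR, C, hC⟩ := h z hz
      obtain ⟨y, hy⟩ := exists_tendsto_ultrafilter_of_bounded l (f · z) C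
        (hC.mono fun i hi => hi.2 z (mem_ball_self hR))
      exact ⟨y, fun _ => hy⟩
    · exact ⟨0, fun h => (hz h).elim⟩
  have hg' : ∀ z, ∃ y, z ∈ U → Tendsto (fun i => fderiv ℂ (f i) z) l (𝓝 y) := fun z => by
    by_cases hz : z ∈ U
    · obtain ⟨R, hR, C, hC⟩ := h z hz
      obtain ⟨y, hy⟩ := exists_tendsto_ultrafilter_of_bounded l (fun i => fderiv ℂ (f i) z)
        (2 * C / R) (hC.mono fun i hi => norm_fderiv_le_of_ball hR hi.1 hi.2)
      exact ⟨y, fun _ => hy⟩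
    · exact ⟨0, fun h => (hz h).elim⟩
  choose g hg using hg
  choose g' hg' using hg'
  have key : ∀ z ∈ U, ∃ R > 0, ball z R ⊆ U ∧ TendstoUniformlyOn f g l (ball z R) ∧
      TendstoUniformlyOn (fun i => fderiv ℂ (f i)) g' l (ball z R) ∧
      ∀ᶠ i in (l : Filter ι), ∀ w ∈ ball z R, DifferentiableAt ℂ (f i) w := by
    intro z hz
    obtain ⟨R, hR, C, hC⟩ := h z hz
    obtain ⟨R', hR', hsub⟩ := Metric.isOpen_iff.1 hU z hz
    set ρ := min (R / 4) R' with hρ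
    have hρ0 : 0 < ρ := lt_min (by positivity) hR'
    have h4 : 4 * ρ ≤ R := by linarith [min_le_left (R / 4) R']
    have hsub' : ball z ρ ⊆ U := (ball_subset_ball (min_le_right _ _)).trans hsub
    refine ⟨ρ, hρ0, hsub', ?_, ?_, ?_⟩
    · refine tendstoUniformlyOn_of_eventually_lipschitz (M := 2 * C / ρ)
        (isCompact_closedBall z ρ |>.totallyBounded.subset ball_subset_closedBall) ?_
        fun x hx => hg x (hsub' hx)
      filter_upwards [hC] with i hi x hx y hy
      rw [dist_eq_norm, dist_eq_norm]
      have hb : ball z (2 * ρ) ⊆ ball z R := ball_subset_ball (by linarith)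
      exact norm_sub_le_of_ball hρ0 (hi.1.mono hb) (fun w hw => hi.2 w (hb hw)) hx hy
    · refine tendstoUniformlyOn_of_eventually_lipschitz (M := 2 * C / ρ ^ 2)
        (isCompact_closedBall z ρ |>.totallyBounded.subset ball_subset_closedBall) ?_
        fun x hx => hg' x (hsub' hx)
      filter_upwards [hC] with i hi x hx y hy
      rw [dist_eq_norm, dist_eq_norm]
      have hb : ball z (4 * ρ) ⊆ ball z R := ball_subset_ball h4
      exact norm_fderiv_sub_le_of_ball hρ0 (hi.1.mono hb) (fun w hw => hi.2 w (hb hw)) hx hy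
    · filter_upwards [hC] with i hi w hw
      exact hi.1.differentiableAt (isOpen_ball.mem_nhds (ball_subset_ball (by linarith) hw))
  have hder : ∀ z ∈ U, HasFDerivAt g (g' z) z := by
    intro z hz
    obtain ⟨R, hR, hsub, h1, h2, h3⟩ := key z hz
    refine hasFDerivAt_of_tendstoUniformlyOnFilter (l := (l : Filter ι)) (𝕜 := ℂ)
      (f' := fun i => fderiv ℂ (f i)) (f := f) ?_ ?_ ?_
    · exact (tendstoUniformlyOn_iff_tendstoUniformlyOnFilter.1 h2).mono_right
        (le_principal_iff.2 (ball_mem_nhds z hR))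
    · have : ∀ᶠ p in (l : Filter ι) ×ˢ 𝓟 (ball z R), DifferentiableAt ℂ (f p.1) p.2 :=
        eventually_prod_principal_iff.2 h3
      exact (this.filter_mono
        (Filter.prod_mono le_rfl (le_principal_iff.2 (ball_mem_nhds z hR)))).mono fun p hp => hp.hasFDerivAt
    · filter_upwards [ball_mem_nhds z hR] with y hy using hg y (hsub hy)
  refine ⟨g, fun z hz => (hder z hz).differentiableAt.differentiableWithinAt, fun z hz => ?_⟩
  obtain ⟨R, hR, hsub, h1, h2, h3⟩ := key z hz
  exact ⟨R, hR, hsub, h1, h2.congr_right fun w hw => (hder w (hsub hw)).fderiv.symm⟩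

/-- The derivative of a holomorphic map of several variables is holomorphic. -/
theorem DifferentiableOn.fderiv_complex {U : Set E} (hU : IsOpen U) {f : E → F}
    (hf : DifferentiableOn ℂ f U) : DifferentiableOn ℂ (fderiv ℂ f) U := by
  have hdir : ∀ v : E, DifferentiableOn ℂ (fun z => fderiv ℂ f z v) U := by
    intro v
    have l0 : (𝓝[≠] (0 : ℂ)).NeBot := inferInstance
    let l : Ultrafilter ℂ := Ultrafilter.of (𝓝[≠] (0 : ℂ))
    have hl : (l : Filter ℂ) ≤ 𝓝[≠] (0 : ℂ) := Ultrafilter.of_le _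
    obtain ⟨g, hgd, hg⟩ := exists_tendsto_of_locally_bounded l hU
      (f := fun (t : ℂ) z => t⁻¹ • (f (z + t • v) - f z)) (by
        intro z hz
        obtain ⟨R', hR', hsub⟩ := Metric.isOpen_iff.1 hU z hz
        obtain ⟨R'', hR'', C, hC⟩ : ∃ R > 0, ∃ C, ∀ w ∈ ball z R, ‖f w‖ ≤ C := by
          have hc := (hf.continuousOn.continuousAt (hU.mem_nhds hz)).norm
          obtain ⟨R, hR, h⟩ := Metric.eventually_nhds_iff_ball.1
            (hc.eventually (gt_mem_nhds (lt_add_one _)))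
          exact ⟨R, hR, _, fun w hw => (h w hw).le⟩
        set R := min R' R'' / 4 with hRdef
        have hm : 0 < min R' R'' := lt_min hR' hR''
        have hR : 0 < R := by positivity
        have hs4 : ball z (4 * R) ⊆ U := (ball_subset_ball (by
          linarith [min_le_left R' R''])).trans hsub
        have hC4 : ∀ w ∈ ball z (4 * R), ‖f w‖ ≤ C := fun w hw => hC w (ball_subset_ball (by
          linarith [min_le_right R' R'']) hw)
        refine ⟨R, hR, 2 * C / (2 * R) * ‖v‖, hl ?_⟩
        have hsmall : ∀ᶠ t : ℂ in 𝓝[≠] 0, ‖t • v‖ < R := by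
          refine nhdsWithin_le_nhds ?_
          have : Continuous fun t : ℂ => ‖t • v‖ := by fun_prop
          exact this.continuousAt.eventually (gt_mem_nhds (by simpa using hR))
        filter_upwards [hsmall, self_mem_nhdsWithin] with t ht ht0
        have hmem : ∀ w ∈ ball z R, w + t • v ∈ ball z (2 * R) := fun w hw => by
          rw [mem_ball, dist_eq_norm] at *
          calc ‖w + t • v - z‖ = ‖(w - z) + t • v‖ := by congr 1; abel
            _ ≤ ‖w - z‖ + ‖t • v‖ := norm_add_le _ _
            _ < 2 * R := by linarith
        have hdiff : ∀ w ∈ ball z (2 * R), DifferentiableAt ℂ f w := fun w hw =>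
          hf.differentiableAt (hU.mem_nhds (hs4 (ball_subset_ball (by linarith) hw)))
        constructor
        · intro w hw
          have h1 := ((hdiff _ (hmem w hw)).hasFDerivAt.comp w
            ((hasFDerivAt_id w).add_const (t • v))).differentiableAt
          exact ((h1.sub (hdiff w (ball_subset_ball (by linarith) hw))).const_smul
            t⁻¹).differentiableWithinAt
        · intro w hw
          have h1 := norm_sub_le_of_ball (f := f) (c := z) (R := 2 * R) (C := C) (by linarith)
            (by rw [← mul_assoc]; norm_num; exact hf.mono hs4)
            (by rw [← mul_assoc]; norm_num; exact hC4)
            (hmem w hw) (ball_subset_ball (by linarith) hw)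
          rw [add_sub_cancel_left, norm_smul] at h1
          rw [norm_smul, norm_inv]
          have ht' : 0 < ‖t‖ := norm_pos_iff.2 ht0
          calc ‖t‖⁻¹ * ‖f (w + t • v) - f w‖
              ≤ ‖t‖⁻¹ * (2 * C / (2 * R) * (‖t‖ * ‖v‖)) := by gcongr
            _ = _ := by field_simp)
    refine hgd.congr fun z hz => ?_
    obtain ⟨R, hR, -, h1, -⟩ := hg z hz
    refine tendsto_nhds_unique (l := (l : Filter ℂ)) ?_
      (h1.tendsto_at (mem_ball_self hR))
    have hz' := (hf.differentiableAt (hU.mem_nhds hz)).hasFDerivAt.hasLineDerivAt v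
    have := hasDerivAt_iff_tendsto_slope_zero.1 hz'
    simpa using this.mono_left hl
  have h0 : ContDiffOn ℂ 0 f U := contDiffOn_zero.2 hf.continuousOn
  let b := Module.finBasis ℂ E
  let L : (E →L[ℂ] F) →ₗ[ℂ] (Fin (Module.finrank ℂ E) → F) :=
    { toFun := fun A i => A (b i)
      map_add' := fun A B => by ext; simp
      map_smul' := fun c A => by ext; simp }
  have hL : Function.Injective L := fun A B hAB => by
    ext v
    rw [← b.sum_repr v]
    simp only [map_sum, map_smul]
    exact Finset.sum_congr rfl fun i _ => by rw [show A (b i) = B (b i) from congrFun hAB i]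
  obtain ⟨M, hM⟩ := LinearMap.exists_leftInverse_of_injective L (LinearMap.ker_eq_bot.2 hL)
  have hM' : ∀ A, M (L A) = A := fun A => LinearMap.congr_fun hM A
  have hcomp : fderiv ℂ f = fun z =>
      LinearMap.toContinuousLinearMap M (fun i => fderiv ℂ f z (b i)) := by
    funext z
    exact (hM' (fderiv ℂ f z)).symm
  rw [hcomp]
  exact (LinearMap.toContinuousLinearMap M).differentiable.comp_differentiableOn
    (differentiableOn_pi.2 fun i => hdir (b i))

theorem DifferentiableOn.contDiffOn_complex {U : Set E} (hU : IsOpen U) {f : E → F}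
    (hf : DifferentiableOn ℂ f U) (n : ℕ) : ContDiffOn ℂ n f U := by
  induction n generalizing F with
  | zero => exact contDiffOn_zero.2 hf.continuousOn
  | succ n ih =>
    push_cast
    rw [contDiffOn_succ_iff_fderiv_of_isOpen hU]
    exact ⟨hf, by simp, contDiffOn_clm_apply.2 fun v => ih fun z hz =>
      ((hf.fderiv_complex hU) z hz).clm_apply (differentiableWithinAt_const v)⟩

end SeveralVariables

section ImplicitFunction

variable {E : Type*} [NormedAddCommGroup E] [NormedSpace ℂ E] [FiniteDimensional ℂ E]

/-- The holomorphic implicit function theorem: a regular zero set of a holomorphic function is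
parametrized by the kernel of its derivative. -/
theorem exists_parametrization_zero_set {U : Set E} (hU : IsOpen U) {g : E → ℂ}
    (hg : DifferentiableOn ℂ g U) {a : E} (ha : a ∈ U) (hga : g a = 0) {ℓ : E →L[ℂ] ℂ}
    (hℓ : fderiv ℂ g a = ℓ) (hℓ0 : ℓ ≠ 0) :
    ∃ (Φ : ℓ.ker → E) (π : E → ℓ.ker) (V : Set ℓ.ker) (N : Set E),
      IsOpen V ∧ (0 : ℓ.ker) ∈ V ∧ IsOpen N ∧ N ⊆ U ∧ a ∈ N ∧ Φ 0 = a ∧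
      DifferentiableOn ℂ Φ V ∧ HasFDerivAt Φ ℓ.ker.subtypeL 0 ∧ ContinuousOn π N ∧
      (∀ y ∈ V, Φ y ∈ N ∧ g (Φ y) = 0 ∧ π (Φ y) = y) ∧
      (∀ z ∈ N, g z = 0 → π z ∈ V ∧ Φ (π z) = z) := by
  have : CompleteSpace E := FiniteDimensional.complete ℂ E
  obtain ⟨v₀, hv₀⟩ : ∃ v, ℓ v ≠ 0 := by
    by_contra! h
    exact hℓ0 (ContinuousLinearMap.ext h)
  obtain ⟨v, hv⟩ : ∃ v, ℓ v = 1 := ⟨(ℓ v₀)⁻¹ • v₀, by simp [hv₀]⟩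
  let T : E → E := fun z => z + (g z - ℓ (z - a)) • v
  have hT1 : ContDiffAt ℂ 1 T a := by
    have h1 : ContDiffAt ℂ 1 g a := by
      have := (hg.contDiffOn_complex hU 1).contDiffAt (hU.mem_nhds ha)
      exact_mod_cast this
    have h2 : ContDiffAt ℂ 1 (fun z => ℓ (z - a)) a :=
      ℓ.contDiff.contDiffAt.comp a (contDiffAt_id.sub contDiffAt_const)
    exact contDiffAt_id.add ((h1.sub h2).smul contDiffAt_const)
  have hT' : HasFDerivAt T ((ContinuousLinearEquiv.refl ℂ E : E ≃L[ℂ] E) : E →L[ℂ] E) a := by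
    have h1 : HasFDerivAt g ℓ a := hℓ ▸ (hg.differentiableAt (hU.mem_nhds ha)).hasFDerivAt
    have h2 : HasFDerivAt (fun z => ℓ (z - a)) ℓ a :=
      ℓ.hasFDerivAt.comp a ((hasFDerivAt_id a).sub_const a)
    have h3 : HasFDerivAt T (ContinuousLinearMap.id ℂ E + (ℓ - ℓ).smulRight v) a :=
      (hasFDerivAt_id a).add ((h1.sub h2).smul_const v)
    have h4 : ((ContinuousLinearEquiv.refl ℂ E : E ≃L[ℂ] E) : E →L[ℂ] E) =
        ContinuousLinearMap.id ℂ E + (ℓ - ℓ).smulRight v := by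
      ext x
      simp
    rw [h4]
    exact h3
  have hTa : T a = a := by simp [T, hga]
  let e := hT1.toOpenPartialHomeomorph T hT' one_ne_zero
  have he : ∀ z, e z = T z := fun z => rfl
  have haS : a ∈ e.source := hT1.mem_toOpenPartialHomeomorph_source hT' one_ne_zero
  have haT : a ∈ e.target := by
    have := e.map_source haS
    rwa [he, hTa] at this
  have hsa : e.symm a = a := by
    have := e.left_inv haS
    rwa [he, hTa] at this
  have hsymm : ContDiffAt ℂ 1 e.symm a := by
    have := hT1.to_localInverse hT' one_ne_zero
    rw [hTa] at this
    exact this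
  obtain ⟨O, hO, hOo, haO⟩ := _root_.eventually_nhds_iff.1 (hsymm.eventually (by simp))
  have hdO : ∀ y ∈ O, DifferentiableAt ℂ e.symm y := fun y hy =>
    (hO y hy).differentiableAt one_ne_zero
  have hℓT : ∀ z, ℓ (T z - a) = g z := fun z => by
    simp only [T, map_sub, map_add, map_smul, hv, smul_eq_mul]
    ring
  let p : E →L[ℂ] ℓ.ker := (ContinuousLinearMap.id ℂ E - ℓ.smulRight v).codRestrict ℓ.ker (by
    intro x
    simp [LinearMap.mem_ker, hv])
  have hp : ∀ x : E, (p x : E) = x - ℓ x • v := fun x => rfl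
  have hT_cont : ContinuousOn T e.source := e.continuousOn
  let N : Set E := (e.source ∩ e ⁻¹' O) ∩ U
  let A : ℓ.ker → E := fun y => a + y
  have hA : Continuous A := by fun_prop
  let V : Set ℓ.ker := A ⁻¹' ((e.target ∩ e.symm ⁻¹' U) ∩ O)
  have hπ : ∀ z, g z = 0 → A (p (T z - a)) = T z := fun z hz => by
    simp only [A, hp, hℓT, hz]
    simp
  refine ⟨fun y => e.symm (A y), fun z => p (T z - a), V, N,
    ?_, ?_, ?_, ?_, ?_, ?_, ?_, ?_, ?_, ?_, ?_⟩
  · exact ((e.isOpen_inter_preimage_symm hU).inter hOo).preimage hA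
  · simp only [V, A, mem_preimage, mem_inter_iff, ZeroMemClass.coe_zero, add_zero]
    exact ⟨⟨haT, by rwa [hsa]⟩, haO⟩
  · exact (e.isOpen_inter_preimage hOo).inter hU
  · exact inter_subset_right
  · exact ⟨⟨haS, by rw [mem_preimage, he, hTa]; exact haO⟩, ha⟩
  · simp [A, hsa]
  · intro y hy
    refine ((hdO _ hy.2).comp y ?_).differentiableWithinAt
    exact (ℓ.ker.subtypeL.differentiableAt).const_add a
  · have h1 : HasFDerivAt e.symm ((ContinuousLinearEquiv.refl ℂ E).symm : E →L[ℂ] E) a := by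
      refine e.hasFDerivAt_symm haT ?_
      rw [hsa]
      exact hT'
    have h2 : HasFDerivAt A ℓ.ker.subtypeL 0 := (ℓ.ker.subtypeL.hasFDerivAt).const_add a
    have h3 : HasFDerivAt e.symm ((ContinuousLinearEquiv.refl ℂ E).symm : E →L[ℂ] E) (A 0) := by
      simpa [A] using h1
    exact h3.comp 0 h2
  · refine p.continuous.comp_continuousOn ?_
    exact (hT_cont.mono fun z hz => hz.1.1).sub continuousOn_const
  · intro y hy
    have hr : T (e.symm (A y)) = A y := e.right_inv hy.1.1
    have hg0 : g (e.symm (A y)) = 0 := by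
      rw [← hℓT, hr]
      simp [A]
    refine ⟨⟨⟨e.map_target hy.1.1, ?_⟩, hy.1.2⟩, hg0, ?_⟩
    · rw [mem_preimage, e.right_inv hy.1.1]
      exact hy.2
    · rw [Subtype.ext_iff, hp, hr]
      simp [A]
  · intro z hz hgz
    have h2 : e.symm (T z) = z := e.left_inv hz.1.1
    refine ⟨?_, ?_⟩
    · change A (p (T z - a)) ∈ (e.target ∩ e.symm ⁻¹' U) ∩ O
      rw [hπ z hgz]
      exact ⟨⟨e.map_source hz.1.1, by rw [mem_preimage, h2]; exact hz.2⟩, hz.1.2⟩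
    · change e.symm (A (p (T z - a))) = z
      rw [hπ z hgz, h2]

end ImplicitFunction

section Discs

universe u

/-- The functions obtained from a family `𝓕` by taking `k` directional derivatives. -/
def iteratedDirDeriv {E : Type u} [NormedAddCommGroup E] [NormedSpace ℂ E] (𝓕 : Set (E → ℂ)) :
    ℕ → Set (E → ℂ)
  | 0 => 𝓕
  | k + 1 => {h | ∃ g ∈ iteratedDirDeriv 𝓕 k, ∃ v : E, h = fun z => fderiv ℂ g z v}

theorem differentiableOn_of_mem_iteratedDirDeriv {E : Type u} [NormedAddCommGroup E]
    [NormedSpace ℂ E] [FiniteDimensional ℂ E] {𝓕 : Set (E → ℂ)} {U : Set E} (hU : IsOpen U)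
    (h𝓕 : ∀ f ∈ 𝓕, DifferentiableOn ℂ f U) (k : ℕ) :
    ∀ g ∈ iteratedDirDeriv 𝓕 k, DifferentiableOn ℂ g U := by
  induction k with
  | zero => exact h𝓕
  | succ k ih =>
    rintro _ ⟨g, hg, v, rfl⟩
    exact ((ih g hg).fderiv_complex hU).clm_apply (differentiableOn_const v)

/-- A holomorphic function all of whose directional derivatives vanish at a point vanishes on balls
about that point. -/
theorem eq_zero_of_iteratedDirDeriv_eq_zero {E : Type u} [NormedAddCommGroup E]
    [NormedSpace ℂ E] [FiniteDimensional ℂ E] {𝓕 : Set (E → ℂ)} {a : E} {r : ℝ}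
    (h𝓕 : ∀ f ∈ 𝓕, DifferentiableOn ℂ f (ball a r))
    (h0 : ∀ k, ∀ g ∈ iteratedDirDeriv 𝓕 k, g a = 0) {f : E → ℂ} (hf : f ∈ 𝓕) {z : E}
    (hz : z ∈ ball a r) : f z = 0 := by
  have hr : 0 < r := pos_of_mem_ball hz
  set v := z - a with hv
  have hvr : ‖v‖ < r := by rwa [hv, ← dist_eq_norm]
  obtain ⟨ρ, hρ1, hρ⟩ : ∃ ρ : ℝ, 1 < ρ ∧ ρ * ‖v‖ < r := by
    rcases eq_or_ne v 0 with h | h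
    · exact ⟨2, by norm_num, by simpa [h] using hr⟩
    · have hv0 : 0 < ‖v‖ := norm_pos_iff.2 h
      obtain ⟨ρ, h1, h2⟩ := exists_between ((one_lt_div hv0).2 hvr)
      exact ⟨ρ, h1, (lt_div_iff₀ hv0).1 h2⟩
  have hmem : ∀ t ∈ ball (0 : ℂ) ρ, a + t • v ∈ ball a r := by
    intro t ht
    rw [mem_ball_zero_iff] at ht
    rw [mem_ball, dist_eq_norm, add_sub_cancel_left, norm_smul]
    exact (mul_le_mul_of_nonneg_right ht.le (norm_nonneg _)).trans_lt hρ
  have hd : ∀ k, ∀ g ∈ iteratedDirDeriv 𝓕 k, ∀ t ∈ ball (0 : ℂ) ρ,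
      HasDerivAt (fun s : ℂ => g (a + s • v)) (fderiv ℂ g (a + t • v) v) t := by
    intro k g hg t ht
    have h1 := ((differentiableOn_of_mem_iteratedDirDeriv isOpen_ball h𝓕 k g hg).differentiableAt
      (isOpen_ball.mem_nhds (hmem t ht))).hasFDerivAt
    have h2 : HasDerivAt (fun s : ℂ => a + s • v) v t := by
      simpa using ((hasDerivAt_id t).smul_const v).const_add a
    exact h1.comp_hasDerivAt t h2
  have hit : ∀ k, ∃ g ∈ iteratedDirDeriv 𝓕 k, ∀ t ∈ ball (0 : ℂ) ρ,
      iteratedDeriv k (fun s : ℂ => f (a + s • v)) t = g (a + t • v) := by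
    intro k
    induction k with
    | zero => exact ⟨f, hf, fun t _ => by simp⟩
    | succ k ih =>
      obtain ⟨g, hg, hgt⟩ := ih
      refine ⟨_, ⟨g, hg, v, rfl⟩, fun t ht => ?_⟩
      rw [iteratedDeriv_succ]
      have : iteratedDeriv k (fun s : ℂ => f (a + s • v)) =ᶠ[𝓝 t] fun s => g (a + s • v) :=
        Filter.eventuallyEq_of_mem (isOpen_ball.mem_nhds ht) hgt
      rw [this.deriv_eq]
      exact (hd k g hg t ht).deriv
  have hdo : DifferentiableOn ℂ (fun s : ℂ => f (a + s • v)) (ball 0 ρ) := fun t ht =>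
    (hd 0 f hf t ht).differentiableAt.differentiableWithinAt
  have h1 : (1 : ℂ) ∈ ball (0 : ℂ) ρ := by simpa using hρ1
  have := Complex.taylorSeries_eq_on_ball' h1 hdo
  have h2 : f z = f (a + (1 : ℂ) • v) := by simp [hv]
  rw [h2, ← this]
  convert tsum_zero with k
  obtain ⟨g, hg, hgt⟩ := hit k
  rw [hgt 0 (by simpa using zero_lt_one.trans hρ1)]
  simp [h0 k g hg]

/-- If all functions of a family of holomorphic functions vanish on a nonempty set without isolated
points, then they vanish on a holomorphic disc. -/
theorem exists_disc_of_preperfect (m : ℕ) : ∀ {E : Type u} [NormedAddCommGroup E]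
    [NormedSpace ℂ E] [FiniteDimensional ℂ E], Module.finrank ℂ E = m →
    ∀ {𝓕 : Set (E → ℂ)} {U W : Set E}, IsOpen U → (∀ f ∈ 𝓕, DifferentiableOn ℂ f U) →
    W ⊆ U → W.Nonempty → Preperfect W → (∀ f ∈ 𝓕, ∀ z ∈ W, f z = 0) →
    ∃ ψ : ℂ → E, DifferentiableOn ℂ ψ (ball 0 2) ∧ ψ 0 ≠ ψ 1 ∧
      ∀ t ∈ ball (0 : ℂ) 2, ψ t ∈ U ∧ ∀ f ∈ 𝓕, f (ψ t) = 0 := by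
  induction m with
  | zero =>
    intro E _ _ _ hE 𝓕 U W _ _ _ hne hp _
    obtain ⟨z, hz⟩ := hne
    obtain ⟨y, _, hy⟩ := preperfect_iff_nhds.1 hp z hz univ univ_mem
    have := Module.finrank_zero_iff.1 hE
    exact (hy (Subsingleton.elim _ _)).elim
  | succ m ih =>
    intro E _ _ _ hE 𝓕 U W hU h𝓕 hWU hne hp h0
    by_cases hall : ∀ k, ∀ g ∈ iteratedDirDeriv 𝓕 k, ∀ z ∈ W, g z = 0
    · obtain ⟨a, ha⟩ := hne
      obtain ⟨b, _, hb⟩ := preperfect_iff_nhds.1 hp a ha univ univ_mem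
      obtain ⟨r, hr, hrU⟩ := Metric.isOpen_iff.1 hU a (hWU ha)
      set v : E := ((r / (2 * ‖b - a‖) : ℝ) : ℂ) • (b - a) with hv
      have hba : 0 < ‖b - a‖ := norm_pos_iff.2 (sub_ne_zero.2 hb)
      have hvn : ‖v‖ = r / 2 := by
        rw [hv, norm_smul, Complex.norm_real, Real.norm_of_nonneg (by positivity)]
        field_simp
      have hmem : ∀ t ∈ ball (0 : ℂ) 2, a + t • v ∈ ball a r := by
        intro t ht
        rw [mem_ball_zero_iff] at ht
        rw [mem_ball, dist_eq_norm, add_sub_cancel_left, norm_smul, hvn]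
        nlinarith
      refine ⟨fun t => a + t • v, by fun_prop, ?_, fun t ht => ⟨hrU (hmem t ht), fun f hf => ?_⟩⟩
      · have : v ≠ 0 := norm_pos_iff.1 (by rw [hvn]; positivity)
        simpa using this
      · exact eq_zero_of_iteratedDirDeriv_eq_zero (fun f hf => (h𝓕 f hf).mono hrU)
          (fun k g hg => hall k g hg a ha) hf (hmem t ht)
    · push Not at hall
      classical
      have hk := Nat.find_spec hall
      have hmin := fun j => Nat.find_min hall (m := j)
      generalize Nat.find hall = k at hk hmin
      obtain ⟨h, hh, a, haW, ha0⟩ := hk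
      cases k with
      | zero => exact (ha0 (h0 h hh a haW)).elim
      | succ j =>
        obtain ⟨g, hg, v, rfl⟩ := hh
        have hgW : ∀ z ∈ W, g z = 0 := by
          have := hmin j (Nat.lt_succ_self j)
          push Not at this
          exact this g hg
        have hgd := differentiableOn_of_mem_iteratedDirDeriv hU h𝓕 j g hg
        have hℓ0 : fderiv ℂ g a ≠ 0 := fun h => ha0 (by simp [h])
        obtain ⟨Φ, π, V, N, hV, h0V, hN, hNU, haN, hΦ0, hΦd, -, hπ, hΦV, hΦN⟩ :=
          exists_parametrization_zero_set hU hgd (hWU haW) (hgW a haW) rfl hℓ0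
        have hker : Module.finrank ℂ (fderiv ℂ g a).ker = m := by
          have h1 := LinearMap.finrank_range_add_finrank_ker (fderiv ℂ g a : E →ₗ[ℂ] ℂ)
          have h2 : LinearMap.range (fderiv ℂ g a : E →ₗ[ℂ] ℂ) = ⊤ :=
            LinearMap.range_eq_top.2 (LinearMap.surjective (by
              intro h
              exact hℓ0 (ContinuousLinearMap.ext fun x => LinearMap.congr_fun h x)))
          rw [h2, finrank_top, Module.finrank_self, hE] at h1
          change Module.finrank ℂ (LinearMap.ker (fderiv ℂ g a : E →ₗ[ℂ] ℂ)) = m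
          omega
        obtain ⟨ψ, hψd, hψ01, hψ⟩ := ih hker (𝓕 := (fun f => f ∘ Φ) '' 𝓕) (U := V)
          (W := V ∩ Φ ⁻¹' W) hV (by
            rintro _ ⟨f, hf, rfl⟩
            exact (h𝓕 f hf).comp hΦd fun y hy => hNU (hΦV y hy).1)
          inter_subset_left ⟨0, h0V, by rwa [mem_preimage, hΦ0]⟩ (by
            rw [preperfect_iff_nhds]
            rintro y ⟨hyV, hyW⟩ O hO
            obtain ⟨hyN, -, hyπ⟩ := hΦV y hyV
            have h1 : N ∩ π ⁻¹' O ∈ 𝓝 (Φ y) := inter_mem (hN.mem_nhds hyN)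
              ((hπ.continuousAt (hN.mem_nhds hyN)).preimage_mem_nhds (by rwa [hyπ]))
            obtain ⟨z, ⟨⟨hzN, hzO⟩, hzW⟩, hzy⟩ := preperfect_iff_nhds.1 hp _ hyW _ h1
            obtain ⟨h2, h3⟩ := hΦN z hzN (hgW z hzW)
            refine ⟨π z, ⟨hzO, h2, ?_⟩, ?_⟩
            · rwa [mem_preimage, h3]
            · rintro rfl
              exact hzy h3.symm) (by
            rintro _ ⟨f, hf, rfl⟩ y ⟨-, hy⟩
            exact h0 f hf _ hy)
        refine ⟨Φ ∘ ψ, hΦd.comp hψd fun t ht => (hψ t ht).1, ?_, fun t ht => ⟨?_, fun f hf => ?_⟩⟩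
        · intro h
          apply hψ01
          rw [← (hΦV _ (hψ 0 (by simp)).1).2.2, ← (hΦV _ (hψ 1 (by simp)).1).2.2]
          exact congrArg π h
        · exact hNU (hΦV _ (hψ t ht).1).1
        · exact (hψ t ht).2 _ ⟨f, hf, rfl⟩

/-- The common zero set of a family of holomorphic functions is countable or contains a holomorphic
disc. -/
theorem exists_disc_of_not_countable {E : Type u} [NormedAddCommGroup E]
    [NormedSpace ℂ E] [FiniteDimensional ℂ E] {𝓕 : Set (E → ℂ)} {U : Set E} (hU : IsOpen U)
    (h𝓕 : ∀ f ∈ 𝓕, DifferentiableOn ℂ f U) (hc : ¬ {z ∈ U | ∀ f ∈ 𝓕, f z = 0}.Countable) :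
    ∃ ψ : ℂ → E, DifferentiableOn ℂ ψ (ball 0 2) ∧ ψ 0 ≠ ψ 1 ∧
      ∀ t ∈ ball (0 : ℂ) 2, ψ t ∈ U ∧ ∀ f ∈ 𝓕, f (ψ t) = 0 := by
  have : ProperSpace E := FiniteDimensional.proper ℂ E
  set Z := {z ∈ U | ∀ f ∈ 𝓕, f z = 0} with hZ
  obtain ⟨D, hD, hDne, -⟩ := exists_perfect_nonempty_of_isClosed_of_not_countable
    (isClosed_univ (X := Z)) (by rwa [countable_univ_iff, countable_coe_iff])
  refine exists_disc_of_preperfect _ rfl (W := (↑) '' D) hU h𝓕 ?_ (hDne.image _) ?_ ?_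
  · rintro _ ⟨z, -, rfl⟩
    exact z.2.1
  · rw [preperfect_iff_nhds]
    rintro _ ⟨z, hz, rfl⟩ O hO
    obtain ⟨y, ⟨hy, hyD⟩, hyz⟩ := preperfect_iff_nhds.1 hD.acc z hz _
      (continuous_subtype_val.continuousAt.preimage_mem_nhds hO)
    exact ⟨y, ⟨hy, y, hyD, rfl⟩, fun h => hyz (Subtype.ext h)⟩
  · rintro f hf _ ⟨z, -, rfl⟩
    exact z.2.2 f hf

end Discs

section Tubes

variable {E : Type*} [NormedAddCommGroup E] [NormedSpace ℂ E]

/-- Near any point of a domain of dimension at least two there is a tube of closed discs whose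
boundary circles avoid a given countable relatively closed set, and some of which avoid this set
entirely. -/
theorem exists_tube_of_countable (hE : 1 < Module.finrank ℂ E) {U Z : Set E} (hU : IsOpen U)
    (hZ : Z.Countable) (hUZ : IsOpen (U \ Z)) {a : E} (ha : a ∈ U) :
    ∃ v : E, ∃ δ > 0, (∀ w ∈ closedBall a δ, ∀ ζ : ℂ, ‖ζ‖ ≤ 1 → w + ζ • v ∈ U) ∧
      (∀ w ∈ closedBall a δ, ∀ ζ : ℂ, ‖ζ‖ = 1 → w + ζ • v ∉ Z) ∧
      ∀ ε > 0, ∃ w ∈ ball a ε, ∀ ζ : ℂ, ‖ζ‖ ≤ 1 → w + ζ • v ∉ Z := by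
  have : Nontrivial E := Module.nontrivial_of_finrank_pos (R := ℂ) (by omega)
  obtain ⟨v₀, hv₀⟩ := exists_ne (0 : E)
  obtain ⟨r, hr, hrU⟩ := Metric.isOpen_iff.1 hU a ha
  have hn : 0 < ‖v₀‖ := norm_pos_iff.2 hv₀
  have hbad : {ρ : ℝ | ∃ ζ : ℂ, ‖ζ‖ = ρ ∧ a + ζ • v₀ ∈ Z}.Countable := by
    have : {ρ : ℝ | ∃ ζ : ℂ, ‖ζ‖ = ρ ∧ a + ζ • v₀ ∈ Z} ⊆
        ⋃ z ∈ Z, {ρ | ∃ ζ : ℂ, ‖ζ‖ = ρ ∧ a + ζ • v₀ = z} := by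
      rintro ρ ⟨ζ, hζ, hz⟩
      exact mem_biUnion hz ⟨ζ, hζ, rfl⟩
    refine (hZ.biUnion fun z _ => Set.Subsingleton.countable ?_).mono this
    rintro _ ⟨ζ, rfl, h1⟩ _ ⟨ξ, rfl, h2⟩
    have : ζ • v₀ = ξ • v₀ := add_left_cancel (h1.trans h2.symm)
    rw [smul_left_injective ℂ hv₀ this]
  obtain ⟨ρ, hρ, hρ0, hρr⟩ : ∃ ρ ∈ {ρ : ℝ | ∃ ζ : ℂ, ‖ζ‖ = ρ ∧ a + ζ • v₀ ∈ Z}ᶜ,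
      0 < ρ ∧ ρ < r / ‖v₀‖ := by
    obtain ⟨ρ, h1, h2⟩ := (hbad.dense_compl ℝ).exists_between (div_pos hr hn)
    exact ⟨ρ, h1, h2.1, h2.2⟩
  set v : E := (ρ : ℂ) • v₀ with hv
  have hv0 : v ≠ 0 := smul_ne_zero (by exact_mod_cast hρ0.ne') hv₀
  have hvn : ‖v‖ < r := by
    rw [hv, norm_smul, Complex.norm_real, Real.norm_of_nonneg hρ0.le]
    exact (lt_div_iff₀ hn).1 hρr
  have hc : Continuous fun ζ : ℂ => a + ζ • v := by fun_prop
  obtain ⟨δ₁, hδ₁, h1⟩ := ((isCompact_closedBall (0 : ℂ) 1).image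
    hc).exists_cthickening_subset_open hU (by
      rintro _ ⟨ζ, hζ, rfl⟩
      apply hrU
      rw [mem_closedBall_zero_iff] at hζ
      rw [mem_ball, dist_eq_norm, add_sub_cancel_left, norm_smul]
      exact (mul_le_of_le_one_left (norm_nonneg _) hζ).trans_lt hvn)
  obtain ⟨δ₂, hδ₂, h2⟩ := ((isCompact_sphere (0 : ℂ) 1).image
    hc).exists_cthickening_subset_open hUZ (by
      rintro _ ⟨ζ, hζ, rfl⟩
      rw [mem_sphere_zero_iff_norm] at hζ
      refine ⟨hrU ?_, fun hz => hρ ⟨ζ * ρ, ?_, ?_⟩⟩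
      · rw [mem_ball, dist_eq_norm, add_sub_cancel_left, norm_smul, hζ, one_mul]
        exact hvn
      · rw [norm_mul, hζ, one_mul, Complex.norm_real, Real.norm_of_nonneg hρ0.le]
      · rwa [mul_smul])
  have hdist : ∀ w (ζ : ℂ), dist (w + ζ • v) (a + ζ • v) = dist w a := fun w ζ =>
    dist_add_right _ _ _
  refine ⟨v, min δ₁ δ₂, lt_min hδ₁ hδ₂, fun w hw ζ hζ => ?_, fun w hw ζ hζ => ?_, fun ε hε => ?_⟩
  · refine h1 (mem_cthickening_of_dist_le _ _ _ _ (mem_image_of_mem _ ?_)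
      ((hdist w ζ).trans_le (hw.trans (min_le_left _ _))))
    rwa [mem_closedBall_zero_iff]
  · refine (h2 (mem_cthickening_of_dist_le _ _ _ _ (mem_image_of_mem _ ?_)
      ((hdist w ζ).trans_le (hw.trans (min_le_right _ _))))).2
    rwa [mem_sphere_zero_iff_norm]
  · obtain ⟨u, hu⟩ : ∃ u : E, ∀ c : ℂ, c • v ≠ u := by
      by_contra! h
      have := finrank_le_one v h
      omega
    have hu0 : u ≠ 0 := fun h => hu 0 (by simp [h])
    have hbad : {s : ℂ | ∃ ζ : ℂ, a + s • u + ζ • v ∈ Z}.Countable := by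
      have : {s : ℂ | ∃ ζ : ℂ, a + s • u + ζ • v ∈ Z} ⊆
          ⋃ z ∈ Z, {s : ℂ | ∃ ζ : ℂ, a + s • u + ζ • v = z} := by
        rintro s ⟨ζ, hz⟩
        exact mem_biUnion hz ⟨ζ, rfl⟩
      refine (hZ.biUnion fun z _ => Set.Subsingleton.countable ?_).mono this
      rintro s ⟨ζ, h1⟩ t ⟨ξ, h2⟩
      by_contra hst
      have h3 : (s - t) • u = (ξ - ζ) • v := by
        have h4 := h1.trans h2.symm
        rw [add_assoc, add_assoc] at h4
        have h5 := add_left_cancel h4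
        rw [sub_smul, sub_smul, sub_eq_sub_iff_add_eq_add, h5, add_comm]
      refine hu ((s - t)⁻¹ * (ξ - ζ)) ?_
      rw [mul_smul, ← h3, inv_smul_smul₀ (sub_ne_zero.2 hst)]
    obtain ⟨s, hs, hsb⟩ := (hbad.dense_compl ℂ).exists_mem_open (isOpen_ball (x := (0 : ℂ))
      (ε := ε / ‖u‖)) ⟨0, mem_ball_self (div_pos hε (norm_pos_iff.2 hu0))⟩
    refine ⟨a + s • u, ?_, fun ζ _ hz => hs ⟨ζ, hz⟩⟩
    rw [mem_ball_zero_iff, lt_div_iff₀ (norm_pos_iff.2 hu0)] at hsb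
    rwa [mem_ball, dist_eq_norm, add_sub_cancel_left, norm_smul]

/-- The maximum principle on a closed disc. -/
theorem norm_le_of_forall_circle {F : Type*} [NormedAddCommGroup F] [NormedSpace ℂ F]
    {h : E → F} {w v : E} {C : ℝ}
    (hd : ∀ ζ : ℂ, ‖ζ‖ ≤ 1 → DifferentiableAt ℂ h (w + ζ • v))
    (hC : ∀ ζ : ℂ, ‖ζ‖ = 1 → ‖h (w + ζ • v)‖ ≤ C) {ζ : ℂ} (hζ : ‖ζ‖ ≤ 1) :
    ‖h (w + ζ • v)‖ ≤ C := by
  refine Complex.norm_le_of_forall_mem_frontier_norm_le (f := fun ζ : ℂ => h (w + ζ • v))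
    (isBounded_ball (x := (0 : ℂ)) (r := 1)) ?_ ?_ (z := ζ) ?_
  · refine DifferentiableOn.diffContOnCl (DifferentiableOn.mono (t := closedBall 0 1) ?_
      closure_ball_subset_closedBall)
    intro t ht
    rw [mem_closedBall_zero_iff] at ht
    exact ((hd t ht).comp t (by fun_prop : DifferentiableAt ℂ (fun ζ : ℂ => w + ζ • v) t)
      ).differentiableWithinAt
  · intro t ht
    rw [frontier_ball _ one_ne_zero, mem_sphere_zero_iff_norm] at ht
    exact hC t ht
  · rwa [closure_ball _ one_ne_zero, mem_closedBall_zero_iff]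

/-- In dimension at least two, zero sets of holomorphic functions are empty or uncountable. -/
theorem not_countable_zero_set (hE : 1 < Module.finrank ℂ E) {U : Set E} (hU : IsOpen U)
    {D : E → ℂ} (hD : DifferentiableOn ℂ D U) {a : E} (ha : a ∈ U) (hDa : D a = 0) :
    ¬ {z ∈ U | D z = 0}.Countable := by
  intro hc
  have hopen : IsOpen (U \ {z ∈ U | D z = 0}) := by
    have : U \ {z ∈ U | D z = 0} = U ∩ D ⁻¹' {0}ᶜ := by
      ext z
      simp +contextual
    rw [this]
    exact hD.continuousOn.isOpen_inter_preimage hU isOpen_compl_singleton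
  obtain ⟨v, δ, hδ, h1, h2, h3⟩ := exists_tube_of_countable hE hU hc hopen ha
  have := FiniteDimensional.of_finrank_pos (K := ℂ) (V := E) (by omega)
  have : ProperSpace E := FiniteDimensional.proper ℂ E
  have hcomp : IsCompact ((fun p : E × ℂ => p.1 + p.2 • v) ''
      (closedBall a δ ×ˢ sphere (0 : ℂ) 1)) :=
    ((isCompact_closedBall a δ).prod (isCompact_sphere 0 1)).image (by fun_prop)
  obtain ⟨M, hM⟩ := hcomp.exists_bound_of_continuousOn (f := fun z => (D z)⁻¹) (by
    refine ContinuousOn.inv₀ (hD.continuousOn.mono ?_) ?_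
    · rintro _ ⟨⟨w, ζ⟩, ⟨hw, hζ⟩, rfl⟩
      exact h1 w hw ζ (mem_sphere_zero_iff_norm.1 hζ).le
    · rintro _ ⟨⟨w, ζ⟩, ⟨hw, hζ⟩, rfl⟩ h0
      have hζ' := mem_sphere_zero_iff_norm.1 hζ
      exact h2 w hw ζ hζ' ⟨h1 w hw ζ hζ'.le, h0⟩)
  have hlt : ∀ᶠ w in 𝓝 a, ‖D w‖ * M < 1 := by
    have hca : ContinuousAt D a := hD.continuousOn.continuousAt (hU.mem_nhds ha)
    have : Tendsto (fun w => ‖D w‖ * M) (𝓝 a) (𝓝 (‖D a‖ * M)) := (hca.norm.mul_const M)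
    rw [hDa, norm_zero, zero_mul] at this
    exact this.eventually_lt_const one_pos
  obtain ⟨ε, hε, hball⟩ := Metric.eventually_nhds_iff_ball.1 hlt
  obtain ⟨w, hw, hwZ⟩ := h3 (min ε δ) (lt_min hε hδ)
  have hwδ : w ∈ closedBall a δ := ball_subset_closedBall (ball_subset_ball (min_le_right _ _) hw)
  have hne : ∀ ζ : ℂ, ‖ζ‖ ≤ 1 → D (w + ζ • v) ≠ 0 := fun ζ hζ h0 =>
    hwZ ζ hζ ⟨h1 w hwδ ζ hζ, h0⟩
  have hle := norm_le_of_forall_circle (h := fun z => (D z)⁻¹) (w := w) (v := v) (C := M)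
    (fun ζ hζ => (hD.differentiableAt (hU.mem_nhds (h1 w hwδ ζ hζ))).inv (hne ζ hζ))
    (fun ζ hζ => hM _ ⟨(w, ζ), ⟨hwδ, mem_sphere_zero_iff_norm.2 hζ⟩, rfl⟩)
    (ζ := 0) (by simp)
  have hne0 := hne 0 (by simp)
  simp only [zero_smul, add_zero, norm_inv] at hle hne0
  have h4 := hball w (ball_subset_ball (min_le_left _ _) hw)
  have h5 : 0 < ‖D w‖ := norm_pos_iff.2 hne0
  have h6 : ‖D w‖ * ‖D w‖⁻¹ ≤ ‖D w‖ * M := by gcongr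
  rw [mul_inv_cancel₀ h5.ne'] at h6
  linarith

end Tubes

section Osgood

/-- An injective holomorphic function of one variable has nonvanishing derivative. -/
theorem deriv_ne_zero_of_injOn {f : ℂ → ℂ} {U : Set ℂ} (hU : IsOpen U)
    (hf : DifferentiableOn ℂ f U) (hinj : InjOn f U) {a : ℂ} (ha : a ∈ U) : deriv f a ≠ 0 := by
  intro h0
  have hconst : ∀ r > 0, ball a r ⊆ U → ∀ w, ¬ ∀ z ∈ ball a r, f z = w := by
    intro r hr hrU w hw
    have hmem : a + (r / 2 : ℝ) ∈ ball a r := by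
      rw [mem_ball, dist_eq_norm, add_sub_cancel_left, Complex.norm_real,
        Real.norm_of_nonneg (by positivity)]
      linarith
    have := hinj (hrU hmem) ha ((hw _ hmem).trans (hw a (mem_ball_self hr)).symm)
    simp at this
    linarith
  obtain ⟨r₁, hr₁, hr₁U⟩ := Metric.isOpen_iff.1 hU a ha
  have hda : AnalyticAt ℂ (deriv f) a :=
    ((hf.deriv hU).analyticAt (hU.mem_nhds ha))
  rcases hda.eventually_eq_zero_or_eventually_ne_zero with h | h
  · obtain ⟨r, hr, hball⟩ := Metric.eventually_nhds_iff_ball.1 (h.and (hU.mem_nhds ha))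
    refine hconst r hr (fun z hz => (hball z hz).2) (f a) fun z hz => ?_
    exact isOpen_ball.is_const_of_deriv_eq_zero (convex_ball a r).isPreconnected
      (hf.mono fun z hz => (hball z hz).2) (fun z hz => (hball z hz).1) hz (mem_ball_self hr)
  · rw [eventually_nhdsWithin_iff] at h
    obtain ⟨r, hr, hball⟩ := Metric.eventually_nhds_iff_ball.1 (h.and (hU.mem_nhds ha))
    have hBU : ball a r ⊆ U := fun z hz => (hball z hz).2
    have hfB := hf.mono hBU
    have hinjB := hinj.mono hBU
    rcases (hfB.analyticOnNhd isOpen_ball).is_constant_or_isOpen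
      (convex_ball a r).isPreconnected with ⟨w, hw⟩ | hop
    · exact hconst r hr hBU w hw
    · set g := Function.invFunOn f (ball a r) with hg
      have hgf : ∀ z ∈ ball a r, g (f z) = z := fun z hz => hinjB.leftInvOn_invFunOn hz
      have hSo := hop _ Subset.rfl isOpen_ball
      have hgc : ∀ z ∈ ball a r, ContinuousAt g (f z) := by
        intro z hz
        rw [ContinuousAt, hgf z hz, tendsto_def]
        intro O hO
        obtain ⟨O', hO', hO'o, hzO'⟩ := _root_.mem_nhds_iff.1 hO
        refine mem_of_superset ((hop (ball a r ∩ O') inter_subset_left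
          (isOpen_ball.inter hO'o)).mem_nhds ⟨z, ⟨hz, hzO'⟩, rfl⟩) ?_
        rintro _ ⟨y, ⟨hy, hyO⟩, rfl⟩
        rw [mem_preimage, hgf y hy]
        exact hO' hyO
      have haB := mem_ball_self (x := a) hr
      have hS : f '' ball a r ∈ 𝓝 (f a) := hSo.mem_nhds ⟨a, haB, rfl⟩
      have hgd : DifferentiableOn ℂ g (f '' ball a r) := by
        rw [← Complex.differentiableOn_compl_singleton_and_continuousAt_iff hS]
        refine ⟨?_, hgc a haB⟩
        rintro _ ⟨⟨z, hz, rfl⟩, hza⟩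
        have hza' : z ≠ a := fun h => hza (by simp [h])
        have hdz : HasDerivAt f (deriv f z) (g (f z)) := by
          rw [hgf z hz]
          exact (hfB.differentiableAt (isOpen_ball.mem_nhds hz)).hasDerivAt
        refine (HasDerivAt.of_local_left_inverse (hgc z hz) hdz ((hball z hz).1 hza')
          ?_).differentiableAt.differentiableWithinAt
        filter_upwards [hSo.mem_nhds ⟨z, hz, rfl⟩]
        rintro _ ⟨y, hy, rfl⟩
        rw [hgf y hy]
      have h1 := (hgd.differentiableAt hS).hasDerivAt.comp a
        (hfB.differentiableAt (isOpen_ball.mem_nhds haB)).hasDerivAt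
      have h2 : HasDerivAt (g ∘ f) 1 a :=
        (hasDerivAt_id a).congr_of_eventuallyEq
          (Filter.eventuallyEq_of_mem (isOpen_ball.mem_nhds haB) hgf)
      have := h1.unique h2
      simp [h0] at this

/-- The points of degeneracy of a holomorphic map between spaces of the same dimension form the
zero set of a holomorphic function. -/
theorem exists_differentiableOn_eq_zero_iff_ker_fderiv {E F : Type*} [NormedAddCommGroup E]
    [NormedSpace ℂ E] [FiniteDimensional ℂ E] [NormedAddCommGroup F] [NormedSpace ℂ F]
    [FiniteDimensional ℂ F] (hEF : Module.finrank ℂ E = Module.finrank ℂ F) {U : Set E}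
    (hU : IsOpen U) {f : E → F} (hf : DifferentiableOn ℂ f U) :
    ∃ D : E → ℂ, DifferentiableOn ℂ D U ∧
      ∀ z ∈ U, D z ≠ 0 ↔ Function.Injective (fderiv ℂ f z) := by
  let e : E ≃L[ℂ] F := ContinuousLinearEquiv.ofFinrankEq hEF
  let b := Module.finBasis ℂ E
  refine ⟨fun z => (LinearMap.toMatrix b b
    ((e.symm : F →L[ℂ] E).comp (fderiv ℂ f z) : E →L[ℂ] E).toLinearMap).det, ?_, fun z hz => ?_⟩
  · simp only [Matrix.det_apply, LinearMap.toMatrix_apply]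
    refine DifferentiableOn.fun_sum fun σ _ => DifferentiableOn.const_smul ?_ _
    have hd := hf.fderiv_complex hU
    let c : ∀ i, E →L[ℂ] ℂ := fun i => (b.coord i).toContinuousLinearMap
    have h1 : ∀ i, DifferentiableOn ℂ
        (fun z => c (σ i) (e.symm (fderiv ℂ f z (b i)))) U := fun i =>
      (c (σ i)).differentiable.comp_differentiableOn
        (e.symm.differentiable.comp_differentiableOn (hd.clm_apply (differentiableOn_const _)))
    exact fun z hz => (HasFDerivWithinAt.finsetProd fun i _ =>
      (h1 i z hz).hasFDerivWithinAt).differentiableWithinAt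
  · beta_reduce
    rw [LinearMap.det_toMatrix, ← isUnit_iff_ne_zero, ← LinearMap.isUnit_iff_isUnit_det,
      LinearMap.isUnit_iff_ker_eq_bot, LinearMap.ker_eq_bot]
    exact e.symm.injective.of_comp_iff (fderiv ℂ f z)

theorem finrank_ker_of_ne_zero {G : Type*} [NormedAddCommGroup G] [NormedSpace ℂ G]
    [FiniteDimensional ℂ G] {ℓ : G →L[ℂ] ℂ} (hℓ : ℓ ≠ 0) {m : ℕ}
    (hm : Module.finrank ℂ G = m + 1) : Module.finrank ℂ ℓ.ker = m := by
  have := Module.Dual.finrank_ker_add_one_of_ne_zero (f := (ℓ : G →ₗ[ℂ] ℂ))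
    (fun h => hℓ (ContinuousLinearMap.ext fun x => LinearMap.congr_fun h x))
  change Module.finrank ℂ (LinearMap.ker (ℓ : G →ₗ[ℂ] ℂ)) = m
  omega

universe u v

/-- **Osgood's theorem**: an injective holomorphic map between spaces of the same dimension has
injective derivatives. -/
theorem injective_fderiv_of_injOn (m : ℕ) : ∀ {E : Type u} {F : Type v} [NormedAddCommGroup E]
    [NormedSpace ℂ E] [FiniteDimensional ℂ E] [NormedAddCommGroup F] [NormedSpace ℂ F]
    [FiniteDimensional ℂ F], Module.finrank ℂ E = m → Module.finrank ℂ F = m →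
    ∀ {U : Set E}, IsOpen U → ∀ {f : E → F}, DifferentiableOn ℂ f U → InjOn f U →
    ∀ {a}, a ∈ U → Function.Injective (fderiv ℂ f a) := by
  induction m with
  | zero =>
    intro E F _ _ _ _ _ _ hE _ U _ f _ _ a _
    have := Module.finrank_zero_iff.1 hE
    exact Function.injective_of_subsingleton _
  | succ m ih =>
    intro E F _ _ _ _ _ _ hE hF U hU f hf hinj
    have key : ∀ a ∈ U, fderiv ℂ f a ≠ 0 → Function.Injective (fderiv ℂ f a) := by
      intro a ha hne
      have hfa := (hf.differentiableAt (hU.mem_nhds ha)).hasFDerivAt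
      obtain ⟨v, hv⟩ : ∃ v, fderiv ℂ f a v ≠ 0 := by
        by_contra! h
        exact hne (ContinuousLinearMap.ext h)
      obtain ⟨ℓ', hℓ'⟩ := SeparatingDual.exists_ne_zero (R := ℂ) hv
      set w : F := (ℓ' (fderiv ℂ f a v))⁻¹ • fderiv ℂ f a v with hw
      have hw1 : ℓ' w = 1 := by simp [hw, hℓ']
      set g : E → ℂ := fun z => ℓ' (f z - f a) with hg
      have hgd : DifferentiableOn ℂ g U :=
        ℓ'.differentiable.comp_differentiableOn (hf.sub_const _)
      have hg' : fderiv ℂ g a = ℓ'.comp (fderiv ℂ f a) :=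
        (ℓ'.hasFDerivAt.comp a (hfa.sub_const _)).fderiv
      have hℓ0 : ℓ'.comp (fderiv ℂ f a) ≠ 0 := fun h => hℓ' (by
        simpa using congrArg (fun L : E →L[ℂ] ℂ => L v) h)
      have hℓ'0 : ℓ' ≠ 0 := fun h => hℓ' (by simp [h])
      obtain ⟨Φ, π, V, N, hV, h0V, hN, hNU, haN, hΦ0, hΦd, hΦ', -, hΦV, -⟩ :=
        exists_parametrization_zero_set hU hgd ha (by simp [hg]) hg' hℓ0
      have hk1 : Module.finrank ℂ (ℓ'.comp (fderiv ℂ f a)).ker = m :=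
        finrank_ker_of_ne_zero hℓ0 hE
      have hk2 : Module.finrank ℂ ℓ'.ker = m := finrank_ker_of_ne_zero hℓ'0 hF
      let p : F →L[ℂ] ℓ'.ker := (ContinuousLinearMap.id ℂ F - ℓ'.smulRight w).codRestrict ℓ'.ker
        (by
          intro x
          simp [LinearMap.mem_ker, hw1])
      have hp : ∀ x : F, (p x : F) = x - ℓ' x • w := fun x => rfl
      have hpf : ∀ y ∈ V, (p (f (Φ y) - f a) : F) = f (Φ y) - f a := by
        intro y hy
        have : ℓ' (f (Φ y) - f a) = 0 := (hΦV y hy).2.1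
        rw [hp, this, zero_smul, sub_zero]
      have hd' : HasFDerivAt (fun y => p (f (Φ y) - f a))
          (p.comp ((fderiv ℂ f a).comp (ℓ'.comp (fderiv ℂ f a)).ker.subtypeL)) 0 := by
        rw [← hΦ0] at hfa
        have h1 := (hfa.comp 0 hΦ').sub_const (f a)
        have h2 := p.hasFDerivAt.comp (0 : (ℓ'.comp (fderiv ℂ f a)).ker) h1
        simp only [hΦ0] at h2
        exact h2
      have hinj' := ih hk1 hk2 hV (f := fun y => p (f (Φ y) - f a))
        (p.differentiable.comp_differentiableOn
          ((hf.comp hΦd fun y hy => hNU (hΦV y hy).1).sub_const (f a))) (by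
          intro y hy z hz hyz
          have h1 := congrArg (fun x : ℓ'.ker => (x : F)) hyz
          simp only [hpf y hy, hpf z hz] at h1
          have h2 := hinj (hNU (hΦV y hy).1) (hNU (hΦV z hz).1) (sub_left_injective h1)
          rw [← (hΦV y hy).2.2, ← (hΦV z hz).2.2, h2]) h0V
      rw [hd'.fderiv] at hinj'
      rw [injective_iff_map_eq_zero]
      intro x hx
      have hxk : x ∈ (ℓ'.comp (fderiv ℂ f a)).ker := by simp [hx]
      have := hinj' (a₁ := ⟨x, hxk⟩) (a₂ := 0) (by
        rw [map_zero]
        change p (fderiv ℂ f a x) = 0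
        rw [hx, map_zero])
      exact congrArg Subtype.val this
    intro a ha
    refine key a ha fun h0 => ?_
    rcases Nat.eq_zero_or_pos m with rfl | hm
    · let e : ℂ ≃L[ℂ] E := ContinuousLinearEquiv.ofFinrankEq (by simp [hE])
      let e' : F ≃L[ℂ] ℂ := ContinuousLinearEquiv.ofFinrankEq (by simp [hF])
      have hd := deriv_ne_zero_of_injOn (f := fun t => e' (f (e t))) (hU.preimage e.continuous)
        (e'.differentiable.comp_differentiableOn
          (hf.comp e.differentiable.differentiableOn fun t ht => ht))
        (fun s hs t ht hst => e.injective (hinj hs ht (e'.injective hst)))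
        (a := e.symm a) (by simpa using ha)
      refine hd ?_
      have h1 : HasFDerivAt f (0 : E →L[ℂ] F) (e (e.symm a)) := by
        rw [e.apply_symm_apply, ← h0]
        exact (hf.differentiableAt (hU.mem_nhds ha)).hasFDerivAt
      have h2 := (h1.comp_hasDerivAt _ (e.hasFDerivAt.hasDerivAt))
      have h3 := (e' : F →L[ℂ] ℂ).hasFDerivAt.comp_hasDerivAt (e.symm a) h2
      have := h3.deriv
      simpa [Function.comp_def] using this
    · obtain ⟨D, hD, hDz⟩ :=
        exists_differentiableOn_eq_zero_iff_ker_fderiv (hE.trans hF.symm) hU hf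
      have : Nontrivial E := Module.nontrivial_of_finrank_pos (R := ℂ) (by omega)
      have hD0 : ∀ z ∈ U, D z = 0 → fderiv ℂ f z = 0 := by
        intro z hz hDz0
        by_contra h
        exact (hDz z hz).2 (key z hz h) hDz0
      have hDa : D a = 0 := by
        by_contra h
        have hi := (hDz a ha).1 h
        obtain ⟨v, hv⟩ := exists_ne (0 : E)
        exact hv (hi (by simp [h0]))
      have hunc := not_countable_zero_set (by omega) hU hD ha hDa
      obtain ⟨ψ, hψd, hψ01, hψ⟩ := exists_disc_of_not_countable (𝓕 := {D}) hU
        (by simpa using hD) (by simpa using hunc)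
      apply hψ01
      refine hinj (hψ 0 (by simp)).1 (hψ 1 (by simp)).1 ?_
      refine isOpen_ball.is_const_of_deriv_eq_zero (f := fun t => f (ψ t))
        (convex_ball (0 : ℂ) 2).isPreconnected
        (hf.comp hψd fun t ht => (hψ t ht).1) (fun t ht => ?_) (by simp) (by simp)
      have h1 : HasFDerivAt f (0 : E →L[ℂ] F) (ψ t) := by
        rw [← hD0 _ (hψ t ht).1 ((hψ t ht).2 D rfl)]
        exact (hf.differentiableAt (hU.mem_nhds (hψ t ht).1)).hasFDerivAt
      have h2 := h1.comp_hasDerivAt t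
        (hψd.differentiableAt (isOpen_ball.mem_nhds ht)).hasDerivAt
      simpa [Function.comp_def] using h2.deriv

/-- An injective holomorphic map between spaces of the same dimension is a biholomorphism onto its
open image. -/
theorem exists_inverse_of_injOn {E : Type u} {F : Type v} [NormedAddCommGroup E]
    [NormedSpace ℂ E] [FiniteDimensional ℂ E] [NormedAddCommGroup F] [NormedSpace ℂ F]
    [FiniteDimensional ℂ F] (hEF : Module.finrank ℂ E = Module.finrank ℂ F) {U : Set E}
    (hU : IsOpen U) {f : E → F} (hf : DifferentiableOn ℂ f U) (hinj : InjOn f U) :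
    IsOpen (f '' U) ∧ ∃ g : F → E, DifferentiableOn ℂ g (f '' U) ∧ (∀ z ∈ U, g (f z) = z) := by
  have : CompleteSpace E := FiniteDimensional.complete ℂ E
  have hder : ∀ a ∈ U, ∃ e : E ≃L[ℂ] F, HasStrictFDerivAt f (e : E →L[ℂ] F) a := by
    intro a ha
    have hi := injective_fderiv_of_injOn _ rfl hEF.symm hU hf hinj ha
    let e := (LinearEquiv.ofInjectiveOfFinrankEq
      (fderiv ℂ f a : E →ₗ[ℂ] F) hi hEF).toContinuousLinearEquiv
    refine ⟨e, ?_⟩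
    have h1 : ContDiffAt ℂ 1 f a := by
      have := (hf.contDiffOn_complex hU 1).contDiffAt (hU.mem_nhds ha)
      exact_mod_cast this
    exact h1.hasStrictFDerivAt one_ne_zero
  have hop : ∀ O ⊆ U, IsOpen O → IsOpen (f '' O) := by
    intro O hOU hO
    rw [isOpen_iff_mem_nhds]
    rintro _ ⟨a, ha, rfl⟩
    obtain ⟨e, he⟩ := hder a (hOU ha)
    rw [← he.map_nhds_eq_of_equiv]
    exact image_mem_map (hO.mem_nhds ha)
  refine ⟨hop U Subset.rfl hU, ?_⟩
  rcases isEmpty_or_nonempty E with hE | hE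
  · exact (hE.false 0).elim
  have hgf : ∀ z ∈ U, Function.invFunOn f U (f z) = z := fun z hz => hinj.leftInvOn_invFunOn hz
  refine ⟨Function.invFunOn f U, ?_, hgf⟩
  rintro _ ⟨a, ha, rfl⟩
  obtain ⟨e, he⟩ := hder a ha
  have hgc : ContinuousAt (Function.invFunOn f U) (f a) := by
    rw [ContinuousAt, hgf a ha, tendsto_def]
    intro O hO
    obtain ⟨O', hO', hO'o, haO'⟩ := _root_.mem_nhds_iff.1 hO
    refine mem_of_superset ((hop (U ∩ O') inter_subset_left
      (hU.inter hO'o)).mem_nhds ⟨a, ⟨ha, haO'⟩, rfl⟩) ?_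
    rintro _ ⟨y, ⟨hy, hyO⟩, rfl⟩
    rw [mem_preimage, hgf y hy]
    exact hO' hyO
  have he' : HasFDerivAt f (e : E →L[ℂ] F) (Function.invFunOn f U (f a)) := by
    rw [hgf a ha]
    exact he.hasFDerivAt
  refine (HasFDerivAt.of_local_left_inverse hgc he' ?_).differentiableAt.differentiableWithinAt
  filter_upwards [(hop U Subset.rfl hU).mem_nhds ⟨a, ha, rfl⟩]
  rintro _ ⟨y, hy, rfl⟩
  rw [hgf y hy]

end Osgood

section BallAutomorphism

variable {E : Type*} [NormedAddCommGroup E] [InnerProductSpace ℂ E]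

/-- The automorphism of the unit ball sending `0` to `a`. -/
noncomputable def ballAut (a z : E) : E :=
  (1 + inner ℂ a z)⁻¹ • (a + ((√(1 - ‖a‖ ^ 2) : ℝ) : ℂ) • z +
    (inner ℂ a z / (1 + ((√(1 - ‖a‖ ^ 2) : ℝ) : ℂ))) • a)

theorem one_add_inner_ne_zero {a z : E} (ha : ‖a‖ < 1) (hz : ‖z‖ < 1) :
    1 + inner ℂ a z ≠ 0 := by
  intro h
  have h1 : inner ℂ a z = -1 := by linear_combination h
  have h2 := norm_inner_le_norm (𝕜 := ℂ) a z
  rw [h1, norm_neg, norm_one] at h2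
  nlinarith [norm_nonneg a, norm_nonneg z]

theorem ballAut_zero (a : E) : ballAut a 0 = a := by simp [ballAut]

theorem differentiableOn_ballAut {a : E} (ha : ‖a‖ < 1) :
    DifferentiableOn ℂ (ballAut a) (ball 0 1) := by
  have hi : Differentiable ℂ fun z : E => inner ℂ a z := (innerSL ℂ a).differentiable
  intro z hz
  rw [mem_ball_zero_iff] at hz
  unfold ballAut
  refine DifferentiableAt.differentiableWithinAt ?_
  refine DifferentiableAt.smul (DifferentiableAt.inv ?_ (one_add_inner_ne_zero ha hz)) ?_
  · exact (hi z).const_add 1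
  · refine DifferentiableAt.add (by fun_prop) ?_
    simp only [div_eq_mul_inv]
    exact ((hi z).mul_const _).smul_const a

theorem mapsTo_ballAut {a : E} (ha : ‖a‖ < 1) : MapsTo (ballAut a) (ball 0 1) (ball 0 1) := by
  intro z hz
  rw [mem_ball_zero_iff] at hz ⊢
  set s := √(1 - ‖a‖ ^ 2) with hs
  have hs2 : s ^ 2 = 1 - ‖a‖ ^ 2 := Real.sq_sqrt (by nlinarith [norm_nonneg a])
  have hs0 : 0 < s := Real.sqrt_pos.2 (by nlinarith [norm_nonneg a])
  set c : ℂ := inner ℂ a z with hc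
  have hne : 0 < ‖1 + c‖ := norm_pos_iff.2 (one_add_inner_ne_zero ha hz)
  have hform : ballAut a z = (1 + c)⁻¹ • ((1 + c / (1 + (s : ℂ))) • a + (s : ℂ) • z) := by
    rw [ballAut, ← hs, ← hc]
    congr 1
    module
  rw [hform, norm_smul, norm_inv, inv_mul_lt_one₀ hne]
  refine lt_of_pow_lt_pow_left₀ 2 (norm_nonneg _) ?_
  have hα : (1 + c / (1 + (s : ℂ))) = ⟨1 + c.re / (1 + s), c.im / (1 + s)⟩ := by
    have : (1 + (s : ℂ)) = ((1 + s : ℝ) : ℂ) := by push_cast; ring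
    rw [this]
    apply Complex.ext
    · simp only [Complex.add_re, Complex.one_re, Complex.div_ofReal_re]
    · simp only [Complex.add_im, Complex.one_im, Complex.div_ofReal_im, zero_add]
  rw [norm_add_sq (𝕜 := ℂ), norm_smul, norm_smul, inner_smul_left, inner_smul_right, ← hc, mul_pow,
    mul_pow, hα, Complex.norm_real, Real.norm_of_nonneg hs0.le, ← Complex.normSq_eq_norm_sq,
    ← Complex.normSq_eq_norm_sq, Complex.normSq_apply, Complex.normSq_apply]
  simp only [RCLike.re_to_complex, Complex.mul_re, Complex.mul_im, Complex.conj_re, Complex.conj_im,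
    Complex.ofReal_re, Complex.ofReal_im, Complex.add_re, Complex.add_im, Complex.one_re,
    Complex.one_im]
  have ha2 : ‖a‖ ^ 2 = 1 - s ^ 2 := by linarith
  have hz2 : ‖z‖ ^ 2 < 1 := by nlinarith [norm_nonneg z]
  rw [ha2]
  have key : (1 + c.re) * (1 + c.re) + (0 + c.im) * (0 + c.im) -
      (((1 + c.re / (1 + s)) * (1 + c.re / (1 + s)) + c.im / (1 + s) * (c.im / (1 + s))) *
        (1 - s ^ 2) + 2 * ((1 + c.re / (1 + s)) * (s * c.re - 0 * c.im) -
          -(c.im / (1 + s)) * (s * c.im + 0 * c.re)) + s ^ 2 * ‖z‖ ^ 2) =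
      s ^ 2 * (1 - ‖z‖ ^ 2) := by
    have : (1 + s) ≠ 0 := by positivity
    field_simp
    ring
  have : 0 < s ^ 2 * (1 - ‖z‖ ^ 2) := by
    have : 0 < 1 - ‖z‖ ^ 2 := by linarith
    positivity
  linarith

theorem ballAut_neg_ballAut {a z : E} (ha : ‖a‖ < 1) (hz : ‖z‖ < 1) :
    ballAut (-a) (ballAut a z) = z := by
  set s := √(1 - ‖a‖ ^ 2) with hs
  have hs2 : s ^ 2 = 1 - ‖a‖ ^ 2 := Real.sq_sqrt (by nlinarith [norm_nonneg a])
  have hs0 : 0 < s := Real.sqrt_pos.2 (by nlinarith [norm_nonneg a])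
  set c : ℂ := inner ℂ a z with hc
  have hne : 1 + c ≠ 0 := one_add_inner_ne_zero ha hz
  have h1s : (1 + (s : ℂ)) ≠ 0 := by exact_mod_cast (by positivity : (1 + s) ≠ 0)
  have hsc : (s : ℂ) ≠ 0 := by exact_mod_cast hs0.ne'
  have haa : inner ℂ a a = 1 - (s : ℂ) ^ 2 := by
    rw [inner_self_eq_norm_sq_to_K]
    have : ((s ^ 2 : ℝ) : ℂ) = ((1 - ‖a‖ ^ 2 : ℝ) : ℂ) := by rw [hs2]
    push_cast at this
    rw [this]
    simp
  have hform : ballAut a z = (1 + c)⁻¹ • ((1 + c / (1 + (s : ℂ))) • a + (s : ℂ) • z) := by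
    rw [ballAut, ← hs, ← hc]
    congr 1
    module
  have hd : inner ℂ a (ballAut a z) = (1 - (s : ℂ) ^ 2 + c) / (1 + c) := by
    rw [hform, inner_smul_right, inner_add_right, inner_smul_right, inner_smul_right, haa, ← hc]
    field_simp
    ring
  have h1d : 1 + inner ℂ (-a) (ballAut a z) = (s : ℂ) ^ 2 / (1 + c) := by
    rw [inner_neg_left, hd]
    field_simp
    ring
  rw [ballAut, h1d, inner_neg_left, hd, norm_neg, ← hs, hform]
  have e1 : ∀ p q r t : ℂ, p • (-a + (s : ℂ) • (q • (r • a + (s : ℂ) • z)) + t • (-a)) =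
      (p * (-1 + s * q * r - t)) • a + (p * s * q * s) • z := by
    intros
    module
  rw [e1]
  have e2 : ((s : ℂ) ^ 2 / (1 + c))⁻¹ * (-1 + s * (1 + c)⁻¹ * (1 + c / (1 + (s : ℂ))) -
      -((1 - (s : ℂ) ^ 2 + c) / (1 + c)) / (1 + (s : ℂ))) = 0 := by
    field_simp
    ring
  have e3 : ((s : ℂ) ^ 2 / (1 + c))⁻¹ * s * (1 + c)⁻¹ * s = 1 := by
    field_simp
  rw [e2, e3, zero_smul, zero_add, one_smul]

theorem injOn_ballAut {a : E} (ha : ‖a‖ < 1) : InjOn (ballAut a) (ball 0 1) :=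
  LeftInvOn.injOn (f₁' := ballAut (-a)) fun _ hz =>
    ballAut_neg_ballAut ha (mem_ball_zero_iff.1 hz)

theorem image_ballAut {a : E} (ha : ‖a‖ < 1) : ballAut a '' ball 0 1 = ball 0 1 := by
  refine (mapsTo_ballAut ha).image_subset.antisymm fun z hz => ?_
  have ha' : ‖-a‖ < 1 := by rwa [norm_neg]
  refine ⟨ballAut (-a) z, mapsTo_ballAut ha' hz, ?_⟩
  have := ballAut_neg_ballAut ha' (mem_ball_zero_iff.1 hz)
  rwa [neg_neg] at this

/-- **Cartan's uniqueness theorem** for the unit ball. -/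
theorem eq_id_of_fderiv_eq_id {F : E → E} (hF : DifferentiableOn ℂ F (ball 0 1))
    (hm : MapsTo F (ball 0 1) (closedBall 0 1)) (h0 : F 0 = 0)
    (hd : fderiv ℂ F 0 = ContinuousLinearMap.id ℂ E) {z : E} (hz : z ∈ ball (0 : E) 1) :
    F z = z := by
  rcases eq_or_ne z 0 with rfl | hne
  · exact h0
  have hn : 0 < ‖z‖ := norm_pos_iff.2 hne
  set u : E := ((‖z‖ : ℂ))⁻¹ • z with hu
  have hu1 : ‖u‖ = 1 := by
    rw [hu, norm_smul, norm_inv, Complex.norm_real, norm_norm, inv_mul_cancel₀ hn.ne']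
  have hmem : ∀ t ∈ ball (0 : ℂ) 1, t • u ∈ ball (0 : E) 1 := by
    intro t ht
    rw [mem_ball_zero_iff] at ht ⊢
    rwa [norm_smul, hu1, mul_one]
  have hder : HasDerivAt (fun t : ℂ => F (t • u)) u 0 := by
    have h1 : HasFDerivAt F (ContinuousLinearMap.id ℂ E) ((0 : ℂ) • u) := by
      rw [zero_smul, ← hd]
      exact (hF.differentiableAt (ball_mem_nhds 0 one_pos)).hasFDerivAt
    have h2 : HasDerivAt (fun t : ℂ => t • u) u 0 := by
      simpa using (hasDerivAt_id (0 : ℂ)).smul_const u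
    simpa [Function.comp_def] using h1.comp_hasDerivAt 0 h2
  have hdif : DifferentiableOn ℂ (fun t : ℂ => F (t • u)) (ball 0 1) :=
    hF.comp (by fun_prop : Differentiable ℂ fun t : ℂ => t • u).differentiableOn hmem
  let _ : InnerProductSpace ℝ E := InnerProductSpace.rclikeToReal ℂ E
  have := Complex.affine_of_mapsTo_ball_of_norm_dslope_eq_div (R₁ := 1) (R₂ := 1) (c := 0)
    (z₀ := 0) hdif (fun t ht => by
      simp only [zero_smul, h0]
      exact hm (hmem t ht)) (by simp) (by rw [dslope_same, hder.deriv, hu1]; norm_num)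
  have h1 := this (x := (‖z‖ : ℂ)) (by simpa using hz)
  have h2 : (‖z‖ : ℂ) • u = z := by
    rw [hu, smul_inv_smul₀ (by exact_mod_cast hn.ne')]
  simpa [h0, dslope_same, hder.deriv, h2] using h1

end BallAutomorphism

section Exhaustion

/-- The strict maximum principle. -/
theorem norm_lt_of_norm_le {E F : Type*} [NormedAddCommGroup E] [NormedSpace ℂ E]
    [NormedAddCommGroup F] [NormedSpace ℂ F] {X : Set E} (hX : IsOpen X) (hc : IsPreconnected X)
    {g : E → F} (hg : DifferentiableOn ℂ g X) {C : ℝ} (hle : ∀ x ∈ X, ‖g x‖ ≤ C) {x₁ : E}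
    (hx₁ : x₁ ∈ X) (h₁ : ‖g x₁‖ < C) {x : E} (hx : x ∈ X) : ‖g x‖ < C := by
  refine (hle x hx).lt_of_ne fun h => h₁.ne ?_
  have := Complex.norm_eqOn_of_isPreconnected_of_isMaxOn hc hX hg hx
    (fun y hy => (hle y hy).trans h.ge)
  have h2 := this hx₁
  simp only [Function.comp_apply, Function.const_apply] at h2
  rw [h2, h]

/-- A perturbation of the identity is injective and surjective near each point. -/
theorem injOn_and_mem_image_of_near_id {E : Type*} [NormedAddCommGroup E] [NormedSpace ℂ E]
    [CompleteSpace E] {f : E → E} {z : E} {R : ℝ} (hR : 0 < R)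
    (hf : DifferentiableOn ℂ f (ball z R))
    (hd : ∀ w ∈ ball z R, ‖fderiv ℂ f w - ContinuousLinearMap.id ℂ E‖ ≤ 1 / 2)
    (h0 : ‖f z - z‖ ≤ R / 8) : InjOn f (ball z R) ∧ z ∈ f '' ball z R := by
  have hlip : ∀ a ∈ ball z R, ∀ b ∈ ball z R, ‖f a - f b - (a - b)‖ ≤ 1 / 2 * ‖a - b‖ := by
    intro a ha b hb
    have := (convex_ball z R).norm_image_sub_le_of_norm_fderiv_le (𝕜 := ℂ)
      (f := fun w => f w - w) (C := 1 / 2)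
      (fun w hw => (hf.differentiableAt (isOpen_ball.mem_nhds hw)).sub differentiableAt_id)
      (fun w hw => by
        have h1 : HasFDerivAt (fun w => f w - w) (fderiv ℂ f w - ContinuousLinearMap.id ℂ E) w :=
          (hf.differentiableAt (isOpen_ball.mem_nhds hw)).hasFDerivAt.sub (hasFDerivAt_id w)
        rw [h1.fderiv]
        exact hd w hw) hb ha
    convert this using 2
    abel
  refine ⟨fun a ha b hb hab => ?_, ?_⟩
  · have := hlip a ha b hb
    rw [hab, sub_self, zero_sub, norm_neg] at this
    have h2 : ‖a - b‖ ≤ 0 := by linarith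
    exact sub_eq_zero.1 (norm_le_zero_iff.1 h2)
  · have happ : ApproximatesLinearOn f (ContinuousLinearMap.id ℂ E) (ball z R) (1 / 2) := by
      intro a ha b hb
      simpa using hlip a ha b hb
    let r : (ContinuousLinearMap.id ℂ E).NonlinearRightInverse :=
      ⟨fun x => x, 1, fun x => by simp, fun x => rfl⟩
    have hs := happ.surjOn_closedBall_of_nonlinearRightInverse r (ε := R / 2) (b := z)
      (by positivity) (closedBall_subset_ball (by linarith))
    obtain ⟨w, hw, hwz⟩ := hs (a := z) (by
      rw [mem_closedBall, dist_comm, dist_eq_norm]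
      have : (((r.nnnorm : ℝ))⁻¹ - ((1 / 2 : NNReal) : ℝ)) * (R / 2) = R / 4 := by
        simp only [r]
        push_cast
        ring
      rw [this]
      linarith)
    exact ⟨w, closedBall_subset_ball (by linarith) hw, hwz⟩

theorem fderiv_comp_fderiv_of_leftInverse {E : Type*} [NormedAddCommGroup E]
    [NormedSpace ℂ E] {f g : E → E} {z : E}
    (hf : DifferentiableAt ℂ f z) (hg : DifferentiableAt ℂ g (f z))
    (h : ∀ᶠ w in 𝓝 z, g (f w) = w) :
    (fderiv ℂ g (f z)).comp (fderiv ℂ f z) = ContinuousLinearMap.id ℂ E := by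
  have h1 := hg.hasFDerivAt.comp z hf.hasFDerivAt
  have h2 : HasFDerivAt (g ∘ f) (ContinuousLinearMap.id ℂ E) z :=
    (hasFDerivAt_id z).congr_of_eventuallyEq h
  exact h1.unique h2



variable {E : Type*} [NormedAddCommGroup E] [InnerProductSpace ℂ E] [FiniteDimensional ℂ E]

/-- A domain exhausted by injective images of the unit ball whose normalized derivatives have
bounded determinants is biholomorphic to the unit ball. -/
theorem exists_biholomorphism_of_exhaustion_aux {X : Set E} (hX : IsOpen X)
    (hc : IsPreconnected X) {x₁ : E} (hx₁ : x₁ ∈ X) {f : ℕ → E → E}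
    (hd : ∀ k, DifferentiableOn ℂ (f k) (ball 0 1)) (hinj : ∀ k, InjOn (f k) (ball 0 1))
    (hsub : ∀ k, MapsTo (f k) (ball 0 1) X) (hf0 : ∀ k, f k 0 = x₁)
    (hex : ∀ x ∈ X, ∃ N ∈ 𝓝 x, ∀ᶠ k in atTop, N ⊆ f k '' ball 0 1) {C : ℝ}
    (hdet : ∀ k, ‖(fderiv ℂ (f k) 0).det‖ ≤ C) :
    ∃ h : E → E, DifferentiableOn ℂ h (ball 0 1) ∧ InjOn h (ball 0 1) ∧ h '' ball 0 1 = X := by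
  have : CompleteSpace E := FiniteDimensional.complete ℂ E
  have h0B : (0 : E) ∈ ball (0 : E) 1 := mem_ball_self one_pos
  let l : Ultrafilter ℕ := Ultrafilter.of atTop
  have hl : (l : Filter ℕ) ≤ atTop := Ultrafilter.of_le _
  choose hop g hgd hgf using fun k => exists_inverse_of_injOn rfl isOpen_ball (hd k) (hinj k)
  have hgB : ∀ k, ∀ x ∈ f k '' ball 0 1, g k x ∈ ball (0 : E) 1 ∧ f k (g k x) = x := by
    rintro k _ ⟨z, hz, rfl⟩
    rw [hgf k z hz]
    exact ⟨hz, rfl⟩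
  have hx₁k : ∀ k, x₁ ∈ f k '' ball 0 1 := fun k => ⟨0, h0B, hf0 k⟩
  have hgx₁ : ∀ k, g k x₁ = 0 := fun k => by
    have := hgf k 0 h0B
    rwa [hf0 k] at this
  obtain ⟨G, hGd, hG⟩ := exists_tendsto_of_locally_bounded l hX (f := g) (by
    intro x hx
    obtain ⟨N, hN, hNk⟩ := hex x hx
    obtain ⟨R, hR, hRN⟩ := Metric.mem_nhds_iff.1 hN
    refine ⟨R, hR, 1, ?_⟩
    filter_upwards [hl hNk] with k hk
    exact ⟨(hgd k).mono (hRN.trans hk),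
      fun w hw => (mem_ball_zero_iff.1 (hgB k w (hk (hRN hw))).1).le⟩)
  have hGlim : ∀ x ∈ X, Tendsto (fun k => g k x) l (𝓝 (G x)) := by
    intro x hx
    obtain ⟨R, hR, -, h1, -⟩ := hG x hx
    exact h1.tendsto_at (mem_ball_self hR)
  have hin : ∀ x ∈ X, ∀ᶠ k in (l : Filter ℕ), x ∈ f k '' ball 0 1 := by
    intro x hx
    obtain ⟨N, hN, hNk⟩ := hex x hx
    filter_upwards [hl hNk] with k hk
    exact hk (mem_of_mem_nhds hN)
  have hGx₁ : G x₁ = 0 := by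
    refine tendsto_nhds_unique (hGlim x₁ hx₁) ?_
    simp only [hgx₁]
    exact tendsto_const_nhds
  have hGle : ∀ x ∈ X, ‖G x‖ ≤ 1 := by
    intro x hx
    refine le_of_tendsto (hGlim x hx).norm ?_
    filter_upwards [hin x hx] with k hk
    exact (mem_ball_zero_iff.1 (hgB k x hk).1).le
  have hGB : MapsTo G X (ball 0 1) := fun x hx => mem_ball_zero_iff.2
    (norm_lt_of_norm_le hX hc hGd hGle hx₁ (by simp [hGx₁]) hx)
  -- the derivative of the limit at the base point is invertible
  have hgf' : ∀ k, (fderiv ℂ (g k) x₁).comp (fderiv ℂ (f k) 0) = ContinuousLinearMap.id ℂ E := by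
    intro k
    have := fderiv_comp_fderiv_of_leftInverse (f := f k) (g := g k) (z := 0)
      ((hd k).differentiableAt (isOpen_ball.mem_nhds h0B))
      (by rw [hf0]; exact (hgd k).differentiableAt ((hop k).mem_nhds (hx₁k k)))
      (Filter.eventually_of_mem (isOpen_ball.mem_nhds h0B) (hgf k))
    rwa [hf0] at this
  have hfg' : ∀ k, (fderiv ℂ (f k) 0).comp (fderiv ℂ (g k) x₁) = ContinuousLinearMap.id ℂ E := by
    intro k
    have h1 : (fderiv ℂ (g k) x₁ : E →ₗ[ℂ] E) ∘ₗ (fderiv ℂ (f k) 0 : E →ₗ[ℂ] E) =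
        LinearMap.id := congrArg (fun L : E →L[ℂ] E => (L : E →ₗ[ℂ] E)) (hgf' k)
    have h2 := (LinearMap.comp_eq_id_comm ℂ E).1 h1
    exact ContinuousLinearMap.ext fun x => LinearMap.congr_fun h2 x
  have hG'lim : Tendsto (fun k => fderiv ℂ (g k) x₁) l (𝓝 (fderiv ℂ G x₁)) := by
    obtain ⟨R, hR, -, -, h2⟩ := hG x₁ hx₁
    exact h2.tendsto_at (mem_ball_self hR)
  have hC : 0 < max C 1 := lt_max_of_lt_right one_pos
  have hGdet : (fderiv ℂ G x₁).det ≠ 0 := by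
    have h1 : ∀ k, (max C 1)⁻¹ ≤ ‖(fderiv ℂ (g k) x₁).det‖ := by
      intro k
      have h2 : (fderiv ℂ (g k) x₁).det * (fderiv ℂ (f k) 0).det = 1 := by
        have := congrArg (fun L : E →L[ℂ] E => LinearMap.det (L : E →ₗ[ℂ] E)) (hgf' k)
        exact (LinearMap.det_comp _ _).symm.trans (this.trans LinearMap.det_id)
      have h3 := congrArg norm h2
      rw [norm_mul, norm_one] at h3
      rw [inv_le_iff_one_le_mul₀ hC, ← h3]
      exact mul_le_mul_of_nonneg_left ((hdet k).trans (le_max_left _ _)) (norm_nonneg _)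
    have h2 : Tendsto (fun k => ‖(fderiv ℂ (g k) x₁).det‖) l (𝓝 ‖(fderiv ℂ G x₁).det‖) :=
      ((ContinuousLinearMap.continuous_det.tendsto _).comp hG'lim).norm
    have h3 := ge_of_tendsto h2 (Filter.Eventually.of_forall h1)
    exact norm_pos_iff.1 ((inv_pos.2 hC).trans_le h3)
  have hGsurj : Function.Surjective (fderiv ℂ G x₁) := by
    have hu : IsUnit (LinearMap.det (fderiv ℂ G x₁ : E →ₗ[ℂ] E)) := isUnit_iff_ne_zero.2 hGdet
    exact LinearMap.range_eq_top.1 ((LinearMap.isUnit_iff_range_eq_top _).1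
      ((LinearMap.isUnit_iff_isUnit_det _).2 hu))
  -- the maps `G ∘ f k` converge to the identity
  have hFd : ∀ k, DifferentiableOn ℂ (G ∘ f k) (ball 0 1) := fun k => hGd.comp (hd k) (hsub k)
  obtain ⟨F, hFdiff, hF⟩ := exists_tendsto_of_locally_bounded l isOpen_ball
    (f := fun k => G ∘ f k) (U := ball 0 1) (by
    intro z hz
    obtain ⟨R, hR, hRb⟩ := Metric.isOpen_iff.1 isOpen_ball z hz
    refine ⟨R, hR, 1, Filter.Eventually.of_forall fun k => ⟨(hFd k).mono hRb, fun w hw => ?_⟩⟩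
    exact hGle _ (hsub k (hRb hw)))
  have hFlim : ∀ z ∈ ball (0 : E) 1, Tendsto (fun k => G (f k z)) l (𝓝 (F z)) := by
    intro z hz
    obtain ⟨R, hR, -, h1, -⟩ := hF z hz
    exact h1.tendsto_at (mem_ball_self hR)
  have hF0 : F 0 = 0 := by
    refine tendsto_nhds_unique (hFlim 0 h0B) ?_
    simp only [hf0, hGx₁]
    exact tendsto_const_nhds
  have hF'0 : fderiv ℂ F 0 = ContinuousLinearMap.id ℂ E := by
    have h1 : Tendsto (fun k => fderiv ℂ (G ∘ f k) 0) l (𝓝 (fderiv ℂ F 0)) := by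
      obtain ⟨R, hR, -, -, h2⟩ := hF 0 h0B
      exact h2.tendsto_at (mem_ball_self hR)
    have h2 : ∀ k, (fderiv ℂ (G ∘ f k) 0).comp (fderiv ℂ (g k) x₁) = fderiv ℂ G x₁ := by
      intro k
      rw [fderiv_comp 0 (by rw [hf0]; exact hGd.differentiableAt (hX.mem_nhds hx₁))
        ((hd k).differentiableAt (isOpen_ball.mem_nhds h0B)), hf0,
        ContinuousLinearMap.comp_assoc, hfg', ContinuousLinearMap.comp_id]
    have h3 : (fderiv ℂ F 0).comp (fderiv ℂ G x₁) = fderiv ℂ G x₁ := by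
      have h4 : Tendsto (fun k => (fderiv ℂ (G ∘ f k) 0).comp (fderiv ℂ (g k) x₁)) l
          (𝓝 ((fderiv ℂ F 0).comp (fderiv ℂ G x₁))) := 
            (isBoundedBilinearMap_comp.continuous.tendsto (fderiv ℂ F 0, fderiv ℂ G x₁)).comp
              (h1.prodMk_nhds hG'lim)
      simp only [h2] at h4
      exact tendsto_nhds_unique h4 tendsto_const_nhds
    ext y
    obtain ⟨x, rfl⟩ := hGsurj y
    exact congrArg (fun L : E →L[ℂ] E => L x) h3
  have hFid : ∀ z ∈ ball (0 : E) 1, F z = z := fun z hz => eq_id_of_fderiv_eq_id hFdiff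
    (fun z hz => mem_closedBall_zero_iff.2 (le_of_tendsto (hFlim z hz).norm
      (Filter.Eventually.of_forall fun k => hGle _ (hsub k hz)))) hF0 hF'0 hz
  have hloc : ∀ z ∈ ball (0 : E) 1, ∃ R > 0, ball z R ⊆ ball 0 1 ∧ ∀ᶠ k in (l : Filter ℕ),
      InjOn (G ∘ f k) (ball z R) ∧ z ∈ (G ∘ f k) '' ball z R := by
    intro z hz
    obtain ⟨R, hR, hRb, h1, h2⟩ := hF z hz
    refine ⟨R, hR, hRb, ?_⟩
    filter_upwards [Metric.tendstoUniformlyOn_iff.1 h1 (R / 8) (by positivity),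
      Metric.tendstoUniformlyOn_iff.1 h2 (1 / 2) (by norm_num)] with k hk1 hk2
    refine injOn_and_mem_image_of_near_id hR ((hFd k).mono hRb) (fun w hw => ?_) ?_
    · have h3 := hk2 w hw
      have h4 : fderiv ℂ F w = ContinuousLinearMap.id ℂ E := by
        have : F =ᶠ[𝓝 w] id :=
          Filter.eventuallyEq_of_mem (isOpen_ball.mem_nhds (hRb hw)) hFid
        rw [this.fderiv_eq, fderiv_id]
      rw [h4, dist_comm, dist_eq_norm] at h3
      exact h3.le
    · have h3 := hk1 z (mem_ball_self hR)
      rw [hFid z hz, dist_comm, dist_eq_norm] at h3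
      exact h3.le
  have hGinj : InjOn G X := by
    intro a ha b hb hab
    obtain ⟨R, hR, hRb, hk⟩ := hloc (G a) (hGB ha)
    have h1 := (hGlim a ha).eventually (ball_mem_nhds _ hR)
    have h2 := (hGlim b hb).eventually (ball_mem_nhds _ hR)
    rw [← hab] at h2
    obtain ⟨k, ⟨⟨hk, -⟩, hka, hkb⟩, hak, hbk⟩ :=
      ((hk.and (h1.and h2)).and ((hin a ha).and (hin b hb))).exists
    have h3 : g k a = g k b := hk hka hkb (by
      simp only [Function.comp_apply]
      rw [(hgB k a hak).2, (hgB k b hbk).2, hab])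
    rw [← (hgB k a hak).2, ← (hgB k b hbk).2, h3]
  have hGim : G '' X = ball 0 1 := by
    refine hGB.image_subset.antisymm fun z hz => ?_
    obtain ⟨R, hR, hRb, hk⟩ := hloc z hz
    obtain ⟨k, -, w, hw, hwz⟩ := hk.exists
    exact ⟨f k w, hsub k (hRb hw), hwz⟩
  obtain ⟨-, h, hhd, hhG⟩ := exists_inverse_of_injOn rfl hX hGd hGinj
  rw [hGim] at hhd
  refine ⟨h, hhd, ?_, ?_⟩
  · rw [← hGim]
    rintro _ ⟨a, ha, rfl⟩ _ ⟨b, hb, rfl⟩ hab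
    rw [hhG a ha, hhG b hb] at hab
    rw [hab]
  · rw [← hGim, image_image]
    ext x
    constructor
    · rintro ⟨y, hy, rfl⟩
      change h (G y) ∈ X
      rwa [hhG y hy]
    · exact fun hx => ⟨x, hx, hhG x hx⟩

/-- A domain exhausted by injective images of the unit ball is biholomorphic to the unit ball,
provided injective maps of the ball into the domain have bounded Jacobians over some point. -/
theorem exists_biholomorphism_of_exhaustion {X : Set E} (hX : IsOpen X)
    (hc : IsPreconnected X) {x₁ : E} (hx₁ : x₁ ∈ X) {f : ℕ → E → E}
    (hd : ∀ k, DifferentiableOn ℂ (f k) (ball 0 1)) (hinj : ∀ k, InjOn (f k) (ball 0 1))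
    (hsub : ∀ k, MapsTo (f k) (ball 0 1) X)
    (hex : ∀ x ∈ X, ∃ N ∈ 𝓝 x, ∀ᶠ k in atTop, N ⊆ f k '' ball 0 1) {C : ℝ}
    (hdet : ∀ φ : E → E, DifferentiableOn ℂ φ (ball 0 1) → InjOn φ (ball 0 1) →
      MapsTo φ (ball 0 1) X → φ 0 = x₁ → ‖(fderiv ℂ φ 0).det‖ ≤ C) :
    ∃ h : E → E, DifferentiableOn ℂ h (ball 0 1) ∧ InjOn h (ball 0 1) ∧ h '' ball 0 1 = X := by
  obtain ⟨N, hN, hNk⟩ := hex x₁ hx₁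
  obtain ⟨k₀, hk₀⟩ := eventually_atTop.1 hNk
  choose a ha haf using fun k => hk₀ (k + k₀) (Nat.le_add_left _ _) (mem_of_mem_nhds hN)
  have ha' : ∀ k, ‖a k‖ < 1 := fun k => mem_ball_zero_iff.1 (ha k)
  have hd' : ∀ k, DifferentiableOn ℂ (f (k + k₀) ∘ ballAut (a k)) (ball 0 1) := fun k =>
    (hd _).comp (differentiableOn_ballAut (ha' k)) (mapsTo_ballAut (ha' k))
  have hi' : ∀ k, InjOn (f (k + k₀) ∘ ballAut (a k)) (ball 0 1) := fun k =>
    (hinj _).comp (injOn_ballAut (ha' k)) (mapsTo_ballAut (ha' k))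
  have hs' : ∀ k, MapsTo (f (k + k₀) ∘ ballAut (a k)) (ball 0 1) X := fun k =>
    (hsub _).comp (mapsTo_ballAut (ha' k))
  have h0' : ∀ k, (f (k + k₀) ∘ ballAut (a k)) 0 = x₁ := fun k => by
    rw [Function.comp_apply, ballAut_zero, haf]
  refine exists_biholomorphism_of_exhaustion_aux hX hc hx₁ hd' hi' hs' h0' (fun x hx => ?_)
    (C := C) fun k => hdet _ (hd' k) (hi' k) (hs' k) (h0' k)
  obtain ⟨N, hN, hNk⟩ := hex x hx
  refine ⟨N, hN, ?_⟩
  filter_upwards [(tendsto_add_atTop_nat k₀).eventually hNk] with k hk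
  rwa [image_comp, image_ballAut (ha' k)]

end Exhaustion

section MeanValue

variable {n : ℕ}

theorem measurePreserving_add_smul_sub (c : Fin n → ℂ) {a : ℂ} (ha : ‖a‖ = 1) :
    MeasurePreserving (fun z : Fin n → ℂ => c + a • (z - c)) volume volume := by
  have h1 : ∀ i, MeasurePreserving (fun ζ : ℂ => c i + a * (ζ - c i)) volume volume := by
    intro i
    have h2 : MeasurePreserving (fun ζ : ℂ => a * ζ) volume volume :=
      (rotation ⟨a, mem_sphere_zero_iff_norm.2 ha⟩).measurePreserving
    exact ((measurePreserving_add_left volume (c i)).comp h2).comp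
      (measurePreserving_sub_right volume (c i))
  exact volume_preserving_pi h1

theorem image_add_smul_sub_ball {E : Type*} [NormedAddCommGroup E] [NormedSpace ℂ E] (c : E)
    {a : ℂ} (ha : ‖a‖ = 1) (ρ : ℝ) : (fun z : E => c + a • (z - c)) '' ball c ρ = ball c ρ := by
  have ha0 : a ≠ 0 := norm_pos_iff.1 (by rw [ha]; exact one_pos)
  ext z
  constructor
  · rintro ⟨w, hw, rfl⟩
    rw [mem_ball_iff_norm] at hw ⊢
    rwa [add_sub_cancel_left, norm_smul, ha, one_mul]
  · intro hz
    refine ⟨c + a⁻¹ • (z - c), ?_, ?_⟩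
    · rw [mem_ball_iff_norm] at hz ⊢
      rwa [add_sub_cancel_left, norm_smul, norm_inv, ha, inv_one, one_mul]
    · simp only [add_sub_cancel_left, smul_smul, mul_inv_cancel₀ ha0, one_smul]
      abel

/-- The sub-mean value inequality for squared moduli of holomorphic functions. -/
theorem enorm_sq_mul_volume_ball_le {F : (Fin n → ℂ) → ℂ} {c : Fin n → ℂ} {ρ : ℝ}
    (hF : DifferentiableOn ℂ F (ball c ρ)) :
    ‖F c‖ₑ ^ 2 * volume (ball c ρ) ≤ ∫⁻ z in ball c ρ, ‖F z‖ₑ ^ 2 := by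
  set T : ℝ → (Fin n → ℂ) → (Fin n → ℂ) := fun θ z => c + circleMap 0 1 θ • (z - c) with hT
  have hn : ∀ θ, ‖circleMap 0 1 θ‖ = 1 := fun θ => by simp
  have h2π : (0 : ℝ) < 2 * Real.pi := by positivity
  set I := ∫⁻ z in ball c ρ, ‖F z‖ₑ ^ 2 with hI
  have hTI : ∀ θ, ∫⁻ z in ball c ρ, ‖F (T θ z)‖ₑ ^ 2 = I := by
    intro θ
    have hemb : MeasurableEmbedding (T θ) := by
      refine Continuous.measurableEmbedding (by fun_prop) fun x y hxy => ?_
      have h0 : circleMap 0 1 θ ≠ 0 := norm_pos_iff.1 (by rw [hn]; exact one_pos)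
      have h3 := smul_right_injective _ h0 (add_left_cancel hxy)
      exact sub_left_injective h3
    have h3 := (measurePreserving_add_smul_sub c (hn θ)).setLIntegral_comp_emb hemb
      (fun z => ‖F z‖ₑ ^ 2) (ball c ρ)
    rwa [image_add_smul_sub_ball c (hn θ)] at h3
  have hpt : ∀ z ∈ ball c ρ, ‖F c‖ₑ ^ 2 ≤ ENNReal.ofReal (2 * Real.pi)⁻¹ *
      ∫⁻ θ in Ioc 0 (2 * Real.pi), ‖F (T θ z)‖ₑ ^ 2 := by
    intro z hz
    have hmem : ∀ ζ : ℂ, ‖ζ‖ ≤ 1 → c + ζ • (z - c) ∈ ball c ρ := by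
      intro ζ hζ
      rw [mem_ball_iff_norm] at hz ⊢
      rw [add_sub_cancel_left, norm_smul]
      exact (mul_le_of_le_one_left (norm_nonneg _) hζ).trans_lt hz
    have hdc : DiffContOnCl ℂ (fun ζ : ℂ => F (c + ζ • (z - c)) ^ 2) (ball 0 |1|) := by
      rw [abs_one]
      refine DifferentiableOn.diffContOnCl fun ζ hζ => ?_
      rw [closure_ball _ one_ne_zero, mem_closedBall_zero_iff] at hζ
      have h3 := hF.differentiableAt (isOpen_ball.mem_nhds (hmem ζ hζ))
      refine ((DifferentiableAt.comp (f := fun ζ : ℂ => c + ζ • (z - c)) ζ h3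
        (by fun_prop)).pow 2).differentiableWithinAt
    have h4 := hdc.circleAverage
    simp only [zero_smul, add_zero] at h4
    rw [← enorm_pow, ← h4, Real.circleAverage, enorm_smul,
      intervalIntegral.integral_of_le h2π.le]
    gcongr
    · rw [Real.enorm_of_nonneg (by positivity)]
    · refine (enorm_integral_le_lintegral_enorm _).trans ?_
      simp only [enorm_pow]
      exact le_rfl
  have hmeas : AEMeasurable (Function.uncurry fun z θ => ‖F (T θ z)‖ₑ ^ 2)
      ((volume.restrict (ball c ρ)).prod (volume.restrict (Ioc 0 (2 * Real.pi)))) := by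
    rw [Measure.prod_restrict]
    refine ContinuousOn.aemeasurable ?_ (measurableSet_ball.prod measurableSet_Ioc)
    refine (ENNReal.continuous_pow 2).comp_continuousOn (continuous_enorm.comp_continuousOn ?_)
    refine hF.continuousOn.comp (f := fun p : (Fin n → ℂ) × ℝ => T p.2 p.1) ?_ ?_
    · have : Continuous fun p : (Fin n → ℂ) × ℝ => T p.2 p.1 := by
        simp only [hT]
        fun_prop
      exact this.continuousOn
    · rintro ⟨z, θ⟩ ⟨hz, -⟩
      rw [← image_add_smul_sub_ball c (hn θ)]
      exact ⟨z, hz, rfl⟩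
  calc ‖F c‖ₑ ^ 2 * volume (ball c ρ) = ∫⁻ _ in ball c ρ, ‖F c‖ₑ ^ 2 := by
        rw [setLIntegral_const]
    _ ≤ ∫⁻ z in ball c ρ, ENNReal.ofReal (2 * Real.pi)⁻¹ *
          ∫⁻ θ in Ioc 0 (2 * Real.pi), ‖F (T θ z)‖ₑ ^ 2 :=
        setLIntegral_mono' measurableSet_ball hpt
    _ = ENNReal.ofReal (2 * Real.pi)⁻¹ *
          ∫⁻ θ in Ioc 0 (2 * Real.pi), ∫⁻ z in ball c ρ, ‖F (T θ z)‖ₑ ^ 2 := by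
        rw [lintegral_const_mul' _ _ ENNReal.ofReal_ne_top, lintegral_lintegral_swap hmeas]
    _ = I := by
        simp only [hTI]
        rw [setLIntegral_const, Real.volume_Ioc, sub_zero, mul_comm I, ← mul_assoc,
          ← ENNReal.ofReal_mul (by positivity), inv_mul_cancel₀ h2π.ne', ENNReal.ofReal_one,
          one_mul]

end MeanValue

section BergmanSpace

variable {n : ℕ} {X : Set (Fin n → ℂ)} {K : (Fin n → ℂ) → (Fin n → ℂ) → ℂ}

theorem MemA2.sub {f g : (Fin n → ℂ) → ℂ} (hf : MemA2 X f) (hg : MemA2 X g) :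
    MemA2 X fun z => f z - g z :=
  ⟨hf.1.sub hg.1, hf.2.sub hg.2⟩

theorem MemA2.integrable_norm_sq {f : (Fin n → ℂ) → ℂ} (hf : MemA2 X f) :
    IntegrableOn (fun z => ‖f z‖ ^ 2) X :=
  MemLp.integrable_norm_pow (p := 2) (by exact_mod_cast hf.2) two_ne_zero

theorem MemA2.lintegral_enorm_sq {f : (Fin n → ℂ) → ℂ} (hf : MemA2 X f) :
    ∫⁻ z in X, ‖f z‖ₑ ^ 2 = ENNReal.ofReal (∫ z in X, ‖f z‖ ^ 2) := by
  rw [ofReal_integral_eq_lintegral_ofReal hf.integrable_norm_sq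
    (Filter.Eventually.of_forall fun z => by positivity)]
  refine lintegral_congr fun z => ?_
  rw [← ofReal_norm, ENNReal.ofReal_pow (norm_nonneg _)]

theorem MemA2.integrable_mul_conj {f g : (Fin n → ℂ) → ℂ} (hf : MemA2 X f) (hg : MemA2 X g) :
    IntegrableOn (fun z => f z * (starRingEnd ℂ) (g z)) X :=
  MemLp.integrable_mul (p := 2) (q := 2) hf.2 hg.2.star

theorem MemA2.norm_sq_le {f : (Fin n → ℂ) → ℂ} (hf : MemA2 X f) {z : Fin n → ℂ} {ρ : ℝ}
    (hρ : 0 < ρ) (hz : ball z ρ ⊆ X) :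
    ‖f z‖ ^ 2 ≤ (volume.real (ball (0 : Fin n → ℂ) ρ))⁻¹ * ∫ z in X, ‖f z‖ ^ 2 := by
  have h1 := (enorm_sq_mul_volume_ball_le (hf.1.mono hz)).trans (lintegral_mono_set hz)
  rw [hf.lintegral_enorm_sq, Measure.addHaar_ball_center, ← ofReal_norm,
    ← ENNReal.ofReal_pow (norm_nonneg _)] at h1
  have hv : 0 < volume.real (ball (0 : Fin n → ℂ) ρ) :=
    ENNReal.toReal_pos (measure_ball_pos _ _ hρ).ne' measure_ball_lt_top.ne
  have h2 := ENNReal.toReal_mono ENNReal.ofReal_ne_top h1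
  rw [ENNReal.toReal_mul, ENNReal.toReal_ofReal (by positivity),
    ENNReal.toReal_ofReal (by positivity)] at h2
  rw [inv_mul_eq_div, le_div_iff₀ hv]
  exact h2

/-- Point evaluations are locally uniformly bounded on the Bergman space. -/
theorem exists_norm_le_of_memA2 (hX : IsOpen X) {p : Fin n → ℂ} (hp : p ∈ X) :
    ∃ R > 0, ball p (4 * R) ⊆ X ∧ ∃ C > 0, ∀ f, MemA2 X f → ∀ z ∈ ball p (4 * R),
      ‖f z‖ ≤ C * √(∫ z in X, ‖f z‖ ^ 2) := by
  obtain ⟨ρ, hρ, hb⟩ := Metric.isOpen_iff.1 hX p hp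
  have hv : 0 < volume.real (ball (0 : Fin n → ℂ) (ρ / 2)) :=
    ENNReal.toReal_pos (measure_ball_pos _ _ (by positivity)).ne' measure_ball_lt_top.ne
  refine ⟨ρ / 8, by positivity, (ball_subset_ball (by linarith)).trans hb,
    √(volume.real (ball (0 : Fin n → ℂ) (ρ / 2)))⁻¹, by positivity, fun f hf z hz => ?_⟩
  rw [← Real.sqrt_mul (by positivity)]
  refine Real.le_sqrt_of_sq_le (hf.norm_sq_le (by positivity) (Subset.trans ?_ hb))
  refine ball_subset_ball' ?_
  rw [mem_ball] at hz
  linarith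

theorem IsBergmanKernel.conj_symm (hK : IsBergmanKernel X K) {z w : Fin n → ℂ} (hz : z ∈ X) (hw : w ∈ X) :
    (starRingEnd ℂ) (K z w) = K w z := by
  rw [hK.2 _ (hK.1 w hw) z hz, hK.2 _ (hK.1 z hz) w hw, ← integral_conj]
  simp [mul_comm]

theorem IsBergmanKernel.integral_norm_sq (hK : IsBergmanKernel X K) {w : Fin n → ℂ} (hw : w ∈ X) :
    ((∫ z in X, ‖K z w‖ ^ 2 : ℝ) : ℂ) = K w w := by
  rw [hK.2 _ (hK.1 w hw) w hw, ← integral_complex_ofReal]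
  simp [Complex.mul_conj, Complex.normSq_eq_norm_sq]

theorem IsBergmanKernel.integral_norm_sub_sq (hK : IsBergmanKernel X K) {a b : Fin n → ℂ} (ha : a ∈ X) (hb : b ∈ X) :
    ((∫ z in X, ‖K z a - K z b‖ ^ 2 : ℝ) : ℂ) = (K a a - K a b) - (K b a - K b b) := by
  have hs := (hK.1 a ha).sub (hK.1 b hb)
  rw [hK.2 _ hs a ha, hK.2 _ hs b hb, ← integral_sub (hs.integrable_mul_conj (hK.1 a ha))
    (hs.integrable_mul_conj (hK.1 b hb)), ← integral_complex_ofReal]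
  refine integral_congr_ae (Filter.Eventually.of_forall fun z => ?_)
  simp only
  rw [← mul_sub, ← map_sub, Complex.mul_conj, Complex.normSq_eq_norm_sq]

theorem IsBergmanKernel.apply_self_eq_ofReal (hK : IsBergmanKernel X K) {w : Fin n → ℂ} (hw : w ∈ X) :
    K w w = ((K w w).re : ℂ) ∧ (K w w).re = ∫ z in X, ‖K z w‖ ^ 2 := by
  rw [← hK.integral_norm_sq hw]
  simp

theorem IsBergmanKernel.re_nonneg (hK : IsBergmanKernel X K) {w : Fin n → ℂ} (hw : w ∈ X) : 0 ≤ (K w w).re := by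
  rw [(hK.apply_self_eq_ofReal hw).2]
  positivity

theorem IsBergmanKernel.mem_slitPlane (hK : IsBergmanKernel X K) {w : Fin n → ℂ} (hw : w ∈ X) (h0 : K w w ≠ 0) :
    K w w ∈ Complex.slitPlane := by
  have h := (hK.apply_self_eq_ofReal hw).1
  refine Or.inl ((hK.re_nonneg hw).lt_of_ne' fun h1 => h0 ?_)
  rw [h, h1, Complex.ofReal_zero]

theorem IsBergmanKernel.apply_self_eq_zero_iff (hK : IsBergmanKernel X K) {w : Fin n → ℂ} (hw : w ∈ X) :
    K w w = 0 ↔ ∀ f, MemA2 X f → f w = 0 := by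
  refine ⟨fun h f hf => ?_, fun h => h (fun z => K z w) (hK.1 w hw)⟩
  have h1 : ∫ z in X, ‖K z w‖ ^ 2 = 0 := by
    have := hK.integral_norm_sq hw
    rw [h] at this
    exact_mod_cast this
  rw [integral_eq_zero_iff_of_nonneg (fun z => by positivity)
    (hK.1 w hw).integrable_norm_sq] at h1
  rw [hK.2 f hf w hw]
  refine (integral_congr_ae ?_).trans (integral_zero _ _)
  filter_upwards [h1] with z hz
  have : K z w = 0 := by simpa using hz
  simp [this]

/-- Near each point, `w ↦ K(·, w)` is Lipschitz as a map into the Bergman space. -/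
theorem IsBergmanKernel.exists_lipschitz (hX : IsOpen X) (hK : IsBergmanKernel X K) {p : Fin n → ℂ} (hp : p ∈ X) :
    ∃ R > 0, ball p (4 * R) ⊆ X ∧ ∃ C > 0,
      (∀ f, MemA2 X f → ∀ z ∈ ball p (4 * R), ‖f z‖ ≤ C * √(∫ z in X, ‖f z‖ ^ 2)) ∧
      (∀ w ∈ ball p (4 * R), √(∫ z in X, ‖K z w‖ ^ 2) ≤ C) ∧
      ∀ a ∈ ball p R, ∀ b ∈ ball p R, √(∫ z in X, ‖K z a - K z b‖ ^ 2) ≤ C * ‖a - b‖ := by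
  obtain ⟨R, hR, hRX, C, hC, hb⟩ := exists_norm_le_of_memA2 hX hp
  refine ⟨R, hR, hRX, max C (2 * C / R), lt_max_of_lt_left hC, ?_, ?_, ?_⟩
  · exact fun f hf z hz => (hb f hf z hz).trans
      (mul_le_mul_of_nonneg_right (le_max_left _ _) (Real.sqrt_nonneg _))
  · intro w hw
    refine le_trans ?_ (le_max_left _ _)
    set N := √(∫ z in X, ‖K z w‖ ^ 2) with hN
    have h1 := hb _ (hK.1 w (hRX hw)) w hw
    rw [← hK.integral_norm_sq (hRX hw), Complex.norm_real, Real.norm_of_nonneg (by positivity),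
      ← Real.sq_sqrt (by positivity : 0 ≤ ∫ z in X, ‖K z w‖ ^ 2), ← hN, Real.sqrt_sq
      (Real.sqrt_nonneg _)] at h1
    have h0 : 0 ≤ N := Real.sqrt_nonneg _
    by_contra! h
    nlinarith
  · intro a ha b hb'
    have h4 : ball p R ⊆ ball p (4 * R) := ball_subset_ball (by linarith)
    have hs := (hK.1 a (hRX (h4 ha))).sub (hK.1 b (hRX (h4 hb')))
    set N := √(∫ z in X, ‖K z a - K z b‖ ^ 2) with hN
    have hN0 : 0 ≤ N := Real.sqrt_nonneg _
    have h24 : ball p (2 * R) ⊆ ball p (4 * R) := ball_subset_ball (by linarith)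
    have h1 := norm_sub_le_of_ball hR (hs.1.mono (h24.trans hRX))
      (fun z hz => hb _ hs z (h24 hz)) ha hb'
    have h2 : N ^ 2 = ‖(K a a - K a b) - (K b a - K b b)‖ := by
      rw [← hK.integral_norm_sub_sq (hRX (h4 ha)) (hRX (h4 hb')), Complex.norm_real,
        Real.norm_of_nonneg (by positivity), hN, Real.sq_sqrt (by positivity)]
    rw [← h2] at h1
    have h3 : N ≤ 2 * C / R * ‖a - b‖ := by
      by_contra! h
      have : N ^ 2 ≤ N * (2 * C / R * ‖a - b‖) := h1.trans_eq (by rw [← hN]; ring)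
      have h0 : 0 ≤ 2 * C / R * ‖a - b‖ := by positivity
      nlinarith
    exact h3.trans (mul_le_mul_of_nonneg_right (le_max_right _ _) (norm_nonneg _))

end BergmanSpace

section BergmanMetric

variable {n : ℕ} {X : Set (Fin n → ℂ)} {K : (Fin n → ℂ) → (Fin n → ℂ) → ℂ}

/-- The holomorphic derivative of `K(·, w)` on the diagonal. -/
noncomputable def diagDeriv (K : (Fin n → ℂ) → (Fin n → ℂ) → ℂ) (w : Fin n → ℂ) :
    (Fin n → ℂ) →L[ℂ] ℂ :=
  fderiv ℂ (fun z => K z w) w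

/-- The real derivative of `u ↦ K(u, u)`. -/
noncomputable def diagRealDeriv (K : (Fin n → ℂ) → (Fin n → ℂ) → ℂ) (w : Fin n → ℂ) :
    (Fin n → ℂ) →L[ℝ] ℂ :=
  (diagDeriv K w).restrictScalars ℝ +
    (Complex.conjCLE : ℂ →L[ℝ] ℂ).comp ((diagDeriv K w).restrictScalars ℝ)

theorem norm_diagRealDeriv_le (w : Fin n → ℂ) :
    ‖diagRealDeriv K w‖ ≤ 2 * ‖diagDeriv K w‖ := by
  refine ContinuousLinearMap.opNorm_le_bound _ (by positivity) fun h => ?_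
  have h1 : diagRealDeriv K w h = diagDeriv K w h + (starRingEnd ℂ) (diagDeriv K w h) := rfl
  rw [h1]
  refine (norm_add_le _ _).trans ?_
  rw [Complex.norm_conj]
  linarith [(diagDeriv K w).le_opNorm h]

theorem IsBergmanKernel.exists_diagDeriv_lipschitz (hX : IsOpen X) (hK : IsBergmanKernel X K)
    {p : Fin n → ℂ} (hp : p ∈ X) :
    ∃ R > 0, ball p R ⊆ X ∧ ∃ M > 0, (∀ u ∈ ball p R, ‖diagDeriv K u‖ ≤ M) ∧
      (∀ u ∈ ball p R, ∀ v ∈ ball p R, ‖diagDeriv K u - diagDeriv K v‖ ≤ M * ‖u - v‖) ∧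
      ∀ u ∈ ball p R, HasFDerivAt (fun u => K u u) (diagRealDeriv K u) u := by
  obtain ⟨R, hR, hRX, C, hC, hb, hN, hlip⟩ := hK.exists_lipschitz hX hp
  have h4 : ball p R ⊆ ball p (4 * R) := ball_subset_ball (by linarith)
  have hbd : ∀ w ∈ ball p (4 * R), ∀ z ∈ ball p (4 * R), ‖K z w‖ ≤ C * C := fun w hw z hz =>
    (hb _ (hK.1 w (hRX hw)) z hz).trans (mul_le_mul_of_nonneg_left (hN w hw) hC.le)
  have hderiv : ∀ f : (Fin n → ℂ) → ℂ, DifferentiableOn ℂ f X → ∀ B : ℝ,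
      (∀ z ∈ ball p (4 * R), ‖f z‖ ≤ B) → ∀ u ∈ ball p R, ‖fderiv ℂ f u‖ ≤ 2 * B / R := by
    intro f hf B hB u hu
    have hsub : ball u R ⊆ ball p (4 * R) := by
      refine ball_subset_ball' ?_
      rw [mem_ball] at hu
      linarith
    exact norm_fderiv_le_of_ball hR (hf.mono (hsub.trans hRX)) fun z hz => hB z (hsub hz)
  refine ⟨R, hR, h4.trans hRX, max (2 * (C * C) / R) (2 * (C * C) / R ^ 2 + 2 * (C * C) / R),
    lt_max_of_lt_left (by positivity), ?_, ?_, ?_⟩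
  · exact fun u hu => (hderiv _ (hK.1 u (hRX (h4 hu))).1 _ (hbd u (h4 hu)) u hu).trans
      (le_max_left _ _)
  · intro u hu v hv
    have hKu := (hK.1 u (hRX (h4 hu))).1
    have hKv := (hK.1 v (hRX (h4 hv))).1
    have h1 := norm_fderiv_sub_le_of_ball hR (hKu.mono hRX) (hbd u (h4 hu)) hu hv
    have hs := (hK.1 u (hRX (h4 hu))).sub (hK.1 v (hRX (h4 hv)))
    have h2 := hderiv _ hs.1 (C * (C * ‖u - v‖)) (fun z hz => (hb _ hs z hz).trans
      (mul_le_mul_of_nonneg_left (hlip u hu v hv) hC.le)) v hv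
    have hvX : X ∈ 𝓝 v := hX.mem_nhds (hRX (h4 hv))
    rw [fderiv_fun_sub (hKu.differentiableAt hvX) (hKv.differentiableAt hvX)] at h2
    have h3 : diagDeriv K u - diagDeriv K v =
        (fderiv ℂ (fun z => K z u) u - fderiv ℂ (fun z => K z u) v) +
        (fderiv ℂ (fun z => K z u) v - fderiv ℂ (fun z => K z v) v) := by
      simp [diagDeriv]
    rw [h3]
    refine (norm_add_le _ _).trans ((add_le_add h1 h2).trans ?_)
    have h5 : 2 * (C * (C * ‖u - v‖)) / R = 2 * (C * C) / R * ‖u - v‖ := by ring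
    rw [h5, ← add_mul]
    exact mul_le_mul_of_nonneg_right (le_max_right _ _) (norm_nonneg _)
  · intro u hu
    have huX := hRX (h4 hu)
    have h1 : HasFDerivAt (fun z => K z u) (diagDeriv K u) u :=
      ((hK.1 u huX).1.differentiableAt (hX.mem_nhds huX)).hasFDerivAt
    have h2 : HasFDerivAt (fun z => K z u) ((diagDeriv K u).restrictScalars ℝ) u :=
      h1.restrictScalars ℝ
    have h3 : HasFDerivAt (fun z => (starRingEnd ℂ) (K z u))
        ((Complex.conjCLE : ℂ →L[ℝ] ℂ).comp ((diagDeriv K u).restrictScalars ℝ)) u :=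
      (Complex.conjCLE : ℂ →L[ℝ] ℂ).hasFDerivAt.comp u h2
    have h5 : HasFDerivAt (fun v => K v v - K v u - (starRingEnd ℂ) (K v u) + K u u)
        (0 : (Fin n → ℂ) →L[ℝ] ℂ) u := by
      refine Asymptotics.IsBigO.hasFDerivAt (n := 2) ?_ one_lt_two
      refine Asymptotics.IsBigO.of_bound (C ^ 2) ?_
      filter_upwards [isOpen_ball.mem_nhds hu] with v hv
      have h6 := hK.integral_norm_sub_sq (hRX (h4 hv)) huX
      have h7 : K v v - K v u - (starRingEnd ℂ) (K v u) + K u u =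
          ((∫ z in X, ‖K z v - K z u‖ ^ 2 : ℝ) : ℂ) := by
        rw [h6, hK.conj_symm (hRX (h4 hv)) huX]
        ring
      have h8 := hlip v hv u hu
      have h9 : 0 ≤ ∫ z in X, ‖K z v - K z u‖ ^ 2 := by positivity
      rw [h7, Complex.norm_real, Real.norm_of_nonneg h9, Real.norm_of_nonneg (by positivity),
        ← mul_pow, ← Real.sq_sqrt h9]
      exact pow_le_pow_left₀ (Real.sqrt_nonneg _) h8 2
    have h6 := (h5.add (h2.add h3)).sub_const (K u u)
    rw [zero_add] at h6
    refine h6.congr_of_eventuallyEq (Filter.Eventually.of_forall fun v => ?_)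
    simp only [Pi.add_apply]
    ring

theorem IsBergmanKernel.continuousOn_diag (hX : IsOpen X) (hK : IsBergmanKernel X K) :
    ContinuousOn (fun u => K u u) X := by
  intro p hp
  obtain ⟨R, hR, -, M, -, -, -, h⟩ := hK.exists_diagDeriv_lipschitz hX hp
  exact (h p (mem_ball_self hR)).continuousAt.continuousWithinAt

theorem IsBergmanKernel.isOpen_diag_ne_zero (hX : IsOpen X) (hK : IsBergmanKernel X K) :
    IsOpen {u ∈ X | K u u ≠ 0} :=
  (hK.continuousOn_diag hX).isOpen_inter_preimage hX isOpen_ne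

theorem norm_wderiv_le (μ : Fin n) (f : (Fin n → ℂ) → ℂ) (z : Fin n → ℂ) :
    ‖wderiv μ f z‖ ≤ ‖fderiv ℝ f z‖ := by
  have h1 := (fderiv ℝ f z).le_opNorm (Pi.single μ 1)
  have h2 := (fderiv ℝ f z).le_opNorm (Pi.single μ Complex.I)
  rw [Pi.norm_single, norm_one, mul_one] at h1
  rw [Pi.norm_single, Complex.norm_I, mul_one] at h2
  rw [wderiv, norm_div, Complex.norm_ofNat, div_le_iff₀ two_pos]
  refine (norm_sub_le _ _).trans ?_
  rw [norm_mul, Complex.norm_I, one_mul]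
  linarith

theorem bergmanMetric_le {z : Fin n → ℂ} {C : ℝ} (hC : ∀ μ ν, ‖bergmanTensor K μ ν z‖ ≤ C)
    (ξ : Fin n → ℂ) : bergmanMetric K z ξ ≤ n * √C * ‖ξ‖ := by
  rcases Nat.eq_zero_or_pos n with rfl | hn
  · simp [bergmanMetric, bergmanQuad]
  have hC0 : 0 ≤ C := (norm_nonneg _).trans (hC ⟨0, hn⟩ ⟨0, hn⟩)
  refine Real.sqrt_le_iff.2 ⟨by positivity, ?_⟩
  refine (Complex.re_le_norm _).trans ?_
  have h1 : ∀ μ ν, ‖bergmanTensor K μ ν z * ξ μ * (starRingEnd ℂ) (ξ ν)‖ ≤ C * ‖ξ‖ * ‖ξ‖ := by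
    intro μ ν
    rw [norm_mul, norm_mul, Complex.norm_conj]
    gcongr
    · exact hC μ ν
    · exact norm_le_pi_norm ξ μ
    · exact norm_le_pi_norm ξ ν
  refine (norm_sum_le_of_le _ fun μ _ => norm_sum_le_of_le _ fun ν _ => h1 μ ν).trans ?_
  simp only [Finset.sum_const, Finset.card_univ, Fintype.card_fin, nsmul_eq_mul]
  rw [mul_pow, mul_pow, Real.sq_sqrt hC0]
  exact le_of_eq (by ring)

theorem bergmanMetric_smul (z ξ : Fin n → ℂ) (c : ℝ) :
    bergmanMetric K z (c • ξ) = |c| * bergmanMetric K z ξ := by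
  have h1 : bergmanQuad K z (c • ξ) = c ^ 2 * bergmanQuad K z ξ := by
    have : ∑ μ, ∑ ν, bergmanTensor K μ ν z * (c • ξ) μ * (starRingEnd ℂ) ((c • ξ) ν) =
        ((c ^ 2 : ℝ) : ℂ) * ∑ μ, ∑ ν, bergmanTensor K μ ν z * ξ μ * (starRingEnd ℂ) (ξ ν) := by
      simp only [Finset.mul_sum]
      refine Finset.sum_congr rfl fun μ _ => Finset.sum_congr rfl fun ν _ => ?_
      simp only [Pi.smul_apply, Complex.real_smul, map_mul, Complex.conj_ofReal]
      push_cast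
      ring
    rw [bergmanQuad, this, Complex.re_ofReal_mul, bergmanQuad]
  rw [bergmanMetric, h1, Real.sqrt_mul (sq_nonneg c), Real.sqrt_sq_eq_abs, bergmanMetric]

/-- Away from the zeros of `K(z, z)` the Bergman metric is locally bounded. -/
theorem IsBergmanKernel.exists_bergmanMetric_le (hX : IsOpen X) (hK : IsBergmanKernel X K)
    {p : Fin n → ℂ} (hp : p ∈ X) (hp0 : K p p ≠ 0) :
    ∃ R > 0, ball p R ⊆ X ∧ ∃ C ≥ 0, ∀ z ∈ ball p R, K z z ≠ 0 ∧
      ∀ ξ, bergmanMetric K z ξ ≤ C * ‖ξ‖ := by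
  obtain ⟨R₀, hR₀, hRX₀, M, hM, hD, hDl, hk⟩ := hK.exists_diagDeriv_lipschitz hX hp
  set m := ‖K p p‖ / 2 with hm
  have hm0 : 0 < m := by positivity
  have hev : ∀ᶠ u in 𝓝 p, m < ‖K u u‖ :=
    ((hk p (mem_ball_self hR₀)).continuousAt.norm).eventually
      (lt_mem_nhds (half_lt_self (norm_pos_iff.2 hp0)))
  obtain ⟨R, hR, hRb⟩ := Metric.mem_nhds_iff.1 (Filter.inter_mem hev (ball_mem_nhds p hR₀))
  have hR₁ : ∀ u ∈ ball p R, m < ‖K u u‖ := fun u hu => (hRb hu).1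
  have hR₂ : ball p R ⊆ ball p R₀ := fun u hu => (hRb hu).2
  have hne : ∀ u ∈ ball p R, K u u ≠ 0 := fun u hu => norm_pos_iff.1 (hm0.trans (hR₁ u hu))
  have hkl : ∀ u ∈ ball p R, ∀ v ∈ ball p R, ‖K u u - K v v‖ ≤ 2 * M * ‖u - v‖ := by
    intro u hu v hv
    refine (convex_ball p R).norm_image_sub_le_of_norm_hasFDerivWithin_le (𝕜 := ℝ)
      (f := fun u => K u u) (f' := diagRealDeriv K)
      (fun x hx => (hk x (hR₂ hx)).hasFDerivWithinAt) (fun x hx => ?_) hv hu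
    exact (norm_diagRealDeriv_le x).trans (by linarith [hD x (hR₂ hx)])
  -- the first derivatives of `log K(u, u)`
  have hbar : ∀ ν, ∀ u ∈ ball p R, wderivBar ν (fun u => Complex.log (K u u)) u =
      (K u u)⁻¹ * (starRingEnd ℂ) (diagDeriv K u (Pi.single ν 1)) := by
    intro ν u hu
    have h1 := HasFDerivAt.comp (f := fun u => K u u) u ((Complex.hasDerivAt_log
      (hK.mem_slitPlane (hRX₀ (hR₂ hu)) (hne u hu))).hasFDerivAt.restrictScalars ℝ)
      (hk u (hR₂ hu))
    have hL : ∀ h, ((ContinuousLinearMap.toSpanSingleton ℂ (K u u)⁻¹).restrictScalars ℝ).comp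
        (diagRealDeriv K u) h = (K u u)⁻¹ * diagRealDeriv K u h := fun h => by
      simp [mul_comm]
    have h0 : fderiv ℝ (fun u => Complex.log (K u u)) u = _ := h1.fderiv
    rw [wderivBar, h0]
    have h2 : (Pi.single ν Complex.I : Fin n → ℂ) = Complex.I • Pi.single ν 1 := by
      rw [← Pi.single_smul, smul_eq_mul, mul_one]
    have h3 : ∀ h, diagRealDeriv K u h =
      diagDeriv K u h + (starRingEnd ℂ) (diagDeriv K u h) := fun h => rfl
    simp only [hL, h3, h2, map_smul, smul_eq_mul, map_mul,
      Complex.conj_I]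
    linear_combination ((K u u)⁻¹ * (diagDeriv K u (Pi.single ν 1) -
      (starRingEnd ℂ) (diagDeriv K u (Pi.single ν 1))) / 2) * Complex.I_sq
  set C₁ : ℝ := M / m + M * (2 * M) / (m * m) with hC₁
  have hC₁0 : 0 ≤ C₁ := by positivity
  have hlip : ∀ ν, ∀ u ∈ ball p R, ∀ v ∈ ball p R,
      ‖wderivBar ν (fun u => Complex.log (K u u)) u -
        wderivBar ν (fun u => Complex.log (K u u)) v‖ ≤ C₁ * ‖u - v‖ := by
    intro ν u hu v hv
    rw [hbar ν u hu, hbar ν v hv]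
    set a := diagDeriv K u (Pi.single ν 1)
    set b := diagDeriv K v (Pi.single ν 1)
    have hab : ‖a - b‖ ≤ M * ‖u - v‖ := by
      have := (diagDeriv K u - diagDeriv K v).le_of_opNorm_le
        (hDl u (hR₂ hu) v (hR₂ hv)) (Pi.single ν 1)
      rwa [Pi.norm_single, norm_one, mul_one] at this
    have hb : ‖b‖ ≤ M := by
      have := (diagDeriv K v).le_of_opNorm_le (hD v (hR₂ hv)) (Pi.single ν 1)
      rwa [Pi.norm_single, norm_one, mul_one] at this
    have h1 : (K u u)⁻¹ * (starRingEnd ℂ) a - (K v v)⁻¹ * (starRingEnd ℂ) b =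
        (K u u)⁻¹ * (starRingEnd ℂ) (a - b) -
          (starRingEnd ℂ) b * (K u u - K v v) * (K u u * K v v)⁻¹ := by
      have := hne u hu
      have := hne v hv
      rw [map_sub]
      field_simp
      ring
    have h2 : ‖(K u u)⁻¹ * (starRingEnd ℂ) (a - b)‖ ≤ m⁻¹ * (M * ‖u - v‖) := by
      rw [norm_mul, norm_inv, Complex.norm_conj]
      gcongr
      exact (hR₁ u hu).le
    have h3 : ‖(starRingEnd ℂ) b * (K u u - K v v) * (K u u * K v v)⁻¹‖ ≤
        M * (2 * M * ‖u - v‖) * (m * m)⁻¹ := by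
      rw [norm_mul, norm_mul, norm_inv, norm_mul, Complex.norm_conj]
      gcongr
      · exact hkl u hu v hv
      · exact (hR₁ u hu).le
      · exact (hR₁ v hv).le
    rw [h1]
    refine (norm_sub_le _ _).trans ((add_le_add h2 h3).trans (le_of_eq ?_))
    rw [hC₁]
    ring
  refine ⟨R, hR, hR₂.trans hRX₀, n * √C₁, by positivity, fun z hz => ⟨hne z hz, fun ξ => ?_⟩⟩
  refine bergmanMetric_le (fun μ ν => ?_) ξ
  refine (norm_wderiv_le _ _ _).trans ?_
  have h1 : LipschitzOnWith ⟨C₁, hC₁0⟩ (wderivBar ν (fun u => Complex.log (K u u))) (ball p R) :=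
    LipschitzOnWith.of_dist_le_mul fun u hu v hv => by
      rw [dist_eq_norm, dist_eq_norm]
      exact hlip ν u hu v hv
  exact norm_fderiv_le_of_lipschitzOn ℝ (isOpen_ball.mem_nhds hz) h1

end BergmanMetric

section Curves

variable {n : ℕ} {X : Set (Fin n → ℂ)} {K : (Fin n → ℂ) → (Fin n → ℂ) → ℂ}

theorem piecewiseC1_iff {γ : ℝ → (Fin n → ℂ)} :
    PiecewiseC1 γ ↔ ContinuousOn γ (Icc 0 1) ∧ ∃ S : Finset ℝ, ∀ a b, 0 ≤ a → a < b → b ≤ 1 →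
      (∀ s ∈ S, s ∉ Ioo a b) → ContDiffOn ℝ 1 γ (Icc a b) := by
  refine and_congr_right fun _ => ⟨?_, ?_⟩
  · rintro ⟨k, t, -, h0, h1, ht⟩
    refine ⟨Finset.univ.image t, fun a b ha hab hb hS => ?_⟩
    obtain ⟨i, hi, hi'⟩ : ∃ i : Fin k, t i.castSucc ≤ a ∧ a < t i.succ := by
      by_contra! h
      have : ∀ i, t i ≤ a := Fin.induction (by rwa [h0]) h
      have := this (Fin.last k)
      rw [h1] at this
      linarith
    have h2 := hS (t i.succ) (Finset.mem_image_of_mem _ (Finset.mem_univ _))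
    refine (ht i).mono (Icc_subset_Icc hi ?_)
    by_contra! h
    exact h2 ⟨hi', h⟩
  · rintro ⟨S, hS⟩
    set S' : Finset ℝ := insert 0 (insert 1 (S.filter fun s => 0 < s ∧ s < 1)) with hS'
    have h0 : (0 : ℝ) ∈ S' := by simp [hS']
    have h1 : (1 : ℝ) ∈ S' := by simp [hS']
    have hI : ∀ s ∈ S', 0 ≤ s ∧ s ≤ 1 := by
      intro s hs
      simp only [hS', Finset.mem_insert, Finset.mem_filter] at hs
      rcases hs with rfl | rfl | ⟨-, h2, h3⟩
      · norm_num
      · norm_num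
      · exact ⟨h2.le, h3.le⟩
    obtain ⟨k, hk⟩ : ∃ k, S'.card = k + 1 :=
      Nat.exists_eq_succ_of_ne_zero (Finset.card_pos.2 ⟨0, h0⟩).ne'
    have hmem : ∀ i, S'.orderEmbOfFin hk i ∈ S' := fun i => S'.orderEmbOfFin_mem hk i
    have hrange : ∀ s ∈ S', ∃ i, S'.orderEmbOfFin hk i = s := fun s hs => by
      have := S'.range_orderEmbOfFin hk
      rw [← Finset.mem_coe, ← this] at hs
      exact hs
    refine ⟨k, S'.orderEmbOfFin hk, (S'.orderEmbOfFin hk).strictMono, ?_, ?_, fun i => ?_⟩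
    · obtain ⟨i, hi⟩ := hrange 0 h0
      refine le_antisymm ?_ (hI _ (hmem _)).1
      rw [← hi]
      exact (S'.orderEmbOfFin hk).monotone (Fin.zero_le i)
    · obtain ⟨i, hi⟩ := hrange 1 h1
      refine le_antisymm (hI _ (hmem _)).2 ?_
      rw [← hi]
      exact (S'.orderEmbOfFin hk).monotone (Fin.le_last i)
    · refine hS _ _ (hI _ (hmem _)).1 ((S'.orderEmbOfFin hk).strictMono i.castSucc_lt_succ)
        (hI _ (hmem _)).2 fun s hs hsI => ?_
      have hs' : s ∈ S' := by
        simp only [hS', Finset.mem_insert, Finset.mem_filter]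
        exact Or.inr (Or.inr ⟨hs, (hI _ (hmem _)).1.trans_lt hsI.1,
          hsI.2.trans_le (hI _ (hmem _)).2⟩)
      obtain ⟨j, rfl⟩ := hrange s hs'
      have h2 := (S'.orderEmbOfFin hk).lt_iff_lt.1 hsI.1
      have h3 := (S'.orderEmbOfFin hk).lt_iff_lt.1 hsI.2
      rw [Fin.lt_def] at h2 h3
      simp only [Fin.val_castSucc, Fin.val_succ] at h2 h3
      omega

/-- The curves over which the Bergman pseudodistance is an infimum. -/
def IsAdmissibleCurve (X : Set (Fin n → ℂ)) (z w : Fin n → ℂ) (γ : ℝ → (Fin n → ℂ)) : Prop :=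
  γ 0 = z ∧ γ 1 = w ∧ (∀ t ∈ Icc (0 : ℝ) 1, γ t ∈ X) ∧ PiecewiseC1 γ

theorem bergmanLength_nonneg (γ : ℝ → (Fin n → ℂ)) : 0 ≤ bergmanLength K γ :=
  intervalIntegral.integral_nonneg zero_le_one fun _ _ => Real.sqrt_nonneg _

theorem bergmanDist_le {z w : Fin n → ℂ} {γ : ℝ → (Fin n → ℂ)} (h : IsAdmissibleCurve X z w γ) :
    bergmanDist X K z w ≤ bergmanLength K γ := by
  refine csInf_le ⟨0, ?_⟩ ⟨γ, h.1, h.2.1, h.2.2.1, h.2.2.2, rfl⟩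
  rintro _ ⟨γ, -, -, -, -, rfl⟩
  exact bergmanLength_nonneg γ

theorem exists_bergmanLength_lt {z w γ₀} (h₀ : IsAdmissibleCurve X z w γ₀) {r : ℝ}
    (hr : bergmanDist X K z w < r) :
    ∃ γ, IsAdmissibleCurve X z w γ ∧ bergmanLength K γ < r := by
  obtain ⟨_, ⟨γ, h1, h2, h3, h4, rfl⟩, hlt⟩ :=
    exists_lt_of_csInf_lt (by exact ⟨_, γ₀, h₀.1, h₀.2.1, h₀.2.2.1, h₀.2.2.2, rfl⟩) hr
  exact ⟨γ, ⟨h1, h2, h3, h4⟩, hlt⟩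

theorem isAdmissibleCurve_of_contDiffOn {z w : Fin n → ℂ} {γ : ℝ → (Fin n → ℂ)} (h0 : γ 0 = z)
    (h1 : γ 1 = w) (hX : ∀ t ∈ Icc (0 : ℝ) 1, γ t ∈ X) (hγ : ContDiffOn ℝ 1 γ (Icc 0 1)) :
    IsAdmissibleCurve X z w γ :=
  ⟨h0, h1, hX, piecewiseC1_iff.2 ⟨hγ.continuousOn, ∅, fun _ _ ha _ hb _ =>
    hγ.mono (Icc_subset_Icc ha hb)⟩⟩

theorem exists_isAdmissibleCurve (hdist : BergmanDistIsDistance X K) {z w : Fin n → ℂ}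
    (hz : z ∈ X) (hw : w ∈ X) : ∃ γ, IsAdmissibleCurve X z w γ := by
  rcases eq_or_ne z w with rfl | hne
  · exact ⟨fun _ => z, isAdmissibleCurve_of_contDiffOn rfl rfl (fun _ _ => hz) contDiffOn_const⟩
  · by_contra! h
    have h1 := hdist z hz w hw hne
    have h2 : {L : ℝ | ∃ γ : ℝ → (Fin n → ℂ), γ 0 = z ∧ γ 1 = w ∧
        (∀ t ∈ Icc (0 : ℝ) 1, γ t ∈ X) ∧ PiecewiseC1 γ ∧ L = bergmanLength K γ} = ∅ := by
      refine eq_empty_of_forall_notMem ?_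
      rintro _ ⟨γ, h1, h2, h3, h4, -⟩
      exact h γ ⟨h1, h2, h3, h4⟩
    rw [bergmanDist, h2, Real.sInf_empty] at h1
    exact h1.false

/-- An initial piece of a curve, reparametrized, has smaller length. -/
theorem IsAdmissibleCurve.truncate {z w : Fin n → ℂ} {γ : ℝ → (Fin n → ℂ)}
    (h : IsAdmissibleCurve X z w γ)
    (hint : IntervalIntegrable (fun t => bergmanMetric K (γ t) (deriv γ t)) volume 0 1)
    {τ : ℝ} (hτ0 : 0 < τ) (hτ1 : τ ≤ 1) :
    ∃ γ', IsAdmissibleCurve X z (γ τ) γ' ∧ bergmanLength K γ' ≤ bergmanLength K γ := by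
  obtain ⟨h0, h1, hX, hpw⟩ := h
  obtain ⟨hc, S, hS⟩ := piecewiseC1_iff.1 hpw
  have hmaps : MapsTo (fun t : ℝ => τ * t) (Icc 0 1) (Icc 0 1) := fun t ht =>
    ⟨mul_nonneg hτ0.le ht.1, mul_le_one₀ hτ1 ht.1 ht.2⟩
  refine ⟨fun t => γ (τ * t), ⟨by simp [h0], by simp, fun t ht => hX _ (hmaps ht),
    piecewiseC1_iff.2 ⟨hc.comp (by fun_prop) hmaps, S.image (τ⁻¹ * ·),
      fun a b ha hab hb hab' => ?_⟩⟩, ?_⟩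
  · refine (hS (τ * a) (τ * b) (by positivity) (by gcongr)
      (hmaps ⟨ha.trans hab.le, hb⟩).2 fun s hs hsI => ?_).comp (by fun_prop)
      fun t ht => ⟨by have := ht.1; gcongr, by have := ht.2; gcongr⟩
    refine hab' _ (Finset.mem_image_of_mem _ hs) ⟨?_, ?_⟩
    · rw [lt_inv_mul_iff₀ hτ0]
      exact hsI.1
    · rw [inv_mul_lt_iff₀ hτ0]
      exact hsI.2
  · have h2 : ∀ t, bergmanMetric K (γ (τ * t)) (deriv (fun t => γ (τ * t)) t) =
        τ * bergmanMetric K (γ (τ * t)) (deriv γ (τ * t)) := by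
      intro t
      rw [deriv_comp_mul_left, bergmanMetric_smul, abs_of_pos hτ0]
    simp only [bergmanLength, h2]
    rw [intervalIntegral.integral_const_mul, ← smul_eq_mul,
      intervalIntegral.smul_integral_comp_mul_left
        (fun t => bergmanMetric K (γ t) (deriv γ t)), mul_zero, mul_one]
    exact intervalIntegral.integral_mono_interval le_rfl hτ0.le hτ1
      (Filter.Eventually.of_forall fun _ => Real.sqrt_nonneg _) hint

/-- A curve may be prolonged by a segment on which the metric is bounded. -/
theorem IsAdmissibleCurve.append_segment {z w w' : Fin n → ℂ} {γ : ℝ → (Fin n → ℂ)}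
    (h : IsAdmissibleCurve X z w γ) {C : ℝ} (hseg : ∀ s ∈ Icc (0 : ℝ) 1, w + s • (w' - w) ∈ X ∧
      ∀ ξ, bergmanMetric K (w + s • (w' - w)) ξ ≤ C * ‖ξ‖) :
    ∃ γ', IsAdmissibleCurve X z w' γ' ∧
      bergmanLength K γ' ≤ bergmanLength K γ + C * ‖w' - w‖ := by
  obtain ⟨h0, h1, hX, hpw⟩ := h
  obtain ⟨hc, S, hS⟩ := piecewiseC1_iff.1 hpw
  set σ : ℝ → (Fin n → ℂ) := fun t => w + (2 * t - 1) • (w' - w) with hσ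
  set γ' : ℝ → (Fin n → ℂ) := fun t => if t ≤ 1 / 2 then γ (2 * t) else σ t with hγ'
  have hσs : ContDiff ℝ 1 σ := by fun_prop
  have hl : ∀ t, t ≤ 1 / 2 → γ' t = γ (2 * t) := fun t ht => if_pos ht
  have hr : ∀ t, 1 / 2 ≤ t → γ' t = σ t := by
    intro t ht
    rcases ht.eq_or_lt with rfl | ht
    · rw [hl _ le_rfl]
      simp [hσ, h1]
    · exact if_neg (not_le.2 ht)
  have hml : MapsTo (fun t : ℝ => 2 * t) (Icc 0 (1 / 2)) (Icc 0 1) := fun t ht =>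
    ⟨by linarith [ht.1], by linarith [ht.2]⟩
  have hCnonneg : 0 ≤ C * ‖w' - w‖ :=
    (Real.sqrt_nonneg _).trans ((hseg 0 ⟨le_rfl, zero_le_one⟩).2 (w' - w))
  refine ⟨γ', ⟨?_, ?_, fun t ht => ?_, piecewiseC1_iff.2 ⟨?_,
    insert (1 / 2) (S.image (2⁻¹ * ·)), fun a b ha hab hb hab' => ?_⟩⟩, ?_⟩
  · rw [hl 0 (by norm_num), mul_zero, h0]
  · rw [hr 1 (by norm_num)]
    simp only [hσ]
    norm_num
  · rcases le_total t (1 / 2) with h2 | h2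
    · rw [hl t h2]
      exact hX _ (hml ⟨ht.1, h2⟩)
    · rw [hr t h2]
      exact (hseg _ ⟨by linarith, by linarith [ht.2]⟩).1
  · rw [← Icc_union_Icc_eq_Icc (b := (1 / 2 : ℝ)) (by norm_num) (by norm_num)]
    refine ContinuousOn.union_of_isClosed ?_ ?_ isClosed_Icc isClosed_Icc
    · exact (hc.comp (by fun_prop) hml).congr fun t ht => hl t ht.2
    · exact hσs.continuous.continuousOn.congr fun t ht => hr t ht.1
  · have h2 : (1 / 2 : ℝ) ∉ Ioo a b := hab' _ (Finset.mem_insert_self _ _)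
    rcases le_or_gt (1 / 2) a with h3 | h3
    · exact hσs.contDiffOn.congr fun t ht => hr t (h3.trans ht.1)
    · have h4 : b ≤ 1 / 2 := by
        by_contra! h4
        exact h2 ⟨h3, h4⟩
      refine ContDiffOn.congr (f := fun t => γ (2 * t)) ?_ fun t ht => hl t (ht.2.trans h4)
      refine (hS (2 * a) (2 * b) (by positivity) (by gcongr) (by linarith)
        fun s hs hsI => ?_).comp (by fun_prop)
        fun t ht => ⟨by have := ht.1; gcongr, by have := ht.2; gcongr⟩
      refine hab' _ (Finset.mem_insert_of_mem (Finset.mem_image_of_mem _ hs)) ⟨?_, ?_⟩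
      · have := hsI.1
        linarith
      · have := hsI.2
        linarith
  · set F : ℝ → ℝ := fun t => bergmanMetric K (γ' t) (deriv γ' t) with hF
    by_cases hint : IntervalIntegrable F volume 0 1
    swap
    · have : bergmanLength K γ' = 0 := intervalIntegral.integral_undef hint
      rw [this]
      exact add_nonneg (bergmanLength_nonneg γ) hCnonneg
    have hi1 : IntervalIntegrable F volume 0 (1 / 2) := hint.mono_set (by
      rw [uIcc_of_le (by norm_num), uIcc_of_le (by norm_num)]
      exact Icc_subset_Icc le_rfl (by norm_num))
    have hi2 : IntervalIntegrable F volume (1 / 2) 1 := hint.mono_set (by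
      rw [uIcc_of_le (by norm_num), uIcc_of_le (by norm_num)]
      exact Icc_subset_Icc (by norm_num) le_rfl)
    have hsplit : bergmanLength K γ' =
        (∫ t in (0 : ℝ)..(1 / 2), F t) + ∫ t in (1 / 2 : ℝ)..1, F t :=
      (intervalIntegral.integral_add_adjacent_intervals hi1 hi2).symm
    rw [hsplit]
    refine add_le_add (le_of_eq ?_) ?_
    · have h2 : ∀ᵐ t ∂volume, t ∈ uIoc (0 : ℝ) (1 / 2) →
          F t = 2 * bergmanMetric K (γ (2 * t)) (deriv γ (2 * t)) := by
        filter_upwards [compl_mem_ae_iff.2 (measure_singleton (1 / 2 : ℝ))] with t ht1 ht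
        rw [uIoc_of_le (by norm_num)] at ht
        have ht2 : t < 1 / 2 := lt_of_le_of_ne ht.2 ht1
        have h3 : γ' =ᶠ[𝓝 t] fun t => γ (2 * t) :=
          Filter.eventually_of_mem (Iio_mem_nhds ht2) fun s hs => hl s (le_of_lt hs)
        simp only [hF]
        rw [h3.deriv_eq, hl t ht.2, deriv_comp_mul_left, bergmanMetric_smul,
          abs_of_pos two_pos]
      rw [intervalIntegral.integral_congr_ae h2, intervalIntegral.integral_const_mul,
        ← smul_eq_mul, intervalIntegral.smul_integral_comp_mul_left
          (fun t => bergmanMetric K (γ t) (deriv γ t)), mul_zero]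
      norm_num [bergmanLength]
    · have h2 : ∀ t ∈ uIoc (1 / 2 : ℝ) 1, ‖F t‖ ≤ 2 * (C * ‖w' - w‖) := by
        intro t ht
        rw [uIoc_of_le (by norm_num)] at ht
        have h3 : γ' =ᶠ[𝓝 t] σ :=
          Filter.eventually_of_mem (Ioi_mem_nhds ht.1) fun s hs => hr s (le_of_lt hs)
        have h4 : HasDerivAt σ ((2 : ℝ) • (w' - w)) t := by
          have h5 : HasDerivAt (fun t : ℝ => 2 * t - 1) 2 t := by
            simpa using ((hasDerivAt_id t).const_mul 2).sub_const 1
          exact (h5.smul_const (w' - w)).const_add w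
        have h5 : F t = bergmanMetric K (σ t) ((2 : ℝ) • (w' - w)) := by
          simp only [hF]
          rw [h3.deriv_eq, h4.deriv, hr t ht.1.le]
        rw [h5, bergmanMetric_smul, abs_of_pos two_pos, Real.norm_of_nonneg (by
          exact mul_nonneg two_pos.le (Real.sqrt_nonneg _))]
        exact mul_le_mul_of_nonneg_left
          ((hseg _ ⟨by linarith [ht.1], by linarith [ht.2]⟩).2 _) two_pos.le
      have h3 := intervalIntegral.norm_integral_le_of_norm_le_const h2
      refine (Real.le_norm_self _).trans (h3.trans (le_of_eq ?_))
      norm_num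
      ring

end Curves

section DiagonalZeros

variable {n : ℕ} {X : Set (Fin n → ℂ)} {K : (Fin n → ℂ) → (Fin n → ℂ) → ℂ}

/-- Since `Complex.log 0 = 0`, the formal derivative of `log f` vanishes at the zeros of `f`. -/
theorem fderiv_clog_eq_zero {E : Type*} [NormedAddCommGroup E] [NormedSpace ℝ E] {f : E → ℂ}
    {z : E} (hf : ContinuousAt f z) (h0 : f z = 0) :
    fderiv ℝ (fun u => Complex.log (f u)) z = 0 := by
  by_cases hd : DifferentiableAt ℝ (fun u => Complex.log (f u)) z
  swap
  · exact fderiv_zero_of_not_differentiableAt hd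
  have h1 : ∀ᶠ u in 𝓝 z, ‖Complex.log (f u)‖ < 1 := by
    refine hd.continuousAt.norm.eventually (gt_mem_nhds ?_)
    simp [h0]
  have h2 : ∀ᶠ u in 𝓝 z, ‖f u‖ < Real.exp (-1) := by
    refine hf.norm.eventually (gt_mem_nhds ?_)
    simp only [h0, norm_zero]
    exact Real.exp_pos _
  have h3 : (fun u => Complex.log (f u)) =ᶠ[𝓝 z] fun _ => 0 := by
    filter_upwards [h1, h2] with u hu1 hu2
    have : f u = 0 := by
      by_contra hne
      rw [← Complex.exp_log hne, Complex.norm_exp, Real.exp_lt_exp] at hu2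
      have := (abs_le.1 (Complex.abs_re_le_norm (Complex.log (f u)))).1
      linarith
    rw [this, Complex.log_zero]
  rw [h3.fderiv_eq, fderiv_const_apply]

theorem wderiv_mul_sum (f : (Fin n → ℂ) → ℂ) (z ξ : Fin n → ℂ) :
    ∑ μ, wderiv μ f z * ξ μ =
      (fderiv ℝ f z ξ - Complex.I * fderiv ℝ f z (Complex.I • ξ)) / 2 := by
  set A := fderiv ℝ f z
  have hI : ∀ v, A (Complex.I • Complex.I • v) = -A v := fun v => by
    rw [smul_smul, Complex.I_mul_I, neg_one_smul, map_neg]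
  have hc : ∀ (c : ℂ) v, A (c • v) - Complex.I * A (Complex.I • c • v) =
      c * (A v - Complex.I * A (Complex.I • v)) := by
    intro c v
    have h1 : ∀ u, A (c • u) = c.re * A u + c.im * A (Complex.I • u) := fun u => by
      have : c • u = c.re • u + c.im • Complex.I • u := by
        conv_lhs => rw [← Complex.re_add_im c]
        rw [add_smul, mul_smul]
        rfl
      rw [this, map_add, map_smul, map_smul, Complex.real_smul, Complex.real_smul]
    rw [smul_comm Complex.I c v, h1 v, h1 (Complex.I • v), hI]
    conv_rhs => rw [← Complex.re_add_im c]
    linear_combination (c.im * A (Complex.I • v)) * Complex.I_sq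
  have hξ : ξ = ∑ μ, ξ μ • (Pi.single μ 1 : Fin n → ℂ) := by
    simp only [← Pi.single_smul, smul_eq_mul, mul_one]
    exact (Finset.univ_sum_single ξ).symm
  conv_rhs => rw [hξ]
  rw [Finset.smul_sum, map_sum, map_sum, Finset.mul_sum, ← Finset.sum_sub_distrib,
    Finset.sum_div]
  refine Finset.sum_congr rfl fun μ _ => ?_
  rw [hc, wderiv]
  have : (Pi.single μ Complex.I : Fin n → ℂ) = Complex.I • Pi.single μ 1 := by
    rw [← Pi.single_smul, smul_eq_mul, mul_one]
  rw [this]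
  ring

/-- The formal Bergman metric vanishes along discs of zeros of `K(z, z)`. -/
theorem bergmanMetric_eq_zero_of_disc (hX : IsOpen X) (hK : IsBergmanKernel X K)
    {ψ : ℂ → (Fin n → ℂ)} {V : Set ℂ} (hV : IsOpen V) (hψ : DifferentiableOn ℂ ψ V)
    (hψX : ∀ s ∈ V, ψ s ∈ X ∧ K (ψ s) (ψ s) = 0) {t : ℂ} (ht : t ∈ V) :
    bergmanMetric K (ψ t) (deriv ψ t) = 0 := by
  have hd : HasDerivAt ψ (deriv ψ t) t := (hψ.differentiableAt (hV.mem_nhds ht)).hasDerivAt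
  have hbar : ∀ ν, ∀ s ∈ V, wderivBar ν (fun u => Complex.log (K u u)) (ψ s) = 0 := by
    intro ν s hs
    have h1 := fderiv_clog_eq_zero (f := fun u => K u u)
      ((hK.continuousOn_diag hX).continuousAt (hX.mem_nhds (hψX s hs).1)) (hψX s hs).2
    simp [wderivBar, h1]
  have hA : ∀ ν, ∀ c : ℂ, fderiv ℝ (wderivBar ν fun u => Complex.log (K u u)) (ψ t)
      (c • deriv ψ t) = 0 := by
    intro ν c
    by_cases hdiff : DifferentiableAt ℝ (wderivBar ν fun u => Complex.log (K u u)) (ψ t)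
    swap
    · simp [fderiv_zero_of_not_differentiableAt hdiff]
    have h1 : HasFDerivAt ψ ((ContinuousLinearMap.toSpanSingleton ℂ (deriv ψ t)).restrictScalars ℝ)
        t := hd.hasFDerivAt.restrictScalars ℝ
    have h2 := hdiff.hasFDerivAt.comp t h1
    have h3 : HasFDerivAt ((wderivBar ν fun u => Complex.log (K u u)) ∘ ψ) (0 : ℂ →L[ℝ] ℂ) t :=
      (hasFDerivAt_const (0 : ℂ) t).congr_of_eventuallyEq
        (Filter.eventually_of_mem (hV.mem_nhds ht) (hbar ν))
    have h4 := congrArg (fun L : ℂ →L[ℝ] ℂ => L c) (h2.unique h3)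
    simpa using h4
  have h1 : bergmanQuad K (ψ t) (deriv ψ t) = 0 := by
    rw [bergmanQuad, Finset.sum_comm]
    have : ∀ ν, ∑ μ, bergmanTensor K μ ν (ψ t) * deriv ψ t μ * (starRingEnd ℂ) (deriv ψ t ν) =
        0 := by
      intro ν
      rw [← Finset.sum_mul]
      have h2 := wderiv_mul_sum (wderivBar ν fun u => Complex.log (K u u)) (ψ t) (deriv ψ t)
      have h3 := hA ν 1
      rw [one_smul] at h3
      rw [h3, hA ν Complex.I, mul_zero, sub_zero, zero_div] at h2
      exact mul_eq_zero_of_left h2 _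
    simp [this]
  rw [bergmanMetric, h1, Real.sqrt_zero]

/-- If the Bergman pseudodistance is a distance, then `K(z, z)` has only countably many zeros. -/
theorem IsBergmanKernel.countable_diag_zero (hX : IsOpen X) (hK : IsBergmanKernel X K)
    (hdist : BergmanDistIsDistance X K) : {z ∈ X | K z z = 0}.Countable := by
  by_contra hc
  have hset : {z ∈ X | K z z = 0} = {z ∈ X | ∀ f ∈ {f | MemA2 X f}, f z = 0} := by
    ext z
    exact and_congr_right fun hz => hK.apply_self_eq_zero_iff hz
  rw [hset] at hc
  obtain ⟨ψ, hψ, hne, hψX⟩ := exists_disc_of_not_countable hX (fun f hf => hf.1) hc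
  have hψX' : ∀ s ∈ ball (0 : ℂ) 2, ψ s ∈ X ∧ K (ψ s) (ψ s) = 0 := fun s hs =>
    ⟨(hψX s hs).1, (hK.apply_self_eq_zero_iff (hψX s hs).1).2 (hψX s hs).2⟩
  have hmem : ∀ t ∈ Icc (0 : ℝ) 1, (t : ℂ) ∈ ball (0 : ℂ) 2 := fun t ht => by
    rw [mem_ball_zero_iff, Complex.norm_real, Real.norm_of_nonneg ht.1]
    linarith [ht.2]
  have hadm : IsAdmissibleCurve X (ψ 0) (ψ 1) (fun t : ℝ => ψ t) := by
    refine isAdmissibleCurve_of_contDiffOn (by simp) (by simp)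
      (fun t ht => (hψX' _ (hmem t ht)).1) ?_
    have h1 : ContDiffOn ℝ 1 ψ (ball 0 2) :=
      (DifferentiableOn.contDiffOn_complex isOpen_ball hψ 1).restrict_scalars ℝ
    exact h1.comp Complex.ofRealCLM.contDiff.contDiffOn hmem
  have hlen : bergmanLength K (fun t : ℝ => ψ t) = 0 := by
    rw [bergmanLength]
    refine (intervalIntegral.integral_congr fun t ht => ?_).trans
      intervalIntegral.integral_zero
    rw [uIcc_of_le zero_le_one] at ht
    have h1 : HasDerivAt (fun t : ℝ => ψ t) (deriv ψ t) t := by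
      have h2 : HasDerivAt ψ (deriv ψ t) (t : ℂ) :=
        (hψ.differentiableAt (isOpen_ball.mem_nhds (hmem t ht))).hasDerivAt
      have h3 := h2.scomp t Complex.ofRealCLM.hasDerivAt
      simpa [Function.comp_def] using h3
    simp only [h1.deriv]
    exact bergmanMetric_eq_zero_of_disc hX hK isOpen_ball hψ hψX' (hmem t ht)
  have h1 := bergmanDist_le (K := K) hadm
  rw [hlen] at h1
  have hz0 := (hψX' _ (hmem 0 ⟨le_rfl, zero_le_one⟩)).1
  have hz1 := (hψX' _ (hmem 1 ⟨zero_le_one, le_rfl⟩)).1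
  rw [Complex.ofReal_zero] at hz0
  rw [Complex.ofReal_one] at hz1
  exact absurd (hdist _ hz0 _ hz1 hne) h1.not_gt

/-- Local Lipschitz continuity of the Bergman distance off the zeros of `K(z, z)`. -/
theorem IsBergmanKernel.exists_bergmanDist_le_add (hX : IsOpen X) (hK : IsBergmanKernel X K)
    (hdist : BergmanDistIsDistance X K) {x₀ p : Fin n → ℂ} (hx₀ : x₀ ∈ X) (hp : p ∈ X)
    (hp0 : K p p ≠ 0) : ∃ R > 0, ball p R ⊆ X ∧ ∃ C ≥ 0, ∀ z ∈ ball p R, ∀ w ∈ ball p R,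
      bergmanDist X K x₀ w ≤ bergmanDist X K x₀ z + C * ‖w - z‖ := by
  obtain ⟨R, hR, hRX, C, hC, hb⟩ := hK.exists_bergmanMetric_le hX hp hp0
  refine ⟨R, hR, hRX, C, hC, fun z hz w hw => le_of_forall_pos_le_add fun ε hε => ?_⟩
  obtain ⟨γ₀, hγ₀⟩ := exists_isAdmissibleCurve hdist hx₀ (hRX hz)
  obtain ⟨γ, hγ, hlen⟩ := exists_bergmanLength_lt (K := K) hγ₀ (lt_add_of_pos_right _ hε)
  obtain ⟨γ', hγ', hlen'⟩ := hγ.append_segment (K := K) (w' := w) (C := C) fun s hs => by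
    have : z + s • (w - z) ∈ ball p R := (convex_ball p R).add_smul_sub_mem hz hw hs
    exact ⟨hRX this, (hb _ this).2⟩
  linarith [bergmanDist_le (K := K) hγ']

theorem IsBergmanKernel.exists_bergmanDist_lt (hX : IsOpen X) (hK : IsBergmanKernel X K)
    (hdist : BergmanDistIsDistance X K) {x₀ p : Fin n → ℂ} (hx₀ : x₀ ∈ X) (hp : p ∈ X)
    (hp0 : K p p ≠ 0) : ∃ N ∈ 𝓝 p, ∃ r, N ⊆ bergmanBall X K x₀ r := by
  obtain ⟨R, hR, hRX, C, hC, hb⟩ := hK.exists_bergmanDist_le_add hX hdist hx₀ hp hp0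
  refine ⟨ball p R, ball_mem_nhds p hR, bergmanDist X K x₀ p + C * R + 1, fun w hw =>
    ⟨hRX hw, ?_⟩⟩
  have h1 := hb p (mem_ball_self hR) w hw
  have h2 : C * ‖w - p‖ ≤ C * R := mul_le_mul_of_nonneg_left (mem_ball_iff_norm.1 hw).le hC
  linarith

end DiagonalZeros

section SmallBalls

variable {n : ℕ} {X : Set (Fin n → ℂ)} {K : (Fin n → ℂ) → (Fin n → ℂ) → ℂ}

/-- A path leaving `{ρ < c}` crosses the level `{ρ = c}`, so it is at least as long as the distance
to this level. -/
theorem le_bergmanDist_of_forall_level (hdist : BergmanDistIsDistance X K) {x₀ z : Fin n → ℂ}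
    (hx₀ : x₀ ∈ X) (hz : z ∈ X) {ρ : (Fin n → ℂ) → ℝ} (hρ : Continuous ρ) {c r : ℝ}
    (h0 : ρ x₀ < c) (hzc : c ≤ ρ z) (hr : ∀ y ∈ X, ρ y = c → r ≤ bergmanDist X K x₀ y) :
    r ≤ bergmanDist X K x₀ z := by
  have hne : x₀ ≠ z := fun h => by
    rw [h] at h0
    exact h0.not_ge hzc
  refine le_of_forall_gt_imp_ge_of_dense fun L hL => ?_
  obtain ⟨γ₀, hγ₀⟩ := exists_isAdmissibleCurve hdist hx₀ hz
  obtain ⟨γ, hγ, hlen⟩ := exists_bergmanLength_lt (K := K) hγ₀ hL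
  have hint : IntervalIntegrable (fun t => bergmanMetric K (γ t) (deriv γ t)) volume 0 1 := by
    by_contra hni
    have h1 : bergmanLength K γ = 0 := intervalIntegral.integral_undef hni
    have h2 := bergmanDist_le (K := K) hγ
    rw [h1] at h2
    exact (hdist _ hx₀ _ hz hne).not_ge h2
  obtain ⟨τ, hτ, hτc⟩ : c ∈ (fun t => ρ (γ t)) '' Icc (0 : ℝ) 1 := by
    refine intermediate_value_Icc zero_le_one (hρ.comp_continuousOn hγ.2.2.2.1) ⟨?_, ?_⟩
    · exact (congrArg ρ hγ.1).trans_le h0.le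
    · exact hzc.trans_eq (congrArg ρ hγ.2.1).symm
  have hτ0 : 0 < τ := hτ.1.lt_of_ne fun h => by
    rw [← h] at hτc
    simp only [hγ.1] at hτc
    exact h0.ne hτc
  obtain ⟨γ', hγ', hle⟩ := hγ.truncate hint hτ0 hτ.2
  have := hr (γ τ) (hγ.2.2.1 τ hτ) hτc
  linarith [bergmanDist_le (K := K) hγ']

/-- Small Bergman balls are contained in a Euclidean ball inside the domain. -/
theorem IsBergmanKernel.exists_bergmanBall_subset_image (hX : IsOpen X) (hK : IsBergmanKernel X K)
    (hdist : BergmanDistIsDistance X K) {x₀ : Fin n → ℂ} (hx₀ : x₀ ∈ X) :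
    ∃ r > 0, ∃ f : (Fin n → ℂ) → (Fin n → ℂ), DifferentiableOn ℂ f (euclUnitBall n) ∧
      InjOn f (euclUnitBall n) ∧ f '' euclUnitBall n ⊆ X ∧
      bergmanBall X K x₀ r ⊆ f '' euclUnitBall n := by
  obtain ⟨R, hR, hRX⟩ := nhds_basis_closedBall.mem_iff.1 (hX.mem_nhds hx₀)
  let q : (Fin n → ℂ) → ℝ := fun z => ∑ μ, ‖z μ - x₀ μ‖ ^ 2
  have hq : Continuous q := by fun_prop
  have hqR : ∀ ε, 0 < ε → ε ≤ R → ∀ z, q z ≤ ε ^ 2 → z ∈ closedBall x₀ R := by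
    intro ε hε hεR z hz
    rw [mem_closedBall, dist_pi_le_iff hR.le]
    intro μ
    rw [dist_eq_norm]
    refine le_trans (le_of_sq_le_sq ?_ hε.le) hεR
    exact (Finset.single_le_sum (f := fun μ => ‖z μ - x₀ μ‖ ^ 2) (fun _ _ => by positivity)
      (Finset.mem_univ μ)).trans hz
  have hc := hK.countable_diag_zero hX hdist
  obtain ⟨ε, hεZ, hε, hεR⟩ : ∃ ε ∈ ((fun z => √(q z)) '' {z ∈ X | K z z = 0})ᶜ, 0 < ε ∧ ε < R :=
    ((hc.image _).dense_compl ℝ).exists_between hR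
  have hS : IsCompact {z | q z = ε ^ 2} :=
    (isCompact_closedBall x₀ R).of_isClosed_subset (isClosed_eq hq continuous_const)
      fun z hz => hqR ε hε hεR.le z (le_of_eq hz)
  have hq0 : q x₀ < ε ^ 2 := by
    simp only [q, sub_self, norm_zero]
    simpa using pow_pos hε 2
  obtain ⟨r, hr, hrS⟩ : ∃ r > 0, ∀ z ∈ {z | q z = ε ^ 2}, r ≤ bergmanDist X K x₀ z := by
    refine hS.induction_on (p := fun s => ∃ r > 0, ∀ z ∈ s, r ≤ bergmanDist X K x₀ z)
      ⟨1, one_pos, fun z hz => hz.elim⟩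
      (fun s t hst ⟨r, hr, h⟩ => ⟨r, hr, fun z hz => h z (hst hz)⟩)
      ?_ ?_
    · rintro s t ⟨r, hr, h⟩ ⟨r', hr', h'⟩
      refine ⟨min r r', lt_min hr hr', fun z hz => hz.elim (fun hz => ?_) fun hz => ?_⟩
      · exact (min_le_left _ _).trans (h z hz)
      · exact (min_le_right _ _).trans (h' z hz)
    · intro p (hp : q p = ε ^ 2)
      have hpX : p ∈ X := hRX (hqR ε hε hεR.le p hp.le)
      have hp0 : K p p ≠ 0 := fun h => hεZ ⟨p, ⟨hpX, h⟩, by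
        simp only [hp]
        exact Real.sqrt_sq hε.le⟩
      have hne : x₀ ≠ p := fun h => hq0.ne (h ▸ hp)
      have hd := hdist _ hx₀ _ hpX hne
      obtain ⟨R', hR', -, C, hC, hb⟩ := hK.exists_bergmanDist_le_add hX hdist hx₀ hpX hp0
      have hev : ∀ᶠ z in 𝓝 p, C * ‖p - z‖ < bergmanDist X K x₀ p / 2 := by
        have : ContinuousAt (fun z => C * ‖p - z‖) p := by fun_prop
        refine this.eventually (gt_mem_nhds ?_)
        simp only [sub_self, norm_zero, mul_zero]
        exact half_pos hd
      refine ⟨_, mem_nhdsWithin_of_mem_nhds (inter_mem (ball_mem_nhds p hR') hev), _, half_pos hd,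
        fun z hz => ?_⟩
      have h1 := hb z hz.1 p (mem_ball_self hR')
      have h2 : C * ‖p - z‖ < bergmanDist X K x₀ p / 2 := hz.2
      linarith
  have hεc : (ε : ℂ) ≠ 0 := by exact_mod_cast hε.ne'
  have hqf : ∀ z, q (x₀ + (ε : ℂ) • z) = ε ^ 2 * ∑ μ, ‖z μ‖ ^ 2 := fun z => by
    simp [q, mul_pow, Finset.mul_sum]
  refine ⟨r, hr, fun z => x₀ + (ε : ℂ) • z, by fun_prop, fun z _ w _ h => ?_, ?_, ?_⟩
  · exact smul_right_injective _ hεc (add_left_cancel h)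
  · rintro _ ⟨z, hz, rfl⟩
    refine hRX (hqR ε hε hεR.le _ ?_)
    rw [hqf]
    have : ∑ μ, ‖z μ‖ ^ 2 < 1 := hz
    nlinarith [pow_pos hε 2]
  · rintro z ⟨hzX, hz⟩
    have hlt : q z < ε ^ 2 := by
      by_contra! h
      exact hz.not_ge (le_bergmanDist_of_forall_level hdist hx₀ hzX hq hq0 h fun y _ hy => hrS y hy)
    have hz' : x₀ + (ε : ℂ) • ((ε : ℂ)⁻¹ • (z - x₀)) = z := by
      rw [smul_inv_smul₀ hεc, add_sub_cancel]
    refine ⟨(ε : ℂ)⁻¹ • (z - x₀), ?_, hz'⟩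
    have := hqf ((ε : ℂ)⁻¹ • (z - x₀))
    rw [hz'] at this
    rw [this] at hlt
    exact lt_of_mul_lt_mul_left (hlt.trans_eq (mul_one _).symm) (by positivity)

/-- If the Bergman–Fridman invariant vanishes at a point, then arbitrarily large Bergman balls are
contained in biholomorphic images of the unit ball. -/
theorem IsBergmanKernel.exists_bergmanBall_subset_of_fridmanInv_eq_zero (hX : IsOpen X)
    (hK : IsBergmanKernel X K) (hdist : BergmanDistIsDistance X K) {x₀ : Fin n → ℂ} (hx₀ : x₀ ∈ X)
    (h0 : fridmanInv X K x₀ = 0) (r : ℝ) :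
    ∃ f : (Fin n → ℂ) → (Fin n → ℂ), DifferentiableOn ℂ f (euclUnitBall n) ∧
      InjOn f (euclUnitBall n) ∧ f '' euclUnitBall n ⊆ X ∧
      bergmanBall X K x₀ r ⊆ f '' euclUnitBall n := by
  obtain ⟨r₀, hr₀, f₀, hf₀⟩ := hK.exists_bergmanBall_subset_image hX hdist hx₀
  have hm : 0 < max r 1 := lt_max_of_lt_right one_pos
  have hlt : fridmanInv X K x₀ < 1 / max r 1 := h0 ▸ one_div_pos.2 hm
  obtain ⟨c, ⟨s, hs, rfl, f, h1, h2, h3, h4⟩, hc⟩ :=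
    exists_lt_of_csInf_lt (by exact ⟨_, r₀, hr₀, rfl, f₀, hf₀⟩) hlt
  have hrs : r ≤ s := (le_max_left _ _).trans ((one_div_lt_one_div hs hm).1 hc).le
  exact ⟨f, h1, h2, h3, fun z hz => h4 ⟨hz.1, hz.2.trans_le hrs⟩⟩

end SmallBalls

section Hartogs

variable {E : Type*} [NormedAddCommGroup E] [NormedSpace ℂ E] [FiniteDimensional ℂ E]

/-- Continuity principle for a biholomorphic image of the unit ball: if a family of discs has all
its boundaries and one of its members in the image, then all the discs lie in the image. -/
theorem disc_mem_image_of_circle_mem_image {f : E → E} (hf : DifferentiableOn ℂ f (ball 0 1))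
    (hinj : InjOn f (ball 0 1)) {a v : E} {δ : ℝ}
    (hcirc : ∀ w ∈ closedBall a δ, ∀ ζ : ℂ, ‖ζ‖ = 1 → w + ζ • v ∈ f '' ball 0 1) {w₀ : E}
    (hw₀ : w₀ ∈ ball a δ) (hdisc : ∀ ζ : ℂ, ‖ζ‖ ≤ 1 → w₀ + ζ • v ∈ f '' ball 0 1) {w : E}
    (hw : w ∈ ball a δ) {ζ : ℂ} (hζ : ‖ζ‖ ≤ 1) : w + ζ • v ∈ f '' ball 0 1 := by
  have : ProperSpace E := FiniteDimensional.proper ℂ E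
  obtain ⟨hopen, g, hg, hgf⟩ := exists_inverse_of_injOn rfl isOpen_ball hf hinj
  have hgB : ∀ x ∈ f '' ball 0 1, g x ∈ ball (0 : E) 1 ∧ f (g x) = x := by
    rintro _ ⟨z, hz, rfl⟩
    rw [hgf z hz]
    exact ⟨hz, rfl⟩
  have hadd : Continuous fun p : E × ℂ => p.1 + p.2 • v := by fun_prop
  obtain ⟨c, hc1, hc⟩ : ∃ c < 1, ∀ w ∈ closedBall a δ, ∀ ζ : ℂ, ‖ζ‖ = 1 → ‖g (w + ζ • v)‖ ≤ c := by
    have hcomp : IsCompact (closedBall a δ ×ˢ sphere (0 : ℂ) 1) :=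
      (isCompact_closedBall a δ).prod (isCompact_sphere 0 1)
    have hmaps : MapsTo (fun p : E × ℂ => p.1 + p.2 • v) (closedBall a δ ×ˢ sphere (0 : ℂ) 1)
        (f '' ball 0 1) := fun p hp => hcirc _ hp.1 _ (mem_sphere_zero_iff_norm.1 hp.2)
    obtain ⟨p, hp, hmax⟩ := hcomp.exists_isMaxOn ⟨(w₀, 1), ball_subset_closedBall hw₀, by simp⟩
      (hg.continuousOn.comp hadd.continuousOn hmaps).norm
    exact ⟨_, mem_ball_zero_iff.1 (hgB _ (hmaps hp)).1, fun w hw ζ hζ =>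
      hmax (show (w, ζ) ∈ _ from ⟨hw, mem_sphere_zero_iff_norm.2 hζ⟩)⟩
  have hcB : closedBall (0 : E) c ⊆ ball 0 1 := closedBall_subset_ball hc1
  have hL : IsClosed (f '' closedBall 0 c) :=
    ((isCompact_closedBall 0 c).image_of_continuousOn (hf.continuousOn.mono hcB)).isClosed
  let A : Set E := {w | ∀ ζ ∈ closedBall (0 : ℂ) 1, w + ζ • v ∈ f '' ball 0 1}
  have hA : IsOpen A := isOpen_iff_mem_nhds.2 fun w hw =>
    (isCompact_closedBall (0 : ℂ) 1).eventually_forall_of_forall_eventually fun ζ hζ =>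
      (hadd.continuousAt (x := (w, ζ))).eventually (hopen.mem_nhds (hw ζ hζ))
  have hAL : ∀ w ∈ ball a δ ∩ A, ∀ ζ : ℂ, ‖ζ‖ ≤ 1 → w + ζ • v ∈ f '' closedBall 0 c := by
    intro w hw ζ hζ
    have hmem : ∀ ζ : ℂ, ‖ζ‖ ≤ 1 → w + ζ • v ∈ f '' ball 0 1 := fun ζ hζ =>
      hw.2 ζ (mem_closedBall_zero_iff.2 hζ)
    refine ⟨g (w + ζ • v), mem_closedBall_zero_iff.2 ?_, (hgB _ (hmem ζ hζ)).2⟩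
    exact norm_le_of_forall_circle
      (fun ζ hζ => hg.differentiableAt (hopen.mem_nhds (hmem ζ hζ)))
      (hc w (ball_subset_closedBall hw.1)) hζ
  refine (convex_ball a δ).isPreconnected.subset_of_closure_inter_subset hA
    ⟨w₀, hw₀, fun ζ hζ => hdisc ζ (mem_closedBall_zero_iff.1 hζ)⟩ (fun w hw ζ hζ => ?_) hw ζ
    (mem_closedBall_zero_iff.2 hζ)
  have hw' : w ∈ closure (ball a δ ∩ A) := isOpen_ball.inter_closure ⟨hw.2, hw.1⟩
  have := map_mem_closure (f := fun w => w + ζ • v) (by fun_prop) hw' fun w hw =>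
    hAL w hw ζ (mem_closedBall_zero_iff.1 hζ)
  rw [hL.closure_eq] at this
  exact image_mono hcB this

/-- If biholomorphic images of the unit ball exhaust a domain off a countable set, they exhaust
the domain. -/
theorem exists_nhds_subset_image_of_countable (hE : 1 < Module.finrank ℂ E) {X Z : Set E}
    (hX : IsOpen X) (hZ : Z.Countable) (hXZ : IsOpen (X \ Z)) {f : ℕ → E → E}
    (hd : ∀ k, DifferentiableOn ℂ (f k) (ball 0 1)) (hinj : ∀ k, InjOn (f k) (ball 0 1))
    (hex : ∀ x ∈ X \ Z, ∃ N ∈ 𝓝 x, ∀ᶠ k in atTop, N ⊆ f k '' ball 0 1) {a : E} (ha : a ∈ X) :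
    ∃ N ∈ 𝓝 a, ∀ᶠ k in atTop, N ⊆ f k '' ball 0 1 := by
  have : ProperSpace E := FiniteDimensional.proper ℂ E
  have hcompact : ∀ Q : Set E, IsCompact Q → Q ⊆ X \ Z → ∀ᶠ k in atTop, Q ⊆ f k '' ball 0 1 := by
    intro Q hQ hQX
    refine hQ.induction_on (p := fun s => ∀ᶠ k in atTop, s ⊆ f k '' ball 0 1)
      (Eventually.of_forall fun k => empty_subset _)
      (fun s t hst h => h.mono fun k hk => hst.trans hk)
      (fun s t hs ht => (hs.and ht).mono fun k hk => union_subset hk.1 hk.2) fun x hx => ?_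
    obtain ⟨N, hN, h⟩ := hex x (hQX hx)
    exact ⟨N, mem_nhdsWithin_of_mem_nhds hN, h⟩
  obtain ⟨v, δ, hδ, h1, h2, h3⟩ := exists_tube_of_countable hE hX hZ hXZ ha
  obtain ⟨w₀, hw₀, hw₀Z⟩ := h3 δ hδ
  have hadd : Continuous fun p : E × ℂ => p.1 + p.2 • v := by fun_prop
  have hcirc := hcompact _ (((isCompact_closedBall a δ).prod (isCompact_sphere (0 : ℂ) 1)).image
    hadd) <| by
      rintro _ ⟨⟨w, ζ⟩, ⟨hw, hζ⟩, rfl⟩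
      rw [mem_sphere_zero_iff_norm] at hζ
      exact ⟨h1 w hw ζ hζ.le, h2 w hw ζ hζ⟩
  have hdisc := hcompact _ (((isCompact_singleton (x := w₀)).prod
    (isCompact_closedBall (0 : ℂ) 1)).image hadd) <| by
      rintro _ ⟨⟨w, ζ⟩, ⟨hw, hζ⟩, rfl⟩
      obtain rfl : w = w₀ := hw
      rw [mem_closedBall_zero_iff] at hζ
      exact ⟨h1 w (ball_subset_closedBall hw₀) ζ hζ, hw₀Z ζ hζ⟩
  refine ⟨ball a δ, ball_mem_nhds a hδ, ?_⟩
  filter_upwards [hcirc, hdisc] with k hk1 hk2 w hw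
  have := disc_mem_image_of_circle_mem_image (hd k) (hinj k)
    (fun w hw ζ hζ => hk1 ⟨(w, ζ), ⟨hw, mem_sphere_zero_iff_norm.2 hζ⟩, rfl⟩) hw₀
    (fun ζ hζ => hk2 ⟨(w₀, ζ), ⟨rfl, mem_closedBall_zero_iff.2 hζ⟩, rfl⟩) hw (ζ := 0) (by simp)
  simpa using this

end Hartogs

section OneVariable

variable {X : Set (Fin 1 → ℂ)} {K : (Fin 1 → ℂ) → (Fin 1 → ℂ) → ℂ}

/-- In one variable, the Bergman space is stable under division by `t - z₀` of the functions that
vanish at `z₀`. -/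
theorem MemA2.dslope (hX : IsOpen X) {φ : ℂ → ℂ} (hφ : MemA2 X fun z => φ (z 0))
    {z₀ : Fin 1 → ℂ} (hz₀ : z₀ ∈ X) (h0 : φ (z₀ 0) = 0) :
    MemA2 X fun z => dslope φ (z₀ 0) (z 0) := by
  have hcst : ∀ z : Fin 1 → ℂ, (fun _ => z 0) = z := fun z => funext fun i => by
    rw [Subsingleton.elim i 0]
  have hU : IsOpen {t : ℂ | (fun _ => t) ∈ X} := hX.preimage (by fun_prop)
  have hφU : DifferentiableOn ℂ φ {t : ℂ | (fun _ => t) ∈ X} :=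
    hφ.1.comp (t := X) (f := fun t _ => t) (by fun_prop) fun t ht => ht
  have hdU : DifferentiableOn ℂ (_root_.dslope φ (z₀ 0)) {t : ℂ | (fun _ => t) ∈ X} := by
    refine (Complex.differentiableOn_dslope (hU.mem_nhds ?_)).2 hφU
    rwa [mem_ofPred_eq, hcst]
  have hd : DifferentiableOn ℂ (fun z : Fin 1 → ℂ => _root_.dslope φ (z₀ 0) (z 0)) X := by
    refine hdU.comp (f := fun z : Fin 1 → ℂ => z 0) (by fun_prop) fun z hz => ?_
    rwa [mem_ofPred_eq, hcst]
  obtain ⟨δ, hδ, hδX⟩ := nhds_basis_closedBall.mem_iff.1 (hX.mem_nhds hz₀)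
  obtain ⟨C, hC⟩ := (isCompact_closedBall z₀ δ).exists_bound_of_continuousOn
    (hd.continuousOn.mono hδX)
  have hC0 : 0 ≤ C := (norm_nonneg _).trans (hC z₀ (mem_closedBall_self hδ.le))
  have h1 : MemLp ((closedBall z₀ δ).indicator fun _ => C) 2 (volume.restrict X) :=
    memLp_indicator_const 2 isClosed_closedBall.measurableSet C
      (.inr ((Measure.restrict_apply_le _ _).trans_lt
        (isCompact_closedBall z₀ δ).measure_lt_top).ne)
  have h2 : MemLp (fun z => δ⁻¹ * ‖φ (z 0)‖) 2 (volume.restrict X) := hφ.2.norm.const_mul δ⁻¹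
  refine ⟨hd, (h1.add h2).mono' (hd.continuousOn.aestronglyMeasurable hX.measurableSet) ?_⟩
  refine Eventually.of_forall fun z => ?_
  have h3 : 0 ≤ δ⁻¹ * ‖φ (z 0)‖ := by positivity
  rw [Pi.add_apply]
  by_cases hz : z ∈ closedBall z₀ δ
  · rw [indicator_of_mem hz]
    exact (hC z hz).trans (le_add_of_nonneg_right h3)
  · rw [indicator_of_notMem hz, zero_add]
    have hδz : δ < ‖z 0 - z₀ 0‖ := by
      rw [mem_closedBall, not_le, dist_eq_norm] at hz
      refine hz.trans_le ((pi_norm_le_iff_of_nonneg (norm_nonneg _)).2 fun i => ?_)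
      rw [Subsingleton.elim i 0, Pi.sub_apply]
    have hne : z 0 ≠ z₀ 0 := sub_ne_zero.1 (norm_pos_iff.1 (hδ.trans hδz))
    rw [dslope_of_ne _ hne, slope, h0, vsub_eq_sub, sub_zero, norm_smul, norm_inv]
    gcongr

/-- In one variable, `K(z, z)` does not vanish if it has only countably many zeros. -/
theorem IsBergmanKernel.diag_ne_zero_of_countable (hX : IsOpen X) (hK : IsBergmanKernel X K)
    (hc : {z ∈ X | K z z = 0}.Countable) {z₀ : Fin 1 → ℂ} (hz₀ : z₀ ∈ X) : K z₀ z₀ ≠ 0 := by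
  intro h0
  have hvan := (hK.apply_self_eq_zero_iff hz₀).1 h0
  have hcst : ∀ z : Fin 1 → ℂ, (fun _ => z 0) = z := fun z => funext fun i => by
    rw [Subsingleton.elim i 0]
  obtain ⟨δ, hδ, hδX⟩ := Metric.isOpen_iff.1 hX z₀ hz₀
  obtain ⟨x₁, hx₁, hx₁Z⟩ := (hc.dense_compl ℂ).inter_open_nonempty _ isOpen_ball
    ⟨z₀, mem_ball_self (x := z₀) hδ⟩
  have hx₁X : x₁ ∈ X := hδX hx₁
  have hne : K x₁ x₁ ≠ 0 := fun h => hx₁Z ⟨hx₁X, h⟩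
  let φ : ℂ → ℂ := fun t => K (fun _ => t) x₁
  have hφ : MemA2 X fun z => φ (z 0) := by
    simp only [φ, hcst]
    exact hK.1 x₁ hx₁X
  have hmem : MapsTo (fun (t : ℂ) (_ : Fin 1) => t) (ball (z₀ 0) δ) (ball z₀ δ) := fun t ht => by
    rw [mem_ball, dist_pi_lt_iff hδ]
    intro i
    rw [Subsingleton.elim i 0]
    exact ht
  have hφd : DifferentiableOn ℂ φ (ball (z₀ 0) δ) :=
    (hK.1 x₁ hx₁X).1.comp (t := X) (f := fun t _ => t) (by fun_prop) (hmem.mono_right hδX)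
  have hφa : AnalyticOnNhd ℂ φ (ball (z₀ 0) δ) := hφd.analyticOnNhd isOpen_ball
  obtain ⟨p, hp⟩ := hφa (z₀ 0) (mem_ball_self hδ)
  have hiter : ∀ k, MemA2 X fun z => ((Function.swap dslope (z₀ 0))^[k] φ) (z 0) := by
    intro k
    induction k with
    | zero => exact hφ
    | succ k ih =>
      rw [Function.iterate_succ_apply']
      exact ih.dslope hX hz₀ (hvan _ ih)
  have hp0 : p = 0 := by
    by_contra h
    exact hp.iterate_dslope_fslope_ne_zero h (hvan _ (hiter p.order))
  have hzero := hφa.eqOn_zero_of_preconnected_of_eventuallyEq_zero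
    (convex_ball (z₀ 0) δ).isPreconnected (mem_ball_self hδ) (hp.locally_zero_iff.2 hp0)
  have hx : φ (x₁ 0) = 0 := hzero ((dist_le_pi_dist x₁ z₀ 0).trans_lt hx₁)
  simp only [φ, hcst] at hx
  exact hne hx

end OneVariable

section Determinant

variable {n : ℕ} {X : Set (Fin n → ℂ)} {K : (Fin n → ℂ) → (Fin n → ℂ) → ℂ}

theorem isOpen_euclUnitBall : IsOpen (euclUnitBall n) :=
  isOpen_lt (by fun_prop) continuous_const

theorem zero_mem_euclUnitBall : (0 : Fin n → ℂ) ∈ euclUnitBall n := by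
  simp [euclUnitBall]

theorem DifferentiableOn.det_fderiv {U : Set (Fin n → ℂ)} (hU : IsOpen U)
    {f : (Fin n → ℂ) → (Fin n → ℂ)} (hf : DifferentiableOn ℂ f U) :
    DifferentiableOn ℂ (fun z => (fderiv ℂ f z).det) U := by
  have h : (fun z => (fderiv ℂ f z).det) =
      fun z => Matrix.det (Matrix.of fun i j => fderiv ℂ f z (Pi.single j 1) i) := by
    funext z
    rw [ContinuousLinearMap.det, ← LinearMap.det_toMatrix']
    congr 1
  have hd := DifferentiableOn.fderiv_complex hU hf
  have he : ∀ i j, DifferentiableOn ℂ (fun z => fderiv ℂ f z (Pi.single j 1) i) U := fun i j =>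
    differentiableOn_pi.1 (hd.clm_apply (differentiableOn_const _)) i
  rw [h]
  simp only [Matrix.det_apply, Matrix.of_apply]
  refine DifferentiableOn.fun_sum fun σ _ => DifferentiableOn.const_smul ?_ _
  exact fun z hz => (HasFDerivWithinAt.finsetProd fun i _ =>
    (he (σ i) i z hz).hasFDerivWithinAt).differentiableWithinAt

theorem abs_det_restrictScalars (A : (Fin n → ℂ) →L[ℂ] (Fin n → ℂ)) :
    |(A.restrictScalars ℝ).det| = ‖A.det‖ ^ 2 := by
  have h : (A.restrictScalars ℝ).det = Complex.normSq A.det := by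
    rw [← Algebra.norm_complex_apply]
    exact LinearMap.det_restrictScalars (R := ℝ) (f := (A : (Fin n → ℂ) →ₗ[ℂ] (Fin n → ℂ)))
  rw [h, Complex.normSq_eq_norm_sq, abs_of_nonneg (by positivity)]

/-- The Bergman kernel bounds the derivatives at the centre of biholomorphic maps from the unit
ball into `X`. -/
theorem IsBergmanKernel.exists_norm_det_fderiv_le (hK : IsBergmanKernel X K)
    {x₁ : Fin n → ℂ} (hx₁ : x₁ ∈ X) (h1 : K x₁ x₁ ≠ 0) :
    ∃ C : ℝ, ∀ f : (Fin n → ℂ) → (Fin n → ℂ), DifferentiableOn ℂ f (euclUnitBall n) →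
      InjOn f (euclUnitBall n) → MapsTo f (euclUnitBall n) X → f 0 = x₁ →
      ‖(fderiv ℂ f 0).det‖ ≤ C := by
  obtain ⟨ρ, hρ, hρB⟩ := Metric.isOpen_iff.1 (isOpen_euclUnitBall (n := n)) 0 zero_mem_euclUnitBall
  set I : ℝ≥0∞ := ∫⁻ z in X, ‖K z x₁‖ₑ ^ 2
  have hI : I ≠ ∞ := by
    rw [show I = _ from (hK.1 x₁ hx₁).lintegral_enorm_sq]
    exact ENNReal.ofReal_ne_top
  set c : ℝ≥0∞ := ‖K x₁ x₁‖ₑ ^ 2 * volume (ball (0 : Fin n → ℂ) ρ)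
  have hc0 : c ≠ 0 := mul_ne_zero (pow_ne_zero 2 (enorm_ne_zero.2 h1))
    (measure_ball_pos volume 0 hρ).ne'
  refine ⟨√(I / c).toReal, fun f hf hinj hfX hf0 => Real.le_sqrt_of_sq_le ?_⟩
  have hfρ := hf.mono hρB
  have hF : DifferentiableOn ℂ (fun z => K (f z) x₁ * (fderiv ℂ f z).det) (ball 0 ρ) :=
    ((hK.1 x₁ hx₁).1.comp hfρ (hfX.mono_left hρB)).mul
      (DifferentiableOn.det_fderiv isOpen_ball hfρ)
  have h2 := enorm_sq_mul_volume_ball_le hF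
  have h3 : ∫⁻ z in ball 0 ρ, ‖K (f z) x₁ * (fderiv ℂ f z).det‖ₑ ^ 2 ≤ I := by
    calc _ = ∫⁻ z in ball 0 ρ, ENNReal.ofReal |((fderiv ℂ f z).restrictScalars ℝ).det| *
          ‖K (f z) x₁‖ₑ ^ 2 := by
          refine lintegral_congr fun z => ?_
          rw [abs_det_restrictScalars, ENNReal.ofReal_pow (norm_nonneg _), ofReal_norm, enorm_mul,
            mul_pow, mul_comm]
      _ = ∫⁻ z in f '' ball 0 ρ, ‖K z x₁‖ₑ ^ 2 :=
          (lintegral_image_eq_lintegral_abs_det_fderiv_mul volume measurableSet_ball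
            (fun z hz => ((hfρ.differentiableAt
              (isOpen_ball.mem_nhds hz)).hasFDerivAt.restrictScalars ℝ).hasFDerivWithinAt)
            (hinj.mono hρB) fun z => ‖K z x₁‖ₑ ^ 2).symm
      _ ≤ I := lintegral_mono_set ((image_mono hρB).trans hfX.image_subset)
  have h4 : ‖(fderiv ℂ f 0).det‖ₑ ^ 2 ≤ I / c := by
    rw [ENNReal.le_div_iff_mul_le (.inl hc0) (.inr hI)]
    refine le_trans (le_of_eq ?_) (h2.trans h3)
    simp only [hf0, enorm_mul, mul_pow, c]
    ring
  have h5 := ENNReal.toReal_mono (ENNReal.div_ne_top hI hc0) h4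
  simpa using h5

end Determinant

section Euclidean

variable {n : ℕ} {X : Set (Fin n → ℂ)} {K : (Fin n → ℂ) → (Fin n → ℂ) → ℂ}

theorem ofLp_mem_euclUnitBall {x : EuclideanSpace ℂ (Fin n)} :
    EuclideanSpace.equiv (Fin n) ℂ x ∈ euclUnitBall n ↔ x ∈ ball 0 1 := by
  rw [mem_ball_zero_iff, ← sq_lt_one_iff₀ (norm_nonneg x), EuclideanSpace.norm_sq_eq]
  rfl

theorem mapsTo_equiv_symm_euclUnitBall :
    MapsTo (EuclideanSpace.equiv (Fin n) ℂ).symm (euclUnitBall n) (ball 0 1) := fun z hz => by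
  rwa [← ofLp_mem_euclUnitBall, ContinuousLinearEquiv.apply_symm_apply]

/-- A self-map of Euclidean space, read on `Fin n → ℂ`. -/
def piConj (φ : EuclideanSpace ℂ (Fin n) → EuclideanSpace ℂ (Fin n)) :
    (Fin n → ℂ) → (Fin n → ℂ) :=
  fun z => EuclideanSpace.equiv (Fin n) ℂ (φ ((EuclideanSpace.equiv (Fin n) ℂ).symm z))

theorem DifferentiableOn.piConj {φ : EuclideanSpace ℂ (Fin n) → EuclideanSpace ℂ (Fin n)}
    (hφ : DifferentiableOn ℂ φ (ball 0 1)) : DifferentiableOn ℂ (piConj φ) (euclUnitBall n) :=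
  (EuclideanSpace.equiv (Fin n) ℂ).differentiable.comp_differentiableOn
    (hφ.comp (EuclideanSpace.equiv (Fin n) ℂ).symm.differentiable.differentiableOn
      mapsTo_equiv_symm_euclUnitBall)

theorem Set.InjOn.piConj {φ : EuclideanSpace ℂ (Fin n) → EuclideanSpace ℂ (Fin n)}
    (hφ : InjOn φ (ball 0 1)) : InjOn (piConj φ) (euclUnitBall n) := fun _ hz _ hw h =>
  (EuclideanSpace.equiv (Fin n) ℂ).symm.injective
    (hφ (mapsTo_equiv_symm_euclUnitBall hz) (mapsTo_equiv_symm_euclUnitBall hw)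
      ((EuclideanSpace.equiv (Fin n) ℂ).injective h))

theorem image_piConj (φ : EuclideanSpace ℂ (Fin n) → EuclideanSpace ℂ (Fin n)) :
    piConj φ '' euclUnitBall n = EuclideanSpace.equiv (Fin n) ℂ '' (φ '' ball 0 1) := by
  ext y
  constructor
  · rintro ⟨z, hz, rfl⟩
    exact ⟨_, ⟨_, mapsTo_equiv_symm_euclUnitBall hz, rfl⟩, rfl⟩
  · rintro ⟨_, ⟨x, hx, rfl⟩, rfl⟩
    refine ⟨_, ofLp_mem_euclUnitBall.2 hx, ?_⟩
    rw [piConj, ContinuousLinearEquiv.symm_apply_apply]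

theorem det_fderiv_piConj {φ : EuclideanSpace ℂ (Fin n) → EuclideanSpace ℂ (Fin n)}
    (hφ : DifferentiableAt ℂ φ 0) : (fderiv ℂ (piConj φ) 0).det = (fderiv ℂ φ 0).det := by
  set e := EuclideanSpace.equiv (Fin n) ℂ
  have h0 : e.symm 0 = 0 := map_zero _
  have h1 : HasFDerivAt (piConj φ) ((e : _ →L[ℂ] _).comp ((fderiv ℂ φ 0).comp
      (e.symm : _ →L[ℂ] _))) 0 :=
    e.hasFDerivAt.comp (0 : Fin n → ℂ)
      (HasFDerivAt.comp (g := φ) (0 : Fin n → ℂ) (h0 ▸ hφ.hasFDerivAt) e.symm.hasFDerivAt)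
  rw [h1.fderiv]
  exact LinearMap.det_conj (fderiv ℂ φ 0 : _ →ₗ[ℂ] _) e.toLinearEquiv

/-- Biholomorphic images of the Euclidean unit ball that contain the Bergman balls of all radii
exhaust the domain. -/
theorem IsBergmanKernel.exists_nhds_subset_image (hX : IsOpen X) (hK : IsBergmanKernel X K)
    (hdist : BergmanDistIsDistance X K) [NeZero n] {x₀ : Fin n → ℂ} (hx₀ : x₀ ∈ X)
    {f : ℕ → EuclideanSpace ℂ (Fin n) → EuclideanSpace ℂ (Fin n)}
    (hd : ∀ k, DifferentiableOn ℂ (f k) (ball 0 1)) (hinj : ∀ k, InjOn (f k) (ball 0 1))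
    (hball : ∀ k : ℕ, bergmanBall X K x₀ k ⊆ EuclideanSpace.equiv (Fin n) ℂ '' (f k '' ball 0 1))
    {x : EuclideanSpace ℂ (Fin n)} (hx : EuclideanSpace.equiv (Fin n) ℂ x ∈ X) :
    ∃ N ∈ 𝓝 x, ∀ᶠ k in atTop, N ⊆ f k '' ball 0 1 := by
  set e := EuclideanSpace.equiv (Fin n) ℂ
  set Z : Set (Fin n → ℂ) := {z ∈ X | K z z = 0}
  have hZ : Z.Countable := hK.countable_diag_zero hX hdist
  have hex : ∀ x, e x ∈ X → K (e x) (e x) ≠ 0 →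
      ∃ N ∈ 𝓝 x, ∀ᶠ k in atTop, N ⊆ f k '' ball 0 1 := by
    intro x hx h0
    obtain ⟨N, hN, r, hNr⟩ := hK.exists_bergmanDist_lt hX hdist hx₀ hx h0
    obtain ⟨m, hm⟩ := exists_nat_ge r
    refine ⟨e ⁻¹' N, e.continuous.continuousAt hN, (eventually_ge_atTop m).mono fun k hk y hy => ?_⟩
    have hrk : r ≤ k := hm.trans (Nat.cast_le.2 hk)
    obtain ⟨y', hy', h⟩ := hball k ⟨(hNr hy).1, (hNr hy).2.trans_le hrk⟩
    rwa [← e.injective h]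
  rcases Nat.lt_or_ge 1 n with hn | hn
  · have hXZ : IsOpen (e ⁻¹' X \ e ⁻¹' Z) := by
      have : e ⁻¹' X \ e ⁻¹' Z = e ⁻¹' {u ∈ X | K u u ≠ 0} := by
        ext y
        simp +contextual [Z]
      rw [this]
      exact (hK.isOpen_diag_ne_zero hX).preimage e.continuous
    exact exists_nhds_subset_image_of_countable (by simpa using hn) (hX.preimage e.continuous)
      (hZ.preimage e.injective) hXZ hd hinj
      (fun y hy => hex y hy.1 fun h => hy.2 ⟨hy.1, h⟩) hx
  · obtain rfl : n = 1 := le_antisymm hn (NeZero.one_le)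
    exact hex x hx (hK.diag_ne_zero_of_countable hX hZ hx)

theorem biholomorphic_of_fridmanInv_eq_zero [NeZero n] (hX : IsOpen X) (hXc : IsConnected X)
    (hK : IsBergmanKernel X K) (hdist : BergmanDistIsDistance X K) {x₀ : Fin n → ℂ} (hx₀ : x₀ ∈ X)
    (h0 : fridmanInv X K x₀ = 0) : Biholomorphic (euclUnitBall n) X := by
  set e := EuclideanSpace.equiv (Fin n) ℂ with he
  obtain ⟨x₁, hx₁, hx₁Z⟩ := ((hK.countable_diag_zero hX hdist).dense_compl ℂ).inter_open_nonempty
    _ hX ⟨x₀, hx₀⟩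
  have hne : K x₁ x₁ ≠ 0 := fun h => hx₁Z ⟨hx₁, h⟩
  choose f hfd hfi hfX hfb using fun k : ℕ =>
    hK.exists_bergmanBall_subset_of_fridmanInv_eq_zero hX hdist hx₀ h0 k
  have hmaps : MapsTo e (ball 0 1) (euclUnitBall n) := fun x hx => ofLp_mem_euclUnitBall.2 hx
  have hFd : ∀ k, DifferentiableOn ℂ (fun x => e.symm (f k (e x))) (ball 0 1) := fun k =>
    e.symm.differentiable.comp_differentiableOn
      ((hfd k).comp e.differentiable.differentiableOn hmaps)
  have hFi : ∀ k, InjOn (fun x => e.symm (f k (e x))) (ball 0 1) := fun k x hx y hy h =>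
    e.injective (hfi k (hmaps hx) (hmaps hy) (e.symm.injective h))
  obtain ⟨C, hC⟩ := hK.exists_norm_det_fderiv_le hx₁ hne
  obtain ⟨h, hhd, hhi, hhX⟩ := exists_biholomorphism_of_exhaustion (X := e ⁻¹' X)
    (hX.preimage e.continuous)
    (e.toHomeomorph.isPreconnected_preimage.2 hXc.isPreconnected)
    (x₁ := e.symm x₁) (by rwa [mem_preimage, e.apply_symm_apply]) hFd hFi
    (fun k x hx => by
      rw [mem_preimage, e.apply_symm_apply]
      exact hfX k ⟨_, hmaps hx, rfl⟩)
    (fun x hx => hK.exists_nhds_subset_image hX hdist hx₀ hFd hFi (fun k z hz => by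
      obtain ⟨w, hw, rfl⟩ := hfb k hz
      refine ⟨_, ⟨e.symm w, mapsTo_equiv_symm_euclUnitBall hw, rfl⟩, ?_⟩
      rw [← he, e.apply_symm_apply, e.apply_symm_apply]) hx)
    (C := C) fun φ hφ hφi hφX hφ0 => by
      rw [← det_fderiv_piConj (hφ.differentiableAt (ball_mem_nhds 0 one_pos))]
      refine hC _ hφ.piConj hφi.piConj (fun z hz => hφX (mapsTo_equiv_symm_euclUnitBall hz)) ?_
      rw [piConj, map_zero, hφ0]
      exact e.apply_symm_apply x₁
  refine ⟨piConj h, hhd.piConj, hhi.piConj, ?_⟩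
  rw [image_piConj, hhX]
  exact image_preimage_eq X e.surjective

theorem fridmanInv_eq_zero_of_biholomorphic (h : Biholomorphic (euclUnitBall n) X)
    (x : Fin n → ℂ) : fridmanInv X K x = 0 := by
  obtain ⟨f, hd, hi, rfl⟩ := h
  refine le_antisymm (le_of_forall_pos_le_add fun ε hε => ?_) (Real.sInf_nonneg ?_)
  · rw [zero_add]
    refine csInf_le ⟨0, ?_⟩ ⟨1 / ε, one_div_pos.2 hε, (one_div_one_div ε).symm, f, hd, hi,
      Subset.rfl, fun z hz => hz.1⟩
    rintro _ ⟨r, hr, rfl, -⟩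
    exact (one_div_pos.2 hr).le
  · rintro _ ⟨r, hr, rfl, -⟩
    exact (one_div_pos.2 hr).le

theorem biholomorphic_euclUnitBall_zero {X : Set (Fin 0 → ℂ)} (hX : X.Nonempty) :
    Biholomorphic (euclUnitBall 0) X := by
  have h : euclUnitBall 0 = univ := eq_univ_of_forall fun z => by simp [euclUnitBall]
  exact ⟨id, differentiableOn_id, injOn_id _, by
    rw [image_id, h, Subsingleton.eq_univ_of_nonempty hX]⟩

end Euclidean

/-- if `h_X` vanishes at one point then `X` is biholomorphic to the ball
and `h_X ≡ 0`. -/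
theorem biholomorphic_ball_of_fridman_eq_zero {n : ℕ} (X : Set (Fin n → ℂ))
    (hXopen : IsOpen X) (hXconn : IsConnected X)
    (K : (Fin n → ℂ) → (Fin n → ℂ) → ℂ) (hK : IsBergmanKernel X K)
    (hdist : BergmanDistIsDistance X K)
    (x0 : Fin n → ℂ) (hx0 : x0 ∈ X) (h0 : fridmanInv X K x0 = 0) :
    Biholomorphic (euclUnitBall n) X ∧ ∀ x ∈ X, fridmanInv X K x = 0 := by
  have hX : Biholomorphic (euclUnitBall n) X := by
    rcases Nat.eq_zero_or_pos n with rfl | hn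
    · exact biholomorphic_euclUnitBall_zero ⟨x0, hx0⟩
    · have : NeZero n := ⟨hn.ne'⟩
      exact biholomorphic_of_fridmanInv_eq_zero hXopen hXconn hK hdist hx0 h0
  exact ⟨hX, fun x _ => fridmanInv_eq_zero_of_biholomorphic hX x⟩

end
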